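/- Let (a_ℓ)_{ℓ≥1} be a sequence of positive integers, let α = [0; a_1, a_2, …] be the value of the corresponding infinite continued fraction, and let (p_ℓ/q_ℓ)_{ℓ≥1} denote its convergents. Assume that the sequence (q_ℓ^{1/ℓ})_{ℓ≥1} is bounded, and set M = limsup_{ℓ→∞} q_ℓ^{1/ℓ} and m = liminf_{ℓ→∞} q_ℓ^{1/ℓ}. Let w and w' be non-negative real numbers with w > (2w'+1)·(log M / log m) − w'. If (a_ℓ)_{ℓ≥1} satisfies Condition (**)_{w,w'}, then α is transcendental. -/

import Mathlib

open Filter Topology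

/-- Denominators of the convergents of the continued fraction `[0; a 0, a 1, ...]`,
where `a i` denotes the `(i+1)`-st partial quotient `a_{i+1}` of the paper:
`q_0 = 1`, `q_1 = a_1`, `q_{ℓ+1} = a_{ℓ+1} q_ℓ + q_{ℓ-1}`. -/
def cfQ (a : ℕ → ℕ) : ℕ → ℕ
  | 0 => 1
  | 1 => a 0
  | n + 2 => a (n + 1) * cfQ a (n + 1) + cfQ a n

/-- Numerators of the convergents of the continued fraction `[0; a 0, a 1, ...]`:
`p_0 = 0`, `p_1 = 1`, `p_{ℓ+1} = a_{ℓ+1} p_ℓ + p_{ℓ-1}`. -/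
def cfP (a : ℕ → ℕ) : ℕ → ℕ
  | 0 => 0
  | 1 => 1
  | n + 2 => a (n + 1) * cfP a (n + 1) + cfP a n

/-- An infinite word is eventually periodic. -/
def EventuallyPeriodic {A : Type*} (x : ℕ → A) : Prop :=
  ∃ k p : ℕ, 0 < p ∧ ∀ n, k ≤ n → x (n + p) = x n

/-- The infinite word `x` begins with `V^w`: its prefix of length `⌈w·|V|⌉`
coincides with the prefix of the same length of the periodic word `VVV⋯`. -/
def BeginsWithPow {A : Type*} (x : ℕ → A) (V : List A) (w : ℝ) : Prop :=
  ∀ i < ⌈w * V.length⌉₊, V[i % V.length]? = some (x i)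

/-- Condition `(*)_w`: `x` is not eventually periodic and there is a sequence of
nonempty finite words `V n` with strictly increasing lengths such that `x` begins
with `(V n)^w` for every `n`. -/
def ConditionStar {A : Type*} (x : ℕ → A) (w : ℝ) : Prop :=
  ¬ EventuallyPeriodic x ∧
    ∃ V : ℕ → List A, (∀ n, V n ≠ []) ∧
      (StrictMono fun n => (V n).length) ∧
      ∀ n, BeginsWithPow x (V n) w

/-- Condition `(**)_{w,w'}`: `x` is not eventually periodic and there are
sequences of finite words `U n` and nonempty words `V n`, with `(|V n|)` strictly
increasing and `|U n|/|V n| ≤ w'`, such that `U n` followed by the prefix of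
length `⌈w·|V n|⌉` of the periodic word `(V n)(V n)(V n)⋯` is a prefix of `x`. -/
def ConditionStarStar {A : Type*} (x : ℕ → A) (w w' : ℝ) : Prop :=
  ¬ EventuallyPeriodic x ∧
    ∃ U V : ℕ → List A, (∀ n, V n ≠ []) ∧
      (StrictMono fun n => (V n).length) ∧
      (∀ n, ((U n).length : ℝ) ≤ w' * ((V n).length : ℝ)) ∧
      ∀ n, (∀ i < (U n).length, (U n)[i]? = some (x i)) ∧
        BeginsWithPow (fun i => x ((U n).length + i)) (V n) w


namespace Sst
open MvPolynomial

section wn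
variable {σ τ R S : Type*} [Fintype σ] [Fintype τ] [SeminormedCommRing R] [SeminormedCommRing S]

/-- weighted l1-norm of a polynomial -/
noncomputable def wn (ρ : σ → ℝ) (f : MvPolynomial σ R) : ℝ :=
  ∑ j ∈ f.support, ‖coeff j f‖ * ∏ v, ρ v ^ j v

lemma wn_eq_of_subset (ρ : σ → ℝ) (f : MvPolynomial σ R) (s : Finset (σ →₀ ℕ))
    (h : f.support ⊆ s) : wn ρ f = ∑ j ∈ s, ‖coeff j f‖ * ∏ v, ρ v ^ j v := by
  unfold wn
  apply Finset.sum_subset h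
  intro x _ hx
  rw [MvPolynomial.notMem_support_iff.1 hx]; simp

lemma wpow_nonneg {ρ : σ → ℝ} (hρ : ∀ v, 0 ≤ ρ v) (j : σ →₀ ℕ) : 0 ≤ ∏ v, ρ v ^ j v :=
  Finset.prod_nonneg fun v _ => pow_nonneg (hρ v) _

lemma wn_nonneg {ρ : σ → ℝ} (hρ : ∀ v, 0 ≤ ρ v) (f : MvPolynomial σ R) : 0 ≤ wn ρ f :=
  Finset.sum_nonneg fun j _ => mul_nonneg (norm_nonneg _) (wpow_nonneg hρ j)

@[simp] lemma wn_zero (ρ : σ → ℝ) : wn ρ (0 : MvPolynomial σ R) = 0 := by simp [wn]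

lemma wn_add_le {ρ : σ → ℝ} (hρ : ∀ v, 0 ≤ ρ v) (f g : MvPolynomial σ R) :
    wn ρ (f + g) ≤ wn ρ f + wn ρ g := by
  classical
  rw [wn_eq_of_subset ρ (f+g) (f.support ∪ g.support) support_add,
    wn_eq_of_subset ρ f (f.support ∪ g.support) Finset.subset_union_left,
    wn_eq_of_subset ρ g (f.support ∪ g.support) Finset.subset_union_right,
    ← Finset.sum_add_distrib]
  refine Finset.sum_le_sum fun j _ => ?_
  rw [← add_mul, coeff_add]
  exact mul_le_mul_of_nonneg_right (norm_add_le _ _) (wpow_nonneg hρ j)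

lemma wn_sum_le {ρ : σ → ℝ} (hρ : ∀ v, 0 ≤ ρ v) {α : Type*} (s : Finset α)
    (f : α → MvPolynomial σ R) : wn ρ (∑ a ∈ s, f a) ≤ ∑ a ∈ s, wn ρ (f a) := by
  classical
  induction s using Finset.induction_on with
  | empty => simp
  | insert a s ha ih =>
    rw [Finset.sum_insert ha, Finset.sum_insert ha]
    exact (wn_add_le hρ _ _).trans (by linarith)

lemma wn_neg (ρ : σ → ℝ) (f : MvPolynomial σ R) : wn ρ (-f) = wn ρ f := by
  simp [wn, support_neg]

lemma wn_monomial (ρ : σ → ℝ) (j : σ →₀ ℕ) (c : R) :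
    wn ρ (monomial j c) = ‖c‖ * ∏ v, ρ v ^ j v := by
  classical
  rw [wn_eq_of_subset ρ _ {j} support_monomial_subset]
  simp

lemma wn_C (ρ : σ → ℝ) (c : R) : wn ρ (C c : MvPolynomial σ R) = ‖c‖ := by
  rw [← monomial_zero', wn_monomial]; simp

lemma wn_X [NormOneClass R] (ρ : σ → ℝ) (v : σ) : wn ρ (X v : MvPolynomial σ R) = ρ v := by
  classical
  rw [X, wn_monomial]
  simp [Finsupp.single_apply, Finset.prod_ite_eq]

lemma wn_one [NormOneClass R] (ρ : σ → ℝ) : wn ρ (1 : MvPolynomial σ R) = 1 := by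
  rw [← C_1, wn_C]; simp

lemma coeff_le_wn {ρ : σ → ℝ} (hρ : ∀ v, 0 ≤ ρ v) (f : MvPolynomial σ R) (j : σ →₀ ℕ) :
    ‖coeff j f‖ * ∏ v, ρ v ^ j v ≤ wn ρ f := by
  by_cases h : j ∈ f.support
  · exact Finset.single_le_sum (f := fun j => ‖coeff j f‖ * ∏ v, ρ v ^ j v)
      (fun j _ => mul_nonneg (norm_nonneg _) (wpow_nonneg hρ j)) h
  · rw [MvPolynomial.notMem_support_iff.1 h]; simpa using wn_nonneg hρ f

lemma wn_mul_le {ρ : σ → ℝ} (hρ : ∀ v, 0 ≤ ρ v) (f g : MvPolynomial σ R) :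
    wn ρ (f * g) ≤ wn ρ f * wn ρ g := by
  have h : f * g = ∑ i ∈ f.support, ∑ j ∈ g.support,
      monomial (i + j) (coeff i f * coeff j g) := by
    conv_lhs => rw [as_sum f, as_sum g]
    rw [Finset.sum_mul_sum]
    simp [monomial_mul]
  rw [h]
  refine (wn_sum_le hρ _ _).trans ?_
  rw [wn, wn, Finset.sum_mul_sum]
  refine Finset.sum_le_sum fun i _ => (wn_sum_le hρ _ _).trans (Finset.sum_le_sum fun j _ => ?_)
  rw [wn_monomial]
  simp only [Finsupp.add_apply, pow_add, Finset.prod_mul_distrib]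
  calc _ ≤ (‖coeff i f‖ * ‖coeff j g‖) * ((∏ v, ρ v ^ i v) * ∏ v, ρ v ^ j v) :=
        mul_le_mul_of_nonneg_right (norm_mul_le _ _)
          (mul_nonneg (wpow_nonneg hρ i) (wpow_nonneg hρ j))
    _ = _ := by ring

lemma wn_pow_le [NormOneClass R] {ρ : σ → ℝ} (hρ : ∀ v, 0 ≤ ρ v) (f : MvPolynomial σ R) (n : ℕ) :
    wn ρ (f ^ n) ≤ wn ρ f ^ n := by
  induction n with
  | zero => simp [wn_one]
  | succ n ih =>
    rw [pow_succ, pow_succ]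
    exact (wn_mul_le hρ _ _).trans (mul_le_mul_of_nonneg_right ih (wn_nonneg hρ f))

lemma wn_prod_le [NormOneClass R] {ρ : σ → ℝ} (hρ : ∀ v, 0 ≤ ρ v) {α : Type*} (s : Finset α)
    (f : α → MvPolynomial σ R) : wn ρ (∏ a ∈ s, f a) ≤ ∏ a ∈ s, wn ρ (f a) := by
  classical
  induction s using Finset.induction_on with
  | empty => simp [wn_one]
  | insert a s ha ih =>
    rw [Finset.prod_insert ha, Finset.prod_insert ha]
    exact (wn_mul_le hρ _ _).trans (mul_le_mul_of_nonneg_left ih (wn_nonneg hρ _))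

lemma wn_hom_le [NormOneClass S] {ρ : τ → ℝ} (hρ : ∀ v, 0 ≤ ρ v)
    {ρ' : σ → ℝ} (h : MvPolynomial σ R →+* MvPolynomial τ S)
    (hC : ∀ r, wn ρ (h (C r)) ≤ ‖r‖) (hX : ∀ v, wn ρ (h (X v)) ≤ ρ' v) (f : MvPolynomial σ R) :
    wn ρ (h f) ≤ wn ρ' f := by
  conv_lhs => rw [as_sum f, map_sum]
  refine (wn_sum_le hρ _ _).trans ?_
  rw [wn]
  refine Finset.sum_le_sum fun j _ => ?_
  rw [monomial_eq, Finsupp.prod_fintype _ _ (by simp), map_mul, map_prod]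
  refine (wn_mul_le hρ _ _).trans ?_
  refine mul_le_mul (hC _) ?_ (wn_nonneg hρ _) (norm_nonneg _)
  refine (wn_prod_le hρ _ _).trans ?_
  refine Finset.prod_le_prod (fun v _ => wn_nonneg hρ _) fun v _ => ?_
  rw [map_pow]
  exact (wn_pow_le hρ _ _).trans (pow_le_pow_left₀ (wn_nonneg hρ _) (hX v) _)

lemma wn_le_of_le_one {ρ : σ → ℝ} (hρ : ∀ v, 0 ≤ ρ v) (f : MvPolynomial σ R) (B : ℝ)
    (hB : ∀ j ∈ f.support, ∏ v, ρ v ^ j v ≤ B) : wn ρ f ≤ wn 1 f * B := by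
  rw [wn, wn, Finset.sum_mul]
  refine Finset.sum_le_sum fun j hj => ?_
  simpa using mul_le_mul_of_nonneg_left (hB j hj) (norm_nonneg _)

lemma wn_map_le (ρ : σ → ℝ) (hρ : ∀ v, 0 ≤ ρ v) (ψ : R →+* S) (f : MvPolynomial σ R)
    (hψ : ∀ r, ‖ψ r‖ ≤ ‖r‖) : wn ρ (map ψ f) ≤ wn ρ f := by
  rw [wn_eq_of_subset ρ _ _ (support_map_subset ψ f), wn]
  refine Finset.sum_le_sum fun j _ => ?_
  rw [coeff_map]
  exact mul_le_mul_of_nonneg_right (hψ _) (wpow_nonneg hρ j)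

end wn

section wt
variable {σ : Type*} [Fintype σ] {R : Type*} [CommRing R]

/-- weight of an exponent vector -/
noncomputable def wt (w : σ → ℝ) (j : σ →₀ ℕ) : ℝ := ∑ i, w i * j i

lemma wt_add (w : σ → ℝ) (i j : σ →₀ ℕ) : wt w (i + j) = wt w i + wt w j := by
  simp [wt, mul_add, Finset.sum_add_distrib]

@[simp] lemma wt_zero (w : σ → ℝ) : wt w (0 : σ →₀ ℕ) = 0 := by simp [wt]

lemma wt_nonneg {w : σ → ℝ} (hw : ∀ i, 0 ≤ w i) (j : σ →₀ ℕ) : 0 ≤ wt w j :=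
  Finset.sum_nonneg fun i _ => mul_nonneg (hw i) (Nat.cast_nonneg _)

/-- all monomials have weight at least θ -/
def WGe (w : σ → ℝ) (θ : ℝ) (f : MvPolynomial σ R) : Prop := ∀ j ∈ f.support, θ ≤ wt w j

lemma WGe.mono {w : σ → ℝ} {θ θ' : ℝ} {f : MvPolynomial σ R} (h : WGe w θ f) (hl : θ' ≤ θ) :
    WGe w θ' f := fun j hj => hl.trans (h j hj)

lemma WGe.zero (w : σ → ℝ) (θ : ℝ) : WGe w θ (0 : MvPolynomial σ R) := by
  intro j hj; simp at hj

lemma WGe.add {w : σ → ℝ} {θ : ℝ} {f g : MvPolynomial σ R} (hf : WGe w θ f) (hg : WGe w θ g) :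
    WGe w θ (f + g) := by
  classical
  intro j hj
  rcases Finset.mem_union.1 (support_add hj) with h | h
  exacts [hf j h, hg j h]

lemma WGe.sum {w : σ → ℝ} {θ : ℝ} {α : Type*} (s : Finset α) {f : α → MvPolynomial σ R}
    (hf : ∀ a ∈ s, WGe w θ (f a)) : WGe w θ (∑ a ∈ s, f a) := by
  classical
  induction s using Finset.induction_on with
  | empty => simpa using WGe.zero w θ
  | insert a s ha ih =>
    rw [Finset.sum_insert ha]
    exact (hf a (by simp)).add (ih fun b hb => hf b (by simp [hb]))

lemma WGe.mul {w : σ → ℝ} {θ θ' : ℝ} {f g : MvPolynomial σ R} (hf : WGe w θ f)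
    (hg : WGe w θ' g) : WGe w (θ + θ') (f * g) := by
  classical
  intro j hj
  obtain ⟨a, ha, b, hb, rfl⟩ := Finset.mem_add.1 (support_mul f g hj)
  rw [wt_add]
  exact add_le_add (hf a ha) (hg b hb)

lemma WGe.of_nonneg {w : σ → ℝ} (hw : ∀ i, 0 ≤ w i) (f : MvPolynomial σ R) : WGe w 0 f :=
  fun j _ => wt_nonneg hw j

lemma WGe.mul_right {w : σ → ℝ} (hw : ∀ i, 0 ≤ w i) {θ : ℝ} {f : MvPolynomial σ R}
    (hf : WGe w θ f) (g : MvPolynomial σ R) : WGe w θ (f * g) := by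
  simpa using hf.mul (WGe.of_nonneg hw g)

lemma WGe.prod {w : σ → ℝ} (hw : ∀ i, 0 ≤ w i) {α : Type*} (s : Finset α) {θ : α → ℝ}
    {f : α → MvPolynomial σ R}
    (hf : ∀ a ∈ s, WGe w (θ a) (f a)) : WGe w (∑ a ∈ s, θ a) (∏ a ∈ s, f a) := by
  classical
  induction s using Finset.induction_on with
  | empty => simpa using WGe.of_nonneg hw 1
  | insert a s ha ih =>
    rw [Finset.sum_insert ha, Finset.prod_insert ha]
    exact (hf a (by simp)).mul (ih fun b hb => hf b (by simp [hb]))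

lemma WGe.max {w : σ → ℝ} {θ θ' : ℝ} {f : MvPolynomial σ R} (hf : WGe w θ f)
    (hg : WGe w θ' f) : WGe w (max θ θ') f := fun j hj => max_le (hf j hj) (hg j hj)

lemma WGe.map {S : Type*} [CommRing S] {w : σ → ℝ} {θ : ℝ} {f : MvPolynomial σ R}
    (hf : WGe w θ f) (ψ : R →+* S) : WGe w θ (map ψ f) :=
  fun j hj => hf j (support_map_subset ψ f hj)

end wt
end Sst


namespace Sst
open MvPolynomial
set_option linter.unusedSectionVars false
set_option linter.unusedSimpArgs false
set_option linter.unusedVariables false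

section hd
variable {σ : Type*} [Fintype σ] {R : Type*} [CommRing R]

/-- product of binomials -/
def bn (ν I : σ →₀ ℕ) : ℕ := ∏ i, (ν i).choose (I i)

lemma bn_eq_zero {ν I : σ →₀ ℕ} (h : ¬ I ≤ ν) : bn ν I = 0 := by
  rw [Finsupp.le_def] at h; push Not at h
  obtain ⟨i, hi⟩ := h
  exact Finset.prod_eq_zero (Finset.mem_univ i) (Nat.choose_eq_zero_of_lt hi)

lemma bn_le (ν I : σ →₀ ℕ) : bn ν I ≤ 2 ^ (∑ i, ν i) := by
  rw [← Finset.prod_pow_eq_pow_sum]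
  exact Finset.prod_le_prod' fun i _ => Nat.choose_le_two_pow _ _

/-- Hasse derivative -/
noncomputable def hd (I : σ →₀ ℕ) (f : MvPolynomial σ R) : MvPolynomial σ R :=
  ∑ ν ∈ f.support, monomial (ν - I) ((bn ν I : R) * coeff ν f)

lemma coeff_hd (I μ : σ →₀ ℕ) (f : MvPolynomial σ R) :
    coeff μ (hd I f) = (bn (μ + I) I : R) * coeff (μ + I) f := by
  classical
  rw [hd, coeff_sum]
  simp only [coeff_monomial]
  rw [Finset.sum_eq_single (μ + I)]
  · simp
  · intro ν _ hne
    by_cases hle : I ≤ ν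
    · rw [if_neg]
      intro h; apply hne; rw [← h]; exact (tsub_add_cancel_of_le hle).symm
    · simp [bn_eq_zero hle]
  · intro h
    rw [MvPolynomial.notMem_support_iff.1 h]; simp

lemma hd_add (I : σ →₀ ℕ) (f g : MvPolynomial σ R) : hd I (f + g) = hd I f + hd I g := by
  ext μ; simp [coeff_hd, mul_add]

lemma hd_C_mul (I : σ →₀ ℕ) (c : R) (f : MvPolynomial σ R) : hd I (C c * f) = C c * hd I f := by
  ext μ; simp [coeff_hd, coeff_C_mul]; ring

lemma hd_zero' (I : σ →₀ ℕ) : hd I (0 : MvPolynomial σ R) = 0 := by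
  ext μ; simp [coeff_hd]

lemma hd_sum (I : σ →₀ ℕ) {α : Type*} (s : Finset α) (f : α → MvPolynomial σ R) :
    hd I (∑ a ∈ s, f a) = ∑ a ∈ s, hd I (f a) := by
  ext μ; simp [coeff_hd, coeff_sum, Finset.mul_sum]

lemma hd_map {S : Type*} [CommRing S] (ψ : R →+* S) (I : σ →₀ ℕ) (f : MvPolynomial σ R) :
    hd I (map ψ f) = map ψ (hd I f) := by
  ext μ; simp [coeff_hd, coeff_map]

lemma hd_zero_left (f : MvPolynomial σ R) : hd 0 f = f := by
  ext μ; simp [coeff_hd, bn]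

lemma hd_succ (I : σ →₀ ℕ) (h : σ) (f : MvPolynomial σ R) :
    C ((I h : R) + 1) * hd (I + Finsupp.single h 1) f = pderiv h (hd I f) := by
  classical
  ext μ
  rw [coeff_C_mul, coeff_hd, coeff_pderiv, coeff_hd]
  have e : μ + (I + Finsupp.single h 1) = μ + Finsupp.single h 1 + I := by
    rw [add_comm I, add_assoc]
  rw [e, ← mul_assoc]
  set ν := μ + Finsupp.single h 1 + I with hν
  have key : (I h + 1) * bn ν (I + Finsupp.single h 1) = bn ν I * (μ h + 1) := by
    unfold bn
    rw [← Finset.mul_prod_erase _ _ (Finset.mem_univ h), ← Finset.mul_prod_erase _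
      (fun i => (ν i).choose (I i)) (Finset.mem_univ h)]
    have h1 : ∏ x ∈ Finset.univ.erase h, (ν x).choose ((I + Finsupp.single h 1 : σ →₀ ℕ) x)
        = ∏ x ∈ Finset.univ.erase h, (ν x).choose (I x) := by
      refine Finset.prod_congr rfl fun x hx => ?_
      have : x ≠ h := Finset.ne_of_mem_erase hx
      simp [Finsupp.single_apply, this.symm]
    rw [h1]
    have h2 : (I + Finsupp.single h 1 : σ →₀ ℕ) h = I h + 1 := by simp
    have h3 : ν h - I h = μ h + 1 := by simp [hν]
    rw [h2]
    have h4 := Nat.choose_succ_right_eq (ν h) (I h)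
    rw [h3] at h4
    calc _ = ((ν h).choose (I h + 1) * (I h + 1)) *
          ∏ x ∈ Finset.univ.erase h, (ν x).choose (I x) := by ring
      _ = _ := by rw [h4]; ring
  have key' : ((I h : R) + 1) * (bn ν (I + Finsupp.single h 1) : R) = (bn ν I : R) * ((μ h : R) + 1) := by
    exact_mod_cast congrArg (Nat.cast (R := R)) key
  rw [key']; ring

/-- translation -/
noncomputable def tr (ξ : σ → R) : MvPolynomial σ R →ₐ[R] MvPolynomial σ R :=
  aeval fun i => X i + C (ξ i)

lemma pderiv_tr (ξ : σ → R) (h : σ) (f : MvPolynomial σ R) :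
    pderiv h (tr ξ f) = tr ξ (pderiv h f) := by
  classical
  induction f using MvPolynomial.induction_on with
  | C a => simp [tr]
  | add p q hp hq => simp [hp, hq]
  | mul_X p i hp =>
    rw [map_mul, Derivation.leibniz, hp, Derivation.leibniz, map_add]
    simp only [smul_eq_mul, map_mul, tr, aeval_X, map_add, pderiv_C, pderiv_X, add_zero]
    by_cases hi : i = h
    · subst hi; simp
    · simp [hi]

end hd

lemma finsupp_ind {σ : Type*} {P : (σ →₀ ℕ) → Prop} (h0 : P 0)
    (hs : ∀ I h, P I → P (I + Finsupp.single h 1)) (I : σ →₀ ℕ) : P I := by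
  classical
  suffices H : ∀ n (I : σ →₀ ℕ), I.sum (fun _ k => k) = n → P I from H _ I rfl
  intro n
  induction n with
  | zero =>
    intro I hI
    have : I = 0 := by
      ext i
      by_contra hne
      have : I i ≤ I.sum (fun _ k => k) := 
        Finset.single_le_sum (f := fun i => I i) (fun _ _ => Nat.zero_le _) (Finsupp.mem_support_iff.2 hne)
      simp at hne; omega
    rw [this]; exact h0
  | succ n ih =>
    intro I hI
    have : I ≠ 0 := by rintro rfl; simp at hI
    obtain ⟨h, hh⟩ := Finsupp.ne_iff.1 this
    have e : I = (I - Finsupp.single h 1) + Finsupp.single h 1 := by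
      refine (tsub_add_cancel_of_le ?_).symm
      rw [Finsupp.single_le_iff]; simp at hh; omega
    rw [e] at hI ⊢
    refine hs _ _ (ih _ ?_)
    rw [Finsupp.sum_add_index' (by simp) (by simp)] at hI
    simpa using hI

lemma hd_tr {σ : Type*} [Fintype σ] (ξ : σ → ℚ) (I : σ →₀ ℕ) (f : MvPolynomial σ ℚ) :
    hd I (tr ξ f) = tr ξ (hd I f) := by
  classical
  induction I using finsupp_ind with
  | h0 => simp [hd_zero_left]
  | hs I h ih =>
    have h1 := hd_succ I h (tr ξ f)
    rw [ih, pderiv_tr, ← hd_succ, map_mul] at h1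
    have h2 : tr ξ (C ((I h : ℚ) + 1)) = (C ((I h : ℚ) + 1) : MvPolynomial σ ℚ) := by
      simp [tr]
    rw [h2] at h1
    refine mul_left_cancel₀ ?_ h1
    rw [Ne, C_eq_zero]; positivity

lemma WGe.hd {σ : Type*} [Fintype σ] {R : Type*} [CommRing R] {w : σ → ℝ} {θ : ℝ}
    {f : MvPolynomial σ R} (hf : WGe w θ f) (I : σ →₀ ℕ) : WGe w (θ - wt w I) (hd I f) := by
  intro j hj
  rw [mem_support_iff, coeff_hd] at hj
  have := hf (j + I) (by rw [mem_support_iff]; exact right_ne_zero_of_mul hj)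
  rw [wt_add] at this; linarith

lemma degreeOf_hd_le {σ : Type*} [Fintype σ] {R : Type*} [CommRing R] (f : MvPolynomial σ R)
    (I : σ →₀ ℕ) (i : σ) : degreeOf i (hd I f) ≤ degreeOf i f := by
  classical
  rw [degreeOf_le_iff]
  intro j hj
  rw [mem_support_iff, coeff_hd] at hj
  have := (degreeOf_le_iff.1 (le_refl (degreeOf i f))) (j + I)
    (by rw [mem_support_iff]; exact right_ne_zero_of_mul hj)
  simp at this; omega

lemma wn_hd_le {σ : Type*} [Fintype σ] (f : MvPolynomial σ ℤ)
    (I : σ →₀ ℕ) (d : σ → ℕ) (hd' : ∀ i, degreeOf i f ≤ d i) :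
    wn 1 (hd I f) ≤ 2 ^ (∑ i, d i) * wn 1 f := by
  classical
  rw [Sst.hd]
  refine (wn_sum_le (by simp) _ _).trans ?_
  rw [wn, Finset.mul_sum]
  refine Finset.sum_le_sum fun ν hν => ?_
  rw [wn_monomial]
  simp only [Pi.one_apply, one_pow, Finset.prod_const_one, mul_one]
  refine (norm_mul_le _ _).trans (mul_le_mul_of_nonneg_right ?_ (norm_nonneg _))
  have h1 : (bn ν I : ℝ) ≤ 2 ^ (∑ i, ν i) := by exact_mod_cast bn_le ν I
  have h2 : ∑ i, ν i ≤ ∑ i, d i := Finset.sum_le_sum fun i _ =>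
    (degreeOf_le_iff.1 (hd' i)) ν hν
  simp only [Int.norm_natCast]
  exact h1.trans (pow_le_pow_right₀ (by norm_num) h2)

section wronskian
variable {σ : Type*} [Fintype σ]

lemma exists_distinct_degrees (m : MonomialOrder σ) (s : ℕ) :
    ∀ (V : Submodule ℚ (MvPolynomial σ ℚ)) [FiniteDimensional ℚ V],
      Module.finrank ℚ V = s → ∃ f : Fin s → MvPolynomial σ ℚ,
        (∀ j, f j ∈ V ∧ f j ≠ 0) ∧ Function.Injective fun j => m.degree (f j) := by
  classical
  induction s with
  | zero => intro V _ _; exact ⟨Fin.elim0, fun j => j.elim0, fun j => j.elim0⟩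
  | succ s ih =>
    intro V _ hV
    have : Nontrivial V := Module.nontrivial_of_finrank_pos (R := ℚ) (by omega)
    obtain ⟨⟨g, hg⟩, hg0⟩ := exists_ne (0 : V)
    have hg0' : g ≠ 0 := fun h => hg0 (by simp [h])
    let ℓ : MvPolynomial σ ℚ →ₗ[ℚ] ℚ := lcoeff ℚ (m.degree g)
    have hℓ : ∀ f, ℓ f = coeff (m.degree g) f := fun f => rfl
    let φ : V →ₗ[ℚ] ℚ := ℓ ∘ₗ V.subtype
    let V' := (LinearMap.ker φ).map V.subtype
    have hr : LinearMap.range φ = ⊤ := by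
      rw [LinearMap.range_eq_top]
      apply LinearMap.surjective_of_ne_zero
      intro h0
      have : φ ⟨g, hg⟩ = 0 := by rw [h0]; rfl
      exact (m.coeff_degree_ne_zero_iff.2 hg0') this
    have hd1 := LinearMap.finrank_range_add_finrank_ker φ
    rw [hr, finrank_top, Module.finrank_self, hV] at hd1
    have hV' : Module.finrank ℚ V' = s := by
      have h5 := LinearMap.finrank_range_of_inj (f := V.subtype.domRestrict (LinearMap.ker φ)) (by
        intro x y hxy; exact Subtype.ext (Subtype.ext hxy))
      rw [LinearMap.range_domRestrict] at h5
      change Module.finrank ℚ V' = _ at h5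
      omega
    obtain ⟨f, hf, hfi⟩ := ih V' hV'
    refine ⟨Fin.cons g f, ?_, ?_⟩
    · intro j
      refine Fin.cases ⟨hg, hg0'⟩ (fun j => ⟨?_, (hf j).2⟩) j
      obtain ⟨x, _, hx⟩ := (hf j).1
      simp only [Fin.cons_succ]
      rw [← hx]; exact x.2
    · have hne : ∀ j, m.degree (f j) ≠ m.degree g := by
        intro j h
        obtain ⟨x, hx1, hx⟩ := (hf j).1
        have h1 : coeff (m.degree g) (f j) = 0 := by rw [← hx]; exact hx1
        rw [← h] at h1
        exact (m.coeff_degree_ne_zero_iff.2 (hf j).2) h1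
      intro a b
      refine Fin.cases ?_ (fun a => ?_) a <;> refine Fin.cases ?_ (fun b => ?_) b
      · simp
      · intro h; exact absurd h.symm (by simpa using hne b)
      · intro h; exact absurd h (by simpa using hne a)
      · intro h; exact congrArg Fin.succ (hfi (by simpa using h))

lemma bn_mul (κ I : σ →₀ ℕ) (h : σ) :
    κ h * bn κ I = (I h + 1) * bn κ (I + Finsupp.single h 1) + I h * bn κ I := by
  classical
  unfold bn
  rw [← Finset.mul_prod_erase _ _ (Finset.mem_univ h), ← Finset.mul_prod_erase _
      (fun i => (κ i).choose ((I + Finsupp.single h 1 : σ →₀ ℕ) i)) (Finset.mem_univ h)]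
  have h1 : ∏ x ∈ Finset.univ.erase h, (κ x).choose ((I + Finsupp.single h 1 : σ →₀ ℕ) x)
        = ∏ x ∈ Finset.univ.erase h, (κ x).choose (I x) := by
    refine Finset.prod_congr rfl fun x hx => ?_
    have : x ≠ h := Finset.ne_of_mem_erase hx
    simp [Finsupp.single_apply, this.symm]
  rw [h1]
  have h2 : (I + Finsupp.single h 1 : σ →₀ ℕ) h = I h + 1 := by simp
  rw [h2]
  have h4 := Nat.choose_succ_right_eq (κ h) (I h)
  have h5 : κ h * (κ h).choose (I h) = (I h + 1) * (κ h).choose (I h + 1) + I h * (κ h).choose (I h) := by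
    by_cases hle : I h ≤ κ h
    · obtain ⟨t, ht⟩ := Nat.exists_eq_add_of_le hle
      have : κ h - I h = t := by omega
      rw [this] at h4
      rw [mul_comm (I h + 1), h4, ht]; ring
    · have h6 : (κ h).choose (I h) = 0 := Nat.choose_eq_zero_of_lt (by omega)
      have h7 : (κ h).choose (I h + 1) = 0 := Nat.choose_eq_zero_of_lt (by omega)
      simp [h6, h7]
  rw [← mul_assoc, h5]; ring

lemma exists_li_of_span_top {s : ℕ} (T : Set (Fin s → ℚ)) (hT : Submodule.span ℚ T = ⊤) :
    ∃ f : Fin s → (Fin s → ℚ), (∀ i, f i ∈ T) ∧ LinearIndependent ℚ f := by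
  obtain ⟨f, hf1, hf2, hf3⟩ := Submodule.exists_fun_fin_finrank_span_eq ℚ T
  have hs : s = Module.finrank ℚ (Submodule.span ℚ T) := by
    rw [hT, finrank_top]; simp
  let e := finCongr hs
  exact ⟨fun i => f (e i), fun i => hf1 _, hf3.comp e e.injective⟩

lemma exists_binom_det {s : ℕ} (κ : Fin s → (σ →₀ ℕ)) (hκ : Function.Injective κ) :
    ∃ I : Fin s → (σ →₀ ℕ), (∀ i, ∑ v, I i v < s) ∧
      (Matrix.of fun i j => (bn (κ j) (I i) : ℚ)).det ≠ 0 := by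
  classical
  let v : (σ →₀ ℕ) → (Fin s → ℚ) := fun I j => bn (κ j) I
  let S : ℕ → Submodule ℚ (Fin s → ℚ) := fun r => Submodule.span ℚ (v '' {I | ∑ i, I i ≤ r})
  have hmono : ∀ r, S r ≤ S (r + 1) := fun r => Submodule.span_mono
    (Set.image_mono fun I (hI : _ ≤ r) => (le_trans hI (by omega) : _ ≤ r + 1))
  have hmul : ∀ r h (y : Fin s → ℚ), y ∈ S r → (fun j => (κ j h : ℚ) * y j) ∈ S (r + 1) := by
    intro r h y hy
    induction hy using Submodule.span_induction with
    | mem y hy =>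
      obtain ⟨I, hI, rfl⟩ := hy
      have e : (fun j => (κ j h : ℚ) * v I j) =
          ((I h : ℚ) + 1) • v (I + Finsupp.single h 1) + (I h : ℚ) • v I := by
        funext j
        have := bn_mul (κ j) I h
        simp only [v, Pi.add_apply, Pi.smul_apply, smul_eq_mul]
        exact_mod_cast this
      rw [e]
      refine (S (r+1)).add_mem ((S (r+1)).smul_mem _ (Submodule.subset_span ⟨_, ?_, rfl⟩))
        ((S (r+1)).smul_mem _ (hmono r (Submodule.subset_span ⟨_, hI, rfl⟩)))
      have hI' : ∑ i, I i ≤ r := hI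
      simp only [Set.mem_ofPred_eq, Finsupp.add_apply, Finset.sum_add_distrib]
      simp [Finsupp.single_apply]; omega
    | zero =>
      have := (S (r+1)).zero_mem
      convert this using 1
      funext j; simp
    | add x y _ _ hx hy =>
      have := (S (r+1)).add_mem hx hy
      convert this using 1
      funext j; simp; ring
    | smul c x _ hx =>
      have := (S (r+1)).smul_mem c hx
      convert this using 1
      funext j; simp; ring
  have hprod : ∀ (T : Finset (Fin s)) (h : Fin s → σ) (c : Fin s → ℚ),
      (fun j => ∏ k ∈ T, ((κ j (h k) : ℚ) - c k)) ∈ S T.card := by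
    intro T h c
    induction T using Finset.induction_on with
    | empty =>
      refine Submodule.subset_span ⟨0, by simp, ?_⟩
      funext j; simp [v, bn]
    | insert a T ha ih =>
      rw [Finset.card_insert_of_notMem ha]
      have := (S (T.card + 1)).sub_mem (hmul _ (h a) _ ih) ((S _).smul_mem (c a) (hmono _ ih))
      convert this using 1
      funext j
      rw [Finset.prod_insert ha]
      simp; ring
  have htop : Submodule.span ℚ (v '' {I | ∑ i, I i < s}) = ⊤ := by
    rw [eq_top_iff, ← (Pi.basisFun ℚ (Fin s)).span_eq, Submodule.span_le]
    rintro _ ⟨j, rfl⟩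
    have hsep : ∀ k : Fin s, k ≠ j → ∃ h : σ, κ k h ≠ κ j h := by
      intro k hk
      have : κ k ≠ κ j := fun h => hk (hκ h)
      exact Finsupp.ne_iff.1 this
    have hs : 0 < s := j.pos
    rcases isEmpty_or_nonempty σ with hσ | ⟨⟨i0⟩⟩
    · have h1 : ∀ k, k = j := by
        intro k; by_contra hk
        obtain ⟨h, _⟩ := hsep k hk; exact hσ.elim h
      refine Submodule.subset_span ⟨0, by simpa using hs, ?_⟩
      funext k; rw [h1 k]; simp [v, bn, Pi.basisFun_apply]
    have hsep' : ∀ k : Fin s, ∃ h : σ, k ≠ j → κ k h ≠ κ j h := by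
      intro k
      by_cases hk : k = j
      · exact ⟨i0, fun h => absurd hk h⟩
      · obtain ⟨h, hh⟩ := hsep k hk; exact ⟨h, fun _ => hh⟩
    choose h hh using hsep'
    have h1 := hprod (Finset.univ.erase j) h (fun k => κ k (h k))
    rw [Finset.card_erase_of_mem (Finset.mem_univ j), Finset.card_univ, Fintype.card_fin] at h1
    set p : ℚ := ∏ k ∈ Finset.univ.erase j, ((κ j (h k) : ℚ) - κ k (h k)) with hp
    have hp0 : p ≠ 0 := by
      rw [hp, Finset.prod_ne_zero_iff]
      intro k hk
      rw [sub_ne_zero]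
      exact_mod_cast (hh k (Finset.ne_of_mem_erase hk)).symm
    have e : (Pi.basisFun ℚ (Fin s)) j = p⁻¹ • fun i => ∏ k ∈ Finset.univ.erase j,
        ((κ i (h k) : ℚ) - κ k (h k)) := by
      funext i
      rw [Pi.basisFun_apply, Pi.smul_apply, smul_eq_mul]
      by_cases hi : i = j
      · subst hi; rw [← hp]; simp [hp0]
      · rw [Finset.prod_eq_zero (Finset.mem_erase.2 ⟨hi, Finset.mem_univ i⟩) (by simp)]
        simp [hi]
    rw [SetLike.mem_coe, e]
    refine Submodule.smul_mem _ _ ?_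
    refine Submodule.span_mono (Set.image_mono ?_) h1
    intro I hI
    have hI' : ∑ i, I i ≤ s - 1 := hI
    exact (by omega : ∑ i, I i < s)
  obtain ⟨f, hf1, hf3⟩ := exists_li_of_span_top _ htop
  have hf4 : ∀ i, ∃ I : σ →₀ ℕ, ∑ v, I v < s ∧ v I = f i := fun i => hf1 i
  choose I hI1 hI2 using hf4
  refine ⟨I, hI1, ?_⟩
  have : (Matrix.of fun i j => (bn (κ j) (I i) : ℚ)) = Matrix.of f := by
    ext i j; simp only [Matrix.of_apply]; rw [← hI2]
  rw [this]
  have hu := Matrix.linearIndependent_rows_iff_isUnit (A := Matrix.of f)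
  have := hu.1 hf3
  rw [Matrix.isUnit_iff_isUnit_det] at this
  exact this.ne_zero

lemma coeff_prod_of_degree_le (m : MonomialOrder σ) {α : Type*} (s : Finset α)
    (P : α → MvPolynomial σ ℚ) (κ : α → (σ →₀ ℕ))
    (h : ∀ a ∈ s, ∀ j ∈ (P a).support, m.toSyn j ≤ m.toSyn (κ a)) :
    coeff (∑ a ∈ s, κ a) (∏ a ∈ s, P a) = ∏ a ∈ s, coeff (κ a) (P a) ∧
    m.toSyn (m.degree (∏ a ∈ s, P a)) ≤ m.toSyn (∑ a ∈ s, κ a) := by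
  classical
  induction s using Finset.induction_on with
  | empty => simp
  | insert a s ha ih =>
    obtain ⟨h1, h2⟩ := ih fun b hb => h b (by simp [hb])
    have h3 : m.toSyn (m.degree (P a)) ≤ m.toSyn (κ a) := by
      rw [m.degree_le_iff]; exact h a (by simp)
    rw [Finset.sum_insert ha, Finset.prod_insert ha, Finset.prod_insert ha]
    refine ⟨?_, ?_⟩
    · rw [m.coeff_mul_of_add_of_degree_le h3 h2, h1]
    · refine m.degree_mul_le.trans ?_
      rw [map_add, map_add]
      exact add_le_add h3 h2

/-- generalized Wronskian -/
lemma exists_wronskian [LinearOrder σ] {s : ℕ} (f : Fin s → MvPolynomial σ ℚ) (hf : LinearIndependent ℚ f) :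
    ∃ I : Fin s → (σ →₀ ℕ), (∀ i, ∑ v, I i v < s) ∧
      (Matrix.of fun i j => hd (I i) (f j)).det ≠ 0 := by
  classical
  let m : MonomialOrder σ := MonomialOrder.lex
  let V := Submodule.span ℚ (Set.range f)
  have hV : Module.finrank ℚ V = s := by
    rw [finrank_span_eq_card hf]; simp
  have : FiniteDimensional ℚ V := FiniteDimensional.span_of_finite ℚ (Set.finite_range f)
  obtain ⟨g, hg, hgi⟩ := exists_distinct_degrees m s V hV
  obtain ⟨I, hI, hdet⟩ := exists_binom_det (fun j => m.degree (g j)) hgi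
  refine ⟨I, hI, fun h0 => ?_⟩
  have hc : ∀ j, ∃ c : Fin s → ℚ, ∑ l, c l • f l = g j := fun j =>
    (Submodule.mem_span_range_iff_exists_fun ℚ).1 (hg j).1
  choose c hc using hc
  have hmat : (Matrix.of fun i j => hd (I i) (g j)) =
      (Matrix.of fun i j => hd (I i) (f j)) * (Matrix.of fun l j => (C (c j l) : MvPolynomial σ ℚ)) := by
    refine Matrix.ext fun i j => ?_
    rw [Matrix.mul_apply]
    simp only [Matrix.of_apply]
    rw [← hc j, hd_sum]
    refine Finset.sum_congr rfl fun l _ => ?_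
    rw [smul_eq_C_mul, hd_C_mul, mul_comm]
  have h0' : (Matrix.of fun i j => hd (I i) (g j)).det = 0 := by
    rw [hmat, Matrix.det_mul, h0, zero_mul]
  -- multiply rows by monomials
  have h1 : (Matrix.of fun i j => (monomial (I i) (1:ℚ)) * hd (I i) (g j)).det = 0 := by
    have := Matrix.det_mul_column (fun i => (monomial (I i) (1:ℚ))) (Matrix.of fun i j => hd (I i) (g j))
    rw [h0', mul_zero] at this
    exact this
  have hco : ∀ i j ν, coeff ν ((monomial (I i) (1:ℚ)) * hd (I i) (g j)) = bn ν (I i) * coeff ν (g j) := by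
    intro i j ν
    rw [coeff_monomial_mul', one_mul]
    split_ifs with h
    · rw [coeff_hd, tsub_add_cancel_of_le h]
    · simp [bn_eq_zero h]
  have h2 := congrArg (coeff (∑ j, m.degree (g j))) h1
  rw [Matrix.det_apply, coeff_sum, coeff_zero] at h2
  apply hdet
  have h3 : (Matrix.of fun i j => (bn (m.degree (g j)) (I i) : ℚ)).det * ∏ j, m.leadingCoeff (g j) = 0 := by
    rw [← h2, Matrix.det_apply, Finset.sum_mul]
    refine Finset.sum_congr rfl fun π _ => ?_
    rw [coeff_smul, smul_mul_assoc]
    congr 1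
    simp only [Matrix.of_apply]
    rw [(coeff_prod_of_degree_le m Finset.univ _ (fun j => m.degree (g j)) ?_).1,
      ← Finset.prod_mul_distrib]
    · refine Finset.prod_congr rfl fun j _ => ?_
      rw [hco]; rfl
    · intro j _ ν hν
      rw [mem_support_iff, hco] at hν
      exact m.le_degree (mem_support_iff.2 (right_ne_zero_of_mul hν))
  refine (mul_eq_zero.1 h3).resolve_right ?_
  refine Finset.prod_ne_zero_iff.2 ?_
  intro j _
  exact m.leadingCoeff_ne_zero_iff.2 (hg j).2

end wronskian
end Sst


namespace Sst
open MvPolynomial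
set_option linter.unusedSectionVars false
set_option linter.unusedSimpArgs false
set_option linter.unusedVariables false

section mg
variable {n : ℕ} {R : Type*} [CommRing R]

/-- product in separate variables -/
noncomputable def mg (f : MvPolynomial (Fin n) R) (g : MvPolynomial (Fin 1) R) :
    MvPolynomial (Fin (n+1)) R := rename Fin.succ f * rename (fun _ => 0) g

lemma fin1_eq (b : Fin 1 →₀ ℕ) : b = Finsupp.single 0 (b 0) := by
  refine Finsupp.ext fun i => ?_
  rw [Subsingleton.elim i 0]; simp

lemma mg_monomial (a : Fin n →₀ ℕ) (b : Fin 1 →₀ ℕ) (c e : R) :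
    mg (monomial a c) (monomial b e) = monomial (Finsupp.cons (b 0) a) (c * e) := by
  classical
  rw [mg, rename_monomial, rename_monomial, monomial_mul]
  have key : Finsupp.mapDomain Fin.succ a + Finsupp.mapDomain (fun _ => (0 : Fin (n+1))) b
      = Finsupp.cons (b 0) a := ?_
  · rw [key]
  ext i
  refine Fin.cases ?_ (fun i => ?_) i
  · rw [Finsupp.add_apply, Finsupp.mapDomain_of_notMem_range _ _ (by simp [Fin.succ_ne_zero])]
    have : b = Finsupp.single 0 (b 0) := fin1_eq b
    rw [this, Finsupp.mapDomain_single]; simp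
  · rw [Finsupp.add_apply, Finsupp.mapDomain_apply (Fin.succ_injective n)]
    rw [Finsupp.mapDomain_of_notMem_range]
    · simp
    · rintro ⟨x, hx⟩; exact (Fin.succ_ne_zero i) hx.symm

lemma coeff_mg (f : MvPolynomial (Fin n) R) (g : MvPolynomial (Fin 1) R) (a : Fin n →₀ ℕ) (k : ℕ) :
    coeff (Finsupp.cons k a) (mg f g) = coeff a f * coeff (Finsupp.single 0 k) g := by
  classical
  have hadd : ∀ f f' g, mg (R := R) (n := n) (f + f') g = mg f g + mg f' g := by
    intro f f' g; simp [mg, add_mul]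
  have hadd' : ∀ f g g', mg (R := R) (n := n) f (g + g') = mg f g + mg f g' := by
    intro f f' g; simp [mg, mul_add]
  induction f using MvPolynomial.induction_on' with
  | add p q hp hq => rw [hadd, coeff_add, coeff_add, hp, hq, add_mul]
  | monomial u c =>
    induction g using MvPolynomial.induction_on' with
    | add p q hp hq => rw [hadd', coeff_add, coeff_add, hp, hq, mul_add]
    | monomial b e =>
      rw [mg_monomial, coeff_monomial, coeff_monomial, coeff_monomial]
      have hb : b = Finsupp.single 0 (b 0) := fin1_eq b
      by_cases h1 : u = a
      · by_cases h2 : b = Finsupp.single 0 k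
        · subst h1; subst h2; simp
        · have : b 0 ≠ k := by rintro rfl; exact h2 hb
          rw [if_neg, if_neg h2, mul_zero]
          intro h
          have := congrArg (fun z => z 0) h
          simp at this; contradiction
      · rw [if_neg, if_neg h1, zero_mul]
        intro h
        apply h1
        have := congrArg Finsupp.tail h
        simpa using this

lemma ext_cons {f g : MvPolynomial (Fin (n+1)) R}
    (h : ∀ k a, coeff (Finsupp.cons k a) f = coeff (Finsupp.cons k a) g) : f = g := by
  ext ν
  rw [← Finsupp.cons_tail ν]; exact h _ _

lemma bn_cons (k j : ℕ) (a I : Fin n →₀ ℕ) :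
    bn (Finsupp.cons k a) (Finsupp.cons j I) = k.choose j * bn a I := by
  simp [bn, Fin.prod_univ_succ]

lemma cons_add (k j : ℕ) (a I : Fin n →₀ ℕ) :
    (Finsupp.cons k a + Finsupp.cons j I : Fin (n+1) →₀ ℕ) = Finsupp.cons (k + j) (a + I) := by
  ext i; refine Fin.cases ?_ (fun i => ?_) i <;> simp

lemma hd_mg (f : MvPolynomial (Fin n) R) (g : MvPolynomial (Fin 1) R) (I : Fin n →₀ ℕ) (j : ℕ) :
    hd (Finsupp.cons j I) (mg f g) = mg (hd I f) (hd (Finsupp.single 0 j) g) := by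
  apply ext_cons
  intro k a
  rw [coeff_hd, cons_add, coeff_mg, coeff_mg, coeff_hd, coeff_hd, bn_cons, ← Finsupp.single_add]
  simp [bn]; ring

lemma tr_mg (f : MvPolynomial (Fin n) R) (g : MvPolynomial (Fin 1) R) (ξ : Fin (n+1) → R) :
    tr ξ (mg f g) = mg (tr (fun i => ξ i.succ) f) (tr (fun _ => ξ 0) g) := by
  rw [mg, mg, map_mul]
  congr 1
  · induction f using MvPolynomial.induction_on with
    | C a => simp [tr]
    | add p q hp hq => simp [hp, hq]
    | mul_X p i hp => simp only [map_mul, hp]; simp [tr]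
  · induction g using MvPolynomial.induction_on with
    | C a => simp [tr]
    | add p q hp hq => simp [hp, hq]
    | mul_X p i hp => simp only [map_mul, hp]; simp [tr]

lemma exists_decomp (F : MvPolynomial (Fin (n+1)) ℚ) (hF : F ≠ 0) (d : ℕ) (hd : degreeOf 0 F ≤ d) :
    ∃ s : ℕ, 1 ≤ s ∧ s ≤ d + 1 ∧ ∃ (f : Fin s → MvPolynomial (Fin n) ℚ)
      (g : Fin s → MvPolynomial (Fin 1) ℚ), LinearIndependent ℚ f ∧ LinearIndependent ℚ g ∧
      F = ∑ l, mg (f l) (g l) := by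
  classical
  let Fk : Fin (d+1) → MvPolynomial (Fin n) ℚ := fun k => Polynomial.coeff (finSuccEquiv ℚ n F) k
  have hFk : ∀ (k : Fin (d+1)) a, coeff a (Fk k) = coeff (Finsupp.cons (k:ℕ) a) F := fun k a =>
    finSuccEquiv_coeff_coeff _ _ _
  let V := Submodule.span ℚ (Set.range Fk)
  have : FiniteDimensional ℚ V := FiniteDimensional.span_of_finite ℚ (Set.finite_range Fk)
  let s := Module.finrank ℚ V
  let b : Module.Basis (Fin s) ℚ V := Module.finBasis ℚ V
  have hmem : ∀ k, Fk k ∈ V := fun k => Submodule.subset_span ⟨k, rfl⟩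
  let r : Fin (d+1) → Fin s → ℚ := fun k l => b.repr ⟨Fk k, hmem k⟩ l
  have hr : ∀ k, Fk k = ∑ l, r k l • (b l : MvPolynomial (Fin n) ℚ) := by
    intro k
    have := congrArg (fun z : V => (z : MvPolynomial (Fin n) ℚ)) (b.sum_repr ⟨Fk k, hmem k⟩)
    rw [AddSubmonoidClass.coe_finsetSum] at this
    exact this.symm
  let g : Fin s → MvPolynomial (Fin 1) ℚ := fun l =>
    ∑ k : Fin (d+1), monomial (Finsupp.single 0 (k:ℕ)) (r k l)
  have hg : ∀ l (k : Fin (d+1)), coeff (Finsupp.single 0 (k:ℕ)) (g l) = r k l := by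
    intro l k
    simp only [g, coeff_sum, coeff_monomial]
    rw [Finset.sum_eq_single k]
    · simp
    · intro k' _ hk
      rw [if_neg]
      intro h
      apply hk
      have := congrArg (fun z => z 0) h
      simp at this
      exact Fin.ext this
    · simp
  have hg' : ∀ l (k : ℕ), d < k → coeff (Finsupp.single 0 k) (g l) = 0 := by
    intro l k hk
    simp only [g, coeff_sum, coeff_monomial]
    refine Finset.sum_eq_zero fun k' _ => ?_
    rw [if_neg]
    intro h
    have := congrArg (fun z => z 0) h
    simp at this
    have := k'.2; omega
  have hdec : F = ∑ l, mg (b l : MvPolynomial (Fin n) ℚ) (g l) := by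
    apply ext_cons
    intro k a
    rw [coeff_sum]
    simp only [coeff_mg]
    by_cases hk : k ≤ d
    · have h1 := hFk ⟨k, by omega⟩ a
      simp only at h1
      rw [← h1, hr, coeff_sum]
      refine Finset.sum_congr rfl fun l _ => ?_
      rw [coeff_smul, smul_eq_mul, ← hg l ⟨k, by omega⟩, mul_comm]
    · rw [Finset.sum_eq_zero (fun l _ => by rw [hg' l k (by omega), mul_zero])]
      by_contra hne
      have := degreeOf_le_iff.1 hd _ (mem_support_iff.2 hne)
      simp at this; omega
  refine ⟨s, ?_, ?_, fun l => b l, g, ?_, ?_, hdec⟩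
  · by_contra h0
    apply hF
    have : s = 0 := by omega
    rw [hdec]
    have : IsEmpty (Fin s) := by rw [this]; infer_instance
    simp
  · have := finrank_range_le_card (R := ℚ) Fk
    rw [Fintype.card_fin] at this
    exact this
  · have := b.linearIndependent.map' V.subtype (by simp)
    exact this
  · rw [Fintype.linearIndependent_iff]
    intro c hc
    let φ : V →ₗ[ℚ] ℚ := b.constr ℚ c
    have h0 : ∀ k, φ ⟨Fk k, hmem k⟩ = 0 := by
      intro k
      have h1 := congrArg (coeff (Finsupp.single 0 (k:ℕ))) hc
      rw [coeff_sum] at h1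
      simp only [coeff_smul, hg, smul_eq_mul, coeff_zero] at h1
      rw [Module.Basis.constr_apply_fintype]
      rw [← h1]
      refine Finset.sum_congr rfl fun l _ => ?_
      rw [smul_eq_mul, mul_comm]; rfl
    have hφ : φ = 0 := by
      ext ⟨x, hx⟩
      induction hx using Submodule.span_induction with
      | mem x hx => obtain ⟨k, rfl⟩ := hx; simpa using h0 k
      | zero => exact map_zero φ
      | add x y hx hy h1 h2 =>
        have : (⟨x + y, V.add_mem hx hy⟩ : V) = ⟨x, hx⟩ + ⟨y, hy⟩ := rfl
        rw [this, map_add, h1, h2]; simp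
      | smul c x hx h1 =>
        have : (⟨c • x, V.smul_mem c hx⟩ : V) = c • ⟨x, hx⟩ := rfl
        rw [this, map_smul, h1]; simp
    intro l
    have : φ (b l) = c l := by simp [φ]
    rw [← this, hφ]; rfl

end mg

/-- one variable estimate -/
lemma one_var (V : MvPolynomial (Fin 1) ℤ) (hV : V ≠ 0) (ξ : ℚ) (N : ℝ)
    (hN : ∀ j, |((coeff j V : ℤ) : ℝ)| ≤ N) :
    ∃ e : ℕ, coeff (Finsupp.single 0 e) (tr (fun _ => ξ) (map (Int.castRingHom ℚ) V)) ≠ 0 ∧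
      (ξ.den : ℝ) ^ e ≤ N := by
  classical
  have hcoef : ∀ {R : Type} [CommRing R] (V : MvPolynomial (Fin 1) R) (k : ℕ),
      (aeval (fun _ => (Polynomial.X : Polynomial R)) V).coeff k = coeff (Finsupp.single 0 k) V := by
    intro R _ V k
    induction V using MvPolynomial.induction_on' with
    | add p q hp hq => rw [map_add, Polynomial.coeff_add, coeff_add, hp, hq]
    | monomial u c =>
      have hb : u = Finsupp.single 0 (u 0) := fin1_eq u
      rw [aeval_monomial, hb, Finsupp.prod_single_index (by simp), coeff_monomial]
      rw [Polynomial.algebraMap_apply, Polynomial.coeff_C_mul, Polynomial.coeff_X_pow]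
      simp only [Finsupp.single_eq_same, Algebra.algebraMap_self, RingHom.id_apply]
      by_cases h : k = u 0
      · rw [if_pos h, if_pos (by rw [h]), mul_one]
      · rw [if_neg h, if_neg, mul_zero]
        intro h'
        have := congrArg (fun z => z 0) h'
        simp at this; exact h this.symm
  let P : Polynomial ℤ := aeval (fun _ => (Polynomial.X : Polynomial ℤ)) V
  have hP : P ≠ 0 := by
    obtain ⟨j, hj⟩ := MvPolynomial.ne_zero_iff.1 hV
    intro h
    have hb : j = Finsupp.single 0 (j 0) := fin1_eq j
    rw [hb, ← hcoef, show aeval (fun _ => (Polynomial.X : Polynomial ℤ)) V = P from rfl, h] at hj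
    simp at hj
  let Pq : Polynomial ℚ := P.map (Int.castRingHom ℚ)
  have hPq : Pq ≠ 0 := by
    rwa [Ne, Polynomial.map_eq_zero_iff (RingHom.injective_int _)]
  have hPq' : Pq = aeval (fun _ => (Polynomial.X : Polynomial ℚ)) (map (Int.castRingHom ℚ) V) := by
    ext k
    rw [hcoef, Polynomial.coeff_map, hcoef, coeff_map]
  let e := Pq.rootMultiplicity ξ
  have htr : ∀ f : MvPolynomial (Fin 1) ℚ, aeval (fun _ => (Polynomial.X : Polynomial ℚ)) (tr (fun _ => ξ) f) =
      (aeval (fun _ => (Polynomial.X : Polynomial ℚ)) f).comp (Polynomial.X + Polynomial.C ξ) := by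
    intro f
    induction f using MvPolynomial.induction_on with
    | C a => simp [tr]
    | add p q hp hq => simp [hp, hq]
    | mul_X p i hp => simp only [map_mul, hp, Polynomial.mul_comp]; simp [tr]
  refine ⟨e, ?_, ?_⟩
  · rw [← hcoef, htr, ← hPq']
    obtain ⟨q, hq1, hq2⟩ := Polynomial.exists_eq_pow_rootMultiplicity_mul_and_not_dvd Pq hPq ξ
    rw [hq1]
    rw [Polynomial.mul_comp, Polynomial.pow_comp, Polynomial.sub_comp, Polynomial.X_comp,
      Polynomial.C_comp, add_sub_cancel_right, Polynomial.coeff_X_pow_mul']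
    rw [if_pos le_rfl, Nat.sub_self, Polynomial.coeff_zero_eq_eval_zero, Polynomial.eval_comp]
    simp only [Polynomial.eval_add, Polynomial.eval_X, Polynomial.eval_C, zero_add]
    intro h0
    exact hq2 (Polynomial.dvd_iff_isRoot.2 h0)
  · let L : Polynomial ℤ := Polynomial.C (ξ.den : ℤ) * Polynomial.X + Polynomial.C (-ξ.num)
    have hLp : L.IsPrimitive := by
      intro r hr
      rw [Polynomial.C_dvd_iff_dvd_coeff] at hr
      have h0 := hr 0
      have h1 := hr 1
      have e0 : L.coeff 0 = -ξ.num := by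
        simp only [L, Polynomial.coeff_add, Polynomial.coeff_C_mul, Polynomial.coeff_X_zero, Polynomial.coeff_C_zero]; ring
      have e1 : L.coeff 1 = ξ.den := by
        simp only [L, Polynomial.coeff_add, Polynomial.coeff_C_mul, Polynomial.coeff_X_one, Polynomial.coeff_C_succ]; ring
      rw [e0, dvd_neg] at h0
      rw [e1] at h1
      have : IsCoprime ξ.num (ξ.den : ℤ) := Int.isCoprime_iff_gcd_eq_one.2 (by
        rw [Int.gcd_eq_natAbs]; simpa using ξ.reduced)
      rw [isCoprime_comm] at this
      exact this.isUnit_of_dvd' h1 h0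
    have hLq : L.map (Int.castRingHom ℚ) = Polynomial.C (ξ.den : ℚ) * (Polynomial.X - Polynomial.C ξ) := by
      simp only [L, Polynomial.map_add, Polynomial.map_mul, Polynomial.map_C, Polynomial.map_X]
      rw [mul_sub, ← Polynomial.C_mul]
      simp only [map_neg, eq_intCast, Int.cast_natCast]
      rw [Rat.den_mul_eq_num, sub_eq_add_neg]
      try simp
    have hdvd : L ^ e ∣ P := by
      rw [Polynomial.IsPrimitive.Int.dvd_iff_map_cast_dvd_map_cast]
      · rw [Polynomial.map_pow, hLq, mul_pow, ← Polynomial.C_pow]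
        obtain ⟨q, hq⟩ := Polynomial.pow_rootMultiplicity_dvd Pq ξ
        refine ⟨Polynomial.C ((ξ.den : ℚ)^e)⁻¹ * q, ?_⟩
        change Pq = _
        rw [mul_mul_mul_comm, ← Polynomial.C_mul, mul_inv_cancel₀ (pow_ne_zero _ (by simp)),
          Polynomial.C_1, one_mul]
        exact hq
      · clear_value e
        induction e with
        | zero => simpa using Polynomial.isPrimitive_one
        | succ e ih => rw [pow_succ]; exact ih.mul hLp
    obtain ⟨q, hq⟩ := hdvd
    have hlc : P.leadingCoeff = (ξ.den : ℤ) ^ e * q.leadingCoeff := by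
      rw [hq, Polynomial.leadingCoeff_mul, Polynomial.leadingCoeff_pow,
        Polynomial.leadingCoeff_linear]
      try simp
    have h1 : (ξ.den : ℤ)^e ≤ |P.leadingCoeff| := by
      refine Int.le_of_dvd (abs_pos.2 (Polynomial.leadingCoeff_ne_zero.2 hP)) ?_
      rw [dvd_abs, hlc]; exact dvd_mul_right _ _
    have h2 := hN (Finsupp.single 0 P.natDegree)
    rw [← hcoef] at h2
    refine le_trans ?_ h2
    have : ((ξ.den : ℤ)^e : ℝ) ≤ (|P.leadingCoeff| : ℤ) := by exact_mod_cast h1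
    push_cast at this
    exact this

end Sst


namespace Sst
open MvPolynomial
set_option linter.unusedSectionVars false
set_option linter.unusedSimpArgs false
set_option linter.unusedVariables false

/-- generalized Wronskian determinant -/
noncomputable def wdet {n s : ℕ} {R : Type*} [CommRing R] (F : MvPolynomial (Fin (n+1)) R)
    (I : Fin s → (Fin n →₀ ℕ)) (j : Fin s → ℕ) : MvPolynomial (Fin (n+1)) R :=
  (Matrix.of fun a b => hd (Finsupp.cons (j b) (I a)) F).det

lemma wdet_map {n s : ℕ} {R S : Type*} [CommRing R] [CommRing S] (ψ : R →+* S)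
    (F : MvPolynomial (Fin (n+1)) R)
    (I : Fin s → (Fin n →₀ ℕ)) (j : Fin s → ℕ) : wdet (map ψ F) I j = map ψ (wdet F I j) := by
  rw [wdet, wdet, RingHom.map_det]
  congr 1
  ext a b : 2
  simp [hd_map]

lemma exists_wdet {n : ℕ} (F : MvPolynomial (Fin (n+1)) ℚ) (hF : F ≠ 0) (d : ℕ)
    (hd' : degreeOf 0 F ≤ d) :
    ∃ s : ℕ, 1 ≤ s ∧ s ≤ d + 1 ∧ ∃ (I : Fin s → (Fin n →₀ ℕ)) (j : Fin s → ℕ),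
      (∀ a, ∑ v, I a v < s) ∧ (∀ f : ℕ → ℝ, ∑ b, f (j b) = ∑ i ∈ Finset.range s, f i) ∧
      ∃ U V, U ≠ 0 ∧ V ≠ 0 ∧ wdet F I j = mg U V := by
  classical
  obtain ⟨s, hs1, hs2, f, g, hf, hg, hFeq⟩ := exists_decomp F hF d hd'
  obtain ⟨I, hI, hU⟩ := exists_wronskian f hf
  obtain ⟨J, hJ, hV⟩ := exists_wronskian g hg
  have hJ' : ∀ b, J b 0 < s := fun b => by simpa using hJ b
  have hinj : Function.Injective (fun b => (⟨J b 0, hJ' b⟩ : Fin s)) := by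
    intro b b' h
    by_contra hne
    apply hV
    refine Matrix.det_zero_of_row_eq hne ?_
    funext l
    have : J b = J b' := by
      rw [fin1_eq (J b), fin1_eq (J b')]
      simp only [Fin.mk.injEq] at h; rw [h]
    simp [this]
  have hbij := Finite.injective_iff_bijective.1 hinj
  refine ⟨s, hs1, hs2, I, fun b => J b 0, hI, ?_, _, _, hU, hV, ?_⟩
  · intro h
    rw [← Fin.sum_univ_eq_sum_range]
    exact Function.Bijective.sum_comp hbij (fun i : Fin s => h (i : ℕ))
  · rw [wdet]
    have : (Matrix.of fun a b => hd (Finsupp.cons (J b 0) (I a)) F) =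
        ((rename Fin.succ : MvPolynomial (Fin n) ℚ →ₐ[ℚ] MvPolynomial (Fin (n+1)) ℚ) : MvPolynomial (Fin n) ℚ →+* _).mapMatrix
          (Matrix.of fun i j => hd (I i) (f j)) *
        (((rename (fun _ => 0) : MvPolynomial (Fin 1) ℚ →ₐ[ℚ] MvPolynomial (Fin (n+1)) ℚ) : MvPolynomial (Fin 1) ℚ →+* _).mapMatrix
          (Matrix.of fun i j => hd (J i) (g j))).transpose := by
      ext a b : 2
      rw [Matrix.mul_apply]
      simp only [Matrix.of_apply, RingHom.mapMatrix_apply, Matrix.map_apply, Matrix.transpose_apply]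
      rw [hFeq, hd_sum]
      congr 1
      apply Finset.sum_congr rfl
      intro l _
      rw [hd_mg, mg, ← fin1_eq]
      rfl
    rw [this, Matrix.det_mul, Matrix.det_transpose, ← RingHom.map_det, ← RingHom.map_det, mg]
    rfl

lemma wdet_wn {n s : ℕ} (F : MvPolynomial (Fin (n+1)) ℤ) (I : Fin s → (Fin n →₀ ℕ)) (j : Fin s → ℕ)
    (d : Fin (n+1) → ℕ) (hd' : ∀ i, degreeOf i F ≤ d i) :
    wn 1 (wdet F I j) ≤ s.factorial * (2 ^ (∑ i, d i) * wn 1 F) ^ s := by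
  classical
  rw [wdet, Matrix.det_apply]
  refine (wn_sum_le (by simp) _ _).trans ?_
  have : ∀ σ ∈ (Finset.univ : Finset (Equiv.Perm (Fin s))), wn 1 (Equiv.Perm.sign σ •
      ∏ i, (Matrix.of fun a b => hd (Finsupp.cons (j b) (I a)) F) (σ i) i) ≤
      (2 ^ (∑ i, d i) * wn 1 F) ^ s := by
    intro σ _
    have h1 : wn 1 (Equiv.Perm.sign σ •
      ∏ i, (Matrix.of fun a b => hd (Finsupp.cons (j b) (I a)) F) (σ i) i) =
      wn 1 (∏ i, (Matrix.of fun a b => hd (Finsupp.cons (j b) (I a)) F) (σ i) i) := by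
      rcases Int.units_eq_one_or (Equiv.Perm.sign σ) with h | h
      · rw [h, one_smul]
      · rw [h, Units.neg_smul, one_smul, wn_neg]
    rw [h1]
    refine (wn_prod_le (by simp) _ _).trans ?_
    refine (Finset.prod_le_prod (fun i _ => wn_nonneg (by simp) _) (fun i _ => wn_hd_le F _ d hd')).trans ?_
    simp
  refine (Finset.sum_le_sum this).trans ?_
  simp [Fintype.card_perm]

lemma degreeOf_det_le {n s : ℕ} {R : Type*} [CommRing R] (M : Matrix (Fin s) (Fin s) (MvPolynomial (Fin n) R))
    (i : Fin n) (d : ℕ) (h : ∀ a b, degreeOf i (M a b) ≤ d) : degreeOf i M.det ≤ s * d := by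
  classical
  rw [Matrix.det_apply]
  refine (degreeOf_sum_le _ _ _).trans (Finset.sup_le fun σ _ => ?_)
  have h1 : degreeOf i (∏ a, M (σ a) a) ≤ s * d := by
    refine (degreeOf_prod_le _ _ _).trans ?_
    refine (Finset.sum_le_sum fun a _ => h _ _).trans ?_
    simp
  rcases Int.units_eq_one_or (Equiv.Perm.sign σ) with h | h
  · rwa [h, one_smul]
  · rw [h, Units.neg_smul, one_smul]
    rw [degreeOf_eq_sup, support_neg, ← degreeOf_eq_sup]; exact h1

lemma wdet_degreeOf {n s : ℕ} {R : Type*} [CommRing R] (F : MvPolynomial (Fin (n+1)) R) (I : Fin s → (Fin n →₀ ℕ)) (j : Fin s → ℕ)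
    (i) : degreeOf i (wdet F I j) ≤ s * degreeOf i F :=
  degreeOf_det_le _ _ _ fun a b => degreeOf_hd_le _ _ _

lemma wdet_WGe {n s : ℕ} (F : MvPolynomial (Fin (n+1)) ℚ) (I : Fin s → (Fin n →₀ ℕ)) (j : Fin s → ℕ)
    (ξ : Fin (n+1) → ℚ) (w : Fin (n+1) → ℝ) (hw : ∀ i, 0 ≤ w i) (θ ω : ℝ) (hF : WGe w θ (tr ξ F))
    (hI : ∀ a, wt (fun i => w (Fin.succ i)) (I a) ≤ ω) :
    WGe w (∑ b, max 0 (θ - ω - w 0 * j b)) (tr ξ (wdet F I j)) := by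
  classical
  rw [wdet, AlgHom.map_det, Matrix.det_apply]
  refine WGe.sum _ fun σ _ => ?_
  have h1 : WGe w (∑ b, max 0 (θ - ω - w 0 * j b))
      (∏ i, ((tr ξ).mapMatrix (Matrix.of fun a b => hd (Finsupp.cons (j b) (I a)) F)) (σ i) i) := by
    refine WGe.prod hw _ fun b _ => ?_
    refine WGe.max (WGe.of_nonneg hw _) ?_
    simp only [AlgHom.mapMatrix_apply, Matrix.map_apply, Matrix.of_apply]
    rw [← hd_tr]
    refine (WGe.hd hF _).mono ?_
    have : wt w (Finsupp.cons (j b) (I (σ b))) = w 0 * j b + wt (fun i => w (Fin.succ i)) (I (σ b)) := by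
      simp [wt, Fin.sum_univ_succ]
    rw [this]
    linarith [hI (σ b)]
  rcases Int.units_eq_one_or (Equiv.Perm.sign σ) with h | h
  · rwa [h, one_smul]
  · rw [h, Units.neg_smul, one_smul]
    intro j hj
    rw [support_neg] at hj
    exact h1 j hj

lemma sum_lb (s d : ℕ) (hd : 1 ≤ d) (hs : s ≤ d + 1) (Θ : ℝ) (h0 : 0 < Θ) (h1 : Θ ≤ 1) :
    s * Θ ^ 2 / 8 ≤ ∑ i ∈ Finset.range s, max 0 (Θ - 1 / d * i) := by
  have hd0 : (0:ℝ) < d := by exact_mod_cast hd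
  let k := min s (⌊Θ * d / 2⌋₊ + 1)
  have hk : (s : ℝ) * Θ / 4 ≤ k := by
    have hs' : (s : ℝ) ≤ d + 1 := by exact_mod_cast hs
    have hd1 : (1:ℝ) ≤ d := by exact_mod_cast hd
    have := Nat.lt_floor_add_one (Θ * d / 2)
    simp only [k, Nat.cast_min, Nat.cast_add, Nat.cast_one]
    apply le_min
    · have : (0:ℝ) ≤ s := Nat.cast_nonneg _
      nlinarith
    · nlinarith
  have h2 : ∑ i ∈ Finset.range k, Θ / 2 ≤ ∑ i ∈ Finset.range k, max 0 (Θ - 1 / d * i) := by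
    refine Finset.sum_le_sum fun i hi => le_max_of_le_right ?_
    have hi' : i ≤ ⌊Θ * d / 2⌋₊ := by
      have := Finset.mem_range.1 hi
      simp only [k] at this; omega
    have : (i:ℝ) ≤ Θ * d / 2 := (Nat.le_floor_iff (by positivity)).1 hi'
    have : 1 / (d:ℝ) * i ≤ Θ / 2 := by
      rw [one_div, inv_mul_le_iff₀ hd0]; linarith
    linarith
  have h3 : ∑ i ∈ Finset.range k, max 0 (Θ - 1 / d * i) ≤ ∑ i ∈ Finset.range s, max 0 (Θ - 1 / (d:ℝ) * i) :=
    Finset.sum_le_sum_of_subset_of_nonneg (by simp [k]) fun _ _ _ => le_max_left _ _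
  simp only [Finset.sum_const, Finset.card_range, nsmul_eq_mul] at h2
  nlinarith

lemma one_le_wn {σ : Type*} [Fintype σ] (F : MvPolynomial σ ℤ) (hF : F ≠ 0) : 1 ≤ wn 1 F := by
  obtain ⟨j, hj⟩ := MvPolynomial.ne_zero_iff.1 hF
  have := coeff_le_wn (ρ := (1 : σ → ℝ)) (by simp) F j
  simp at this
  refine le_trans ?_ this
  have : (1:ℝ) ≤ |(coeff j F : ℤ)| := by exact_mod_cast Int.one_le_abs hj
  simpa [Int.norm_eq_abs] using this

set_option maxHeartbeats 2000000 in
theorem roth (n : ℕ) : ∀ θ : ℝ, 0 < θ → ∃ ω : ℝ, 0 < ω ∧ ∀ (d : Fin n → ℕ) (ξ : Fin n → ℚ) (G : ℝ)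
    (F : MvPolynomial (Fin n) ℤ), (∀ i, 1 ≤ d i) → (∀ i j, i < j → (d i : ℝ) ≤ ω * d j) →
    (∀ i, G ≤ d i * Real.log (ξ i).den) → F ≠ 0 → (∀ i, degreeOf i F ≤ d i) →
    Real.log (wn 1 F) + ∑ i, (d i : ℝ) ≤ ω * G →
    ¬ WGe (fun i => 1 / (d i : ℝ)) θ (tr ξ (map (Int.castRingHom ℚ) F)) := by
  classical
  induction n with
  | zero =>
    intro θ hθ
    refine ⟨1, one_pos, ?_⟩
    intro d ξ G F _ _ _ hF _ _ hW
    have h1 : tr ξ (map (Int.castRingHom ℚ) F) ≠ 0 := by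
      rw [eq_C_of_isEmpty F]
      simp only [map_C, tr, aeval_C]
      intro h
      apply hF
      rw [eq_C_of_isEmpty F]
      have : (algebraMap ℚ (MvPolynomial (Fin 0) ℚ)) = C := rfl
      rw [this, C_eq_zero] at h
      have h' : coeff 0 F = 0 := by simpa using h
      rw [h', C_0]
    obtain ⟨j, hj⟩ := support_nonempty.2 h1
    have := hW j hj
    simp [wt] at this
    linarith
  | succ n ih =>
    intro Θ0 hΘ0
    set Θ := min Θ0 1 with hΘdef
    have hΘ : 0 < Θ := lt_min hΘ0 one_pos
    have hΘ1 : Θ ≤ 1 := min_le_right _ _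
    obtain ⟨ωn, hωn, IH⟩ := ih (Θ^2/64) (by positivity)
    refine ⟨min (ωn/3) (Θ^2/128), by positivity, ?_⟩
    set ω := min (ωn/3) (Θ^2/128) with hωdef
    have hω1 : ω ≤ ωn/3 := min_le_left _ _
    have hω2 : ω ≤ Θ^2/128 := min_le_right _ _
    have hω : 0 < ω := by positivity
    intro d ξ G F hd1 hdω hG hF hdeg hlog hW
    have hFq : map (Int.castRingHom ℚ) F ≠ 0 := by
      rwa [Ne, map_eq_zero_iff _ (map_injective _ (RingHom.injective_int _))]
    obtain ⟨s, hs1, hs2, I, j, hI, hj, U, V, hU, hV, hUV⟩ :=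
      exists_wdet _ hFq (d 0) ((degreeOf_le_iff.2 fun m hm =>
        degreeOf_le_iff.1 (hdeg 0) m (support_map_subset _ _ hm)))
    have hd0 : ∀ i, (1:ℝ) ≤ d i := fun i => by exact_mod_cast hd1 i
    set D : ℝ := ∑ i, (d i : ℝ) with hDdef
    have hD0 : (d 0 : ℝ) ≤ D := Finset.single_le_sum (f := fun i => (d i : ℝ)) (fun i _ => by positivity) (Finset.mem_univ 0)
    have hFone := one_le_wn F hF
    have hlogF : 0 ≤ Real.log (wn 1 F) := Real.log_nonneg hFone
    have hGpos : 0 < G := by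
      have : 0 < ω * G := by linarith [hd0 0]
      exact (pos_iff_pos_of_mul_pos this).1 hω
    have hsR : (1:ℝ) ≤ s := by exact_mod_cast hs1
    set W := wdet F I j with hWdef
    rw [wdet_map] at hUV
    have hcoef : ∀ k a, ((coeff (Finsupp.cons k a) W : ℤ) : ℚ) = coeff a U * coeff (Finsupp.single 0 k) V := by
      intro k a
      rw [← coeff_mg, ← hUV, coeff_map]; rfl
    have hW0 : W ≠ 0 := by
      intro h
      obtain ⟨a, ha⟩ := MvPolynomial.ne_zero_iff.1 hU
      obtain ⟨b, hb⟩ := MvPolynomial.ne_zero_iff.1 hV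
      have := hcoef (b 0) a
      rw [h, ← fin1_eq] at this
      simp at this
      tauto
    have hWone := one_le_wn W hW0
    -- size of W
    have hWlog : Real.log (wn 1 W) ≤ s * (2 * D + Real.log (wn 1 F)) := by
      have h1 := Real.log_le_log (by linarith) (wdet_wn F I j d hdeg)
      refine h1.trans ?_
      rw [Real.log_mul (by positivity) (by positivity), Real.log_pow, Real.log_mul (by positivity) (by positivity), Real.log_pow]
      have h2 : Real.log (s.factorial : ℝ) ≤ s * D := by
        have : (s.factorial : ℝ) ≤ (s:ℝ)^s := by exact_mod_cast Nat.factorial_le_pow s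
        refine (Real.log_le_log (by positivity) this).trans ?_
        rw [Real.log_pow]
        refine mul_le_mul_of_nonneg_left ?_ (by positivity)
        refine (Real.log_le_sub_one_of_pos (by linarith)).trans ?_
        have : (s:ℝ) ≤ d 0 + 1 := by exact_mod_cast hs2
        linarith
      have h3 : Real.log 2 ≤ 1 := by linarith [Real.log_two_lt_d9]
      have h4 : ((∑ i, d i : ℕ) : ℝ) = D := by push_cast; rfl
      rw [h4]
      have : D * Real.log 2 ≤ D := by nlinarith [hd0 0]
      nlinarith
    have hWlog2 : Real.log (wn 1 W) ≤ 2 * s * ω * G := by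
      refine hWlog.trans ?_
      have : 2 * D + Real.log (wn 1 F) ≤ 2 * (ω * G) := by linarith
      nlinarith
    obtain ⟨μ0, hμ0⟩ := MvPolynomial.ne_zero_iff.1 hU
    obtain ⟨b0, hb0⟩ := MvPolynomial.ne_zero_iff.1 hV
    rw [fin1_eq b0] at hb0
    set k0 := b0 0
    -- first factor
    let U1 : MvPolynomial (Fin n) ℤ := Polynomial.coeff (finSuccEquiv ℤ n W) k0
    have hU1c : ∀ a, coeff a U1 = coeff (Finsupp.cons k0 a) W := fun a => finSuccEquiv_coeff_coeff _ _ _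
    have hU1m : map (Int.castRingHom ℚ) U1 = C (coeff (Finsupp.single 0 k0) V) * U := by
      ext a
      rw [coeff_map, hU1c, coeff_C_mul, mul_comm, ← hcoef]; rfl
    have hU10 : U1 ≠ 0 := by
      rintro h
      rw [h, map_zero] at hU1m
      have := congrArg (coeff μ0) hU1m
      rw [coeff_C_mul, coeff_zero] at this
      exact mul_ne_zero hb0 hμ0 this.symm
    have hU1wn : wn 1 U1 ≤ wn 1 W := by
      simp only [wn, Pi.one_apply, one_pow, Finset.prod_const_one, mul_one]
      rw [← Finset.sum_image (s := U1.support) (g := Finsupp.cons k0) (f := fun j => ‖coeff j W‖)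
        (fun x _ y _ h => by simpa using congrArg Finsupp.tail h) |>.trans
        (Finset.sum_congr rfl fun a _ => by rw [hU1c])]
      refine Finset.sum_le_sum_of_subset_of_nonneg ?_ fun _ _ _ => norm_nonneg _
      intro x hx
      obtain ⟨a, ha, rfl⟩ := Finset.mem_image.1 hx
      rw [mem_support_iff, hU1c] at ha
      exact mem_support_iff.2 ha
    have hIH := IH (fun i => s * d i.succ) (fun i => ξ i.succ) (s * G) U1
      (fun i => Nat.mul_pos hs1 (hd1 _)) ?_ ?_ hU10 ?_ ?_
    rotate_left
    · intro i i' hii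
      have := hdω i.succ i'.succ (by simpa using hii)
      have h2 : ω * d i'.succ ≤ ωn * d i'.succ := by
        refine mul_le_mul_of_nonneg_right (by linarith) (by positivity)
      push_cast
      nlinarith
    · intro i
      have := hG i.succ
      push_cast
      rw [mul_assoc]
      exact mul_le_mul_of_nonneg_left this (by positivity)
    · intro i
      refine (degreeOf_coeff_finSuccEquiv W i k0).trans ((wdet_degreeOf F I j _).trans ?_)
      exact Nat.mul_le_mul_left _ (hdeg _)
    · have h1 : Real.log (wn 1 U1) ≤ 2 * s * ω * G :=
        (Real.log_le_log (by linarith [one_le_wn U1 hU10]) hU1wn).trans hWlog2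
      have h2 : ∑ i : Fin n, ((s * d i.succ : ℕ) : ℝ) ≤ s * D := by
        rw [hDdef, Fin.sum_univ_succ, mul_add, Finset.mul_sum]
        push_cast
        have := hd0 0
        nlinarith
      have h3 : s * D ≤ s * (ω * G) := mul_le_mul_of_nonneg_left (by linarith) (by positivity)
      have h4 : ω * (s * G) ≤ ωn / 3 * (s * G) := mul_le_mul_of_nonneg_right hω1 (by positivity)
      nlinarith
    -- second factor
    let V1 : MvPolynomial (Fin 1) ℤ := ∑ k ∈ Finset.range (degreeOf 0 W + 1),
      monomial (Finsupp.single 0 k) (coeff (Finsupp.cons k μ0) W)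
    have hV1c : ∀ k, coeff (Finsupp.single 0 k) V1 = coeff (Finsupp.cons k μ0) W := by
      intro k
      simp only [V1, coeff_sum, coeff_monomial]
      by_cases hk : k < degreeOf 0 W + 1
      · rw [Finset.sum_eq_single k]
        · simp
        · intro k' _ hk'
          rw [if_neg]
          intro h
          exact hk' (by simpa using congrArg (fun z => z 0) h)
        · intro h; simp at h; omega
      · rw [Finset.sum_eq_zero]
        · by_contra hne
          have := degreeOf_le_iff.1 (le_refl (degreeOf 0 W)) _ (mem_support_iff.2 (Ne.symm hne))
          simp at this; omega
        · intro k' hk'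
          rw [if_neg]
          intro h
          have h' : k' = k := by simpa using congrArg (fun z => z 0) h
          rw [Finset.mem_range] at hk'
          omega
    have hV1m : map (Int.castRingHom ℚ) V1 = C (coeff μ0 U) * V := by
      refine MvPolynomial.ext _ _ fun a => ?_
      rw [coeff_map, fin1_eq a, hV1c, coeff_C_mul, ← hcoef]; rfl
    have hV10 : V1 ≠ 0 := by
      rintro h
      rw [h, map_zero] at hV1m
      have := congrArg (coeff (Finsupp.single 0 k0)) hV1m
      rw [coeff_C_mul, coeff_zero] at this
      exact mul_ne_zero hμ0 hb0 this.symm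
    obtain ⟨e, he1, he2⟩ := one_var V1 hV10 (ξ 0) (wn 1 W) (by
      intro a
      rw [fin1_eq a, hV1c]
      have := coeff_le_wn (ρ := (1 : Fin (n+1) → ℝ)) (by simp) W (Finsupp.cons (a 0) μ0)
      simpa [Int.norm_eq_abs] using this)
    have he : (e : ℝ) / d 0 ≤ 2 * s * ω := by
      have h1 : (e:ℝ) * Real.log (ξ 0).den ≤ 2 * s * ω * G := by
        refine le_trans ?_ hWlog2
        rw [← Real.log_pow]
        refine Real.log_le_log ?_ he2
        have := (ξ 0).den_pos
        positivity
      have hdpos : (0:ℝ) < d 0 := by linarith [hd0 0]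
      have h2 := hG 0
      have h3 : 0 < Real.log (ξ 0).den := by
        have : 0 < d 0 * Real.log (ξ 0).den := by linarith
        exact (pos_iff_pos_of_mul_pos this).1 hdpos
      rw [div_le_iff₀ hdpos]
      have h4 : (e:ℝ) * Real.log (ξ 0).den ≤ (2 * s * ω * d 0) * Real.log (ξ 0).den := by
        refine h1.trans ?_
        rw [mul_assoc (2 * (s:ℝ) * ω)]
        exact mul_le_mul_of_nonneg_left h2 (by positivity)
      exact le_of_mul_le_mul_right h4 h3
    -- the low-weight monomial
    rw [WGe] at hIH
    push Not at hIH
    obtain ⟨ν, hν1, hν2⟩ := hIH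
    have hνU : coeff ν (tr (fun i => ξ i.succ) U) ≠ 0 := by
      rw [mem_support_iff, hU1m, map_mul] at hν1
      have : tr (fun i : Fin n => ξ i.succ) (C (coeff (Finsupp.single 0 k0) V)) = C (coeff (Finsupp.single 0 k0) V) := by
        simp [tr]
      rw [this, coeff_C_mul] at hν1
      exact right_ne_zero_of_mul hν1
    have heV : coeff (Finsupp.single 0 e) (tr (fun _ => ξ 0) V) ≠ 0 := by
      rw [hV1m, map_mul] at he1
      have : tr (fun _ => ξ 0) (C (coeff μ0 U)) = (C (coeff μ0 U) : MvPolynomial (Fin 1) ℚ) := by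
        simp [tr]
      rw [this, coeff_C_mul] at he1
      exact right_ne_zero_of_mul he1
    have hmon : Finsupp.cons e ν ∈ (tr ξ (map (Int.castRingHom ℚ) W)).support := by
      rw [hUV, tr_mg, mem_support_iff, coeff_mg]
      exact mul_ne_zero hνU heV
    -- lower bound for weights
    have hlow := wdet_WGe (map (Int.castRingHom ℚ) F) I j ξ (fun i => 1 / (d i : ℝ)) (fun i => by positivity) Θ ω
      (hW.mono (min_le_left _ _)) ?_ 
    rotate_left
    · intro a
      by_cases hn : n = 0
      · subst hn; simp [wt]; exact hω.le
      rw [wt]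
      have hb : ∀ i : Fin n, 1 / (d i.succ : ℝ) * I a i ≤ ω / d 0 * I a i := by
        intro i
        refine mul_le_mul_of_nonneg_right ?_ (by positivity)
        rw [div_le_div_iff₀ (by linarith [hd0 i.succ]) (by linarith [hd0 0]), one_mul]
        exact hdω 0 i.succ (Fin.succ_pos i)
      refine (Finset.sum_le_sum fun i _ => hb i).trans ?_
      rw [← Finset.mul_sum]
      have h1 : (∑ i, (I a i : ℝ)) ≤ d 0 := by
        have := hI a
        have : ∑ i, I a i ≤ d 0 := by omega
        exact_mod_cast this
      calc ω / d 0 * ∑ i, (I a i : ℝ) ≤ ω / d 0 * d 0 := mul_le_mul_of_nonneg_left h1 (by positivity)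
        _ = ω := by field_simp [show (d 0 : ℝ) ≠ 0 by linarith [hd0 0]]
    rw [wdet_map] at hlow
    have hfin := hlow _ hmon
    rw [hj (fun i => max 0 (Θ - ω - 1 / (d 0 : ℝ) * i))] at hfin
    have hΘω : Θ / 2 ≤ Θ - ω := by nlinarith
    have hsl := sum_lb s (d 0) (hd1 0) hs2 (Θ - ω) (by linarith) (by linarith)
    have hwt : wt (fun i => 1 / (d i : ℝ)) (Finsupp.cons e ν) = e / d 0 + s * wt (fun i : Fin n => 1 / ((s * d i.succ : ℕ) : ℝ)) ν := by
      simp only [wt, Fin.sum_univ_succ, Finsupp.cons_zero, Finsupp.cons_succ, Finset.mul_sum]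
      congr 1
      · ring
      · refine Finset.sum_congr rfl fun i _ => ?_
        push_cast
        have := hd0 i.succ
        field_simp
    rw [hwt] at hfin
    have h5 : s * (Θ / 2)^2 / 8 ≤ s * (Θ - ω)^2 / 8 := by
      have : (Θ / 2)^2 ≤ (Θ - ω)^2 := by nlinarith
      nlinarith
    have h6 : s * wt (fun i : Fin n => 1 / ((s * d i.succ : ℕ) : ℝ)) ν < s * (Θ^2/64) :=
      mul_lt_mul_of_pos_left hν2 (by linarith)
    have h7 : 2 * s * ω ≤ 2 * s * (Θ^2/128) := mul_le_mul_of_nonneg_left hω2 (by positivity)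
    nlinarith

end Sst


namespace Sst
open MvPolynomial
set_option linter.unusedSectionVars false
set_option linter.unusedSimpArgs false
set_option linter.unusedVariables false

lemma second_moment {H X : Type*} [Fintype H] [DecidableEq H] [DecidableEq X] (S : H → Finset X)
    (f : H → X → ℝ) (B : ℝ) (hf0 : ∀ h, ∑ x ∈ S h, f h x = 0) (hfB : ∀ h, ∀ x ∈ S h, |f h x| ≤ B) :
    ∑ j ∈ Fintype.piFinset S, (∑ h, f h (j h)) ^ 2 ≤
      Fintype.card H * B ^ 2 * (Fintype.piFinset S).card := by
  have h1 : ∀ j : H → X, (∑ h, f h (j h)) ^ 2 = ∑ h, ∑ h', f h (j h) * f h' (j h') := by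
    intro j; rw [sq, Finset.sum_mul_sum]
  simp only [h1]
  rw [Finset.sum_comm]
  have h2 : ∀ h ∈ (Finset.univ : Finset H), ∑ j ∈ Fintype.piFinset S, ∑ h', f h (j h) * f h' (j h') ≤
      B ^ 2 * (Fintype.piFinset S).card := by
    intro h _
    rw [Finset.sum_comm]
    rw [Finset.sum_eq_single h]
    · calc ∑ j ∈ Fintype.piFinset S, f h (j h) * f h (j h) ≤ ∑ j ∈ Fintype.piFinset S, B ^ 2 := by
            refine Finset.sum_le_sum fun j hj => ?_
            have := hfB h (j h) (Fintype.mem_piFinset.1 hj h)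
            rw [← sq, ← sq_abs]
            exact pow_le_pow_left₀ (abs_nonneg _) this 2
        _ = _ := by simp [mul_comm]
    · intro h' _ hne
      let g : H → X → ℝ := fun k x => if k = h then f h x else if k = h' then f h' x else 1
      have h3 : ∀ j : H → X, f h (j h) * f h' (j h') = ∏ k, g k (j k) := by
        intro j
        rw [Fintype.prod_eq_mul h h' hne.symm]
        · simp [g, hne]
        · rintro k ⟨hk1, hk2⟩; simp [g, hk1, hk2]
      simp only [h3]
      rw [← Finset.prod_univ_sum]
      refine Finset.prod_eq_zero (Finset.mem_univ h) ?_
      simpa [g] using hf0 h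
    · simp
  refine (Finset.sum_le_sum h2).trans ?_
  simp; ring_nf; rfl

lemma chebyshev {H X : Type*} [Fintype H] [DecidableEq H] [DecidableEq X] (S : H → Finset X)
    (f : H → X → ℝ) (B : ℝ) (hf0 : ∀ h, ∑ x ∈ S h, f h x = 0) (hfB : ∀ h, ∀ x ∈ S h, |f h x| ≤ B)
    (ε : ℝ) (hε : 0 < ε) (T : Finset (H → X)) (hTs : T ⊆ Fintype.piFinset S)
    (hTm : ∀ j ∈ T, Fintype.card H * ε < ∑ h, f h (j h)) :
    (T.card : ℝ) *
      (Fintype.card H * ε) ^ 2 ≤ Fintype.card H * B ^ 2 * (Fintype.piFinset S).card := by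
  refine le_trans ?_ (second_moment S f B hf0 hfB)
  refine le_trans ?_ (Finset.sum_le_sum_of_subset_of_nonneg hTs fun _ _ _ => sq_nonneg _)
  rw [← nsmul_eq_mul]
  apply Finset.card_nsmul_le_sum
  intro j hj
  exact pow_le_pow_left₀ (by positivity) (hTm j hj).le 2

/-- the average of a linear function over the simplex -/
lemma simplex_mean {ι : Type*} [Fintype ι] [DecidableEq ι] (c : ι → ℝ) (d : ℕ) :
    (Fintype.card ι : ℝ) * ∑ j ∈ Finset.piAntidiag (Finset.univ : Finset ι) d, ∑ i, c i * (j i : ℝ) =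
      (∑ i, c i) * d * (Finset.piAntidiag (Finset.univ : Finset ι) d).card := by
  set S := Finset.piAntidiag (Finset.univ : Finset ι) d with hS
  have hmem : ∀ j : ι → ℕ, j ∈ S ↔ ∑ i, j i = d := by intro j; simp [hS]
  have hsym : ∀ i i', ∑ j ∈ S, (j i : ℝ) = ∑ j ∈ S, (j i' : ℝ) := by
    intro i i'
    refine Finset.sum_nbij' (fun j => j ∘ Equiv.swap i i') (fun j => j ∘ Equiv.swap i i') ?_ ?_ ?_ ?_ ?_
    · intro j hj
      rw [hmem] at hj ⊢
      rw [← hj]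
      exact Equiv.sum_comp (Equiv.swap i i') j
    · intro j hj
      rw [hmem] at hj ⊢
      rw [← hj]
      exact Equiv.sum_comp (Equiv.swap i i') j
    · intro j _; funext k; simp
    · intro j _; funext k; simp
    · intro j _; simp
  have htot : ∑ i, ∑ j ∈ S, (j i : ℝ) = d * S.card := by
    rw [Finset.sum_comm]
    rw [Finset.sum_congr rfl (g := fun _ => (d:ℝ))]
    · simp [mul_comm]
    · intro j hj
      have := (hmem j).1 hj
      exact_mod_cast this
  have hone : ∀ i, (Fintype.card ι : ℝ) * ∑ j ∈ S, (j i : ℝ) = d * S.card := by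
    intro i
    rw [← htot, Finset.sum_congr rfl (fun i' _ => hsym i' i)]
    simp
  rw [Finset.sum_comm, Finset.mul_sum, mul_assoc, Finset.sum_mul]
  refine Finset.sum_congr rfl fun i _ => ?_
  rw [← Finset.mul_sum, mul_left_comm, hone]

/-- multi-indices, as finitely supported functions -/
noncomputable def toF {m : ℕ} {ι : Type*} [Fintype ι] (j : Fin m → ι → ℕ) : (Fin m × ι) →₀ ℕ :=
  Finsupp.equivFunOnFinite.symm fun p => j p.1 p.2

@[simp] lemma toF_apply {m : ℕ} {ι : Type*} [Fintype ι] (j : Fin m → ι → ℕ) (p : Fin m × ι) :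
    toF j p = j p.1 p.2 := rfl

lemma toF_inj {m : ℕ} {ι : Type*} [Fintype ι] : Function.Injective (toF (m := m) (ι := ι)) := by
  intro j j' h
  funext a b
  have := DFunLike.congr_fun h (a, b)
  simpa using this

/-- block-homogeneous of multidegree d -/
def BH {m : ℕ} {ι : Type*} [Fintype ι] {R : Type*} [CommRing R] (d : Fin m → ℕ) (f : MvPolynomial (Fin m × ι) R) : Prop :=
  ∀ j ∈ f.support, ∀ h, ∑ i, j (h, i) = d h

section BH
variable {m : ℕ} {ι : Type*} [Fintype ι] {R S : Type*} [CommRing R] [CommRing S]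

lemma BH.zero (d : Fin m → ℕ) : BH d (0 : MvPolynomial (Fin m × ι) R) := by intro j hj; simp at hj

lemma BH.add {d : Fin m → ℕ} {f g : MvPolynomial (Fin m × ι) R} (hf : BH d f) (hg : BH d g) : BH d (f + g) := by
  classical
  intro j hj
  rcases Finset.mem_union.1 (support_add hj) with h | h
  exacts [hf j h, hg j h]

lemma BH.sum {d : Fin m → ℕ} {α : Type*} (s : Finset α) {f : α → MvPolynomial (Fin m × ι) R}
    (hf : ∀ a ∈ s, BH d (f a)) : BH d (∑ a ∈ s, f a) := by
  classical
  induction s using Finset.induction_on with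
  | empty => simpa using BH.zero d
  | insert a s ha ih =>
    rw [Finset.sum_insert ha]
    exact (hf a (by simp)).add (ih fun b hb => hf b (by simp [hb]))

lemma BH.mul {d d' : Fin m → ℕ} {f g : MvPolynomial (Fin m × ι) R} (hf : BH d f) (hg : BH d' g) :
    BH (d + d') (f * g) := by
  classical
  intro j hj h
  obtain ⟨a, ha, b, hb, rfl⟩ := Finset.mem_add.1 (support_mul f g hj)
  simp [Finset.sum_add_distrib, hf a ha h, hg b hb h]

lemma BH.C (r : R) : BH (0 : Fin m → ℕ) (C r : MvPolynomial (Fin m × ι) R) := by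
  classical
  intro j hj h
  rw [mem_support_iff, coeff_C] at hj
  have : j = 0 := by by_contra h0; exact hj (if_neg (Ne.symm h0))
  simp [this]

lemma BH.pow {d : Fin m → ℕ} {f : MvPolynomial (Fin m × ι) R} (hf : BH d f) (k : ℕ) : BH (k • d) (f ^ k) := by
  induction k with
  | zero => simpa using BH.C (m := m) (ι := ι) (1 : R)
  | succ k ih => rw [pow_succ, succ_nsmul]; exact ih.mul hf

lemma BH.prod {α : Type*} (s : Finset α) {d : α → Fin m → ℕ} {f : α → MvPolynomial (Fin m × ι) R}
    (hf : ∀ a ∈ s, BH (d a) (f a)) : BH (∑ a ∈ s, d a) (∏ a ∈ s, f a) := by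
  classical
  induction s using Finset.induction_on with
  | empty => simpa using BH.C (m := m) (ι := ι) (1 : R)
  | insert a s ha ih =>
    rw [Finset.sum_insert ha, Finset.prod_insert ha]
    exact (hf a (by simp)).mul (ih fun b hb => hf b (by simp [hb]))

lemma BH.X [DecidableEq ι] (h : Fin m) (i : ι) : BH (Pi.single h 1) (X (h, i) : MvPolynomial (Fin m × ι) R) := by
  classical
  intro j hj h'
  have hj' : j = Finsupp.single (h, i) 1 := by
    by_contra hne
    rw [mem_support_iff, coeff_X] at hj
    exact hj (if_neg (Ne.symm hne))
  subst hj'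
  by_cases hh : h' = h
  · subst hh
    simp [Finsupp.single_apply]
  · rw [Finset.sum_eq_zero]
    · simp [hh]
    · intro x _
      rw [Finsupp.single_apply, if_neg]
      intro h2
      exact hh (congrArg Prod.fst h2).symm

/-- a ring hom that maps variables to block-linear forms preserves block-homogeneity -/
lemma BH.hom [DecidableEq ι] (H : MvPolynomial (Fin m × ι) R →+* MvPolynomial (Fin m × ι) S) 
    (hC : ∀ r, BH (0 : Fin m → ℕ) (H (MvPolynomial.C r)))
    (hX : ∀ h i, BH (Pi.single h 1) (H (MvPolynomial.X (h, i)))) {d : Fin m → ℕ} {f : MvPolynomial (Fin m × ι) R}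
    (hf : BH d f) : BH d (H f) := by
  classical
  rw [f.as_sum, map_sum]
  refine BH.sum _ fun j hj => ?_
  rw [monomial_eq, map_mul, Finsupp.prod, map_prod]
  have h1 : BH (∑ v ∈ j.support, j v • Pi.single v.1 1) (∏ x ∈ j.support, H (MvPolynomial.X x ^ j x)) := by
    refine BH.prod _ fun v _ => ?_
    rw [map_pow]
    exact (hX v.1 v.2).pow _
  have h2 := (hC (coeff j f)).mul h1
  convert h2 using 1
  rw [zero_add]
  funext h
  rw [← hf j hj h, Finset.sum_apply]
  rw [Finset.sum_subset (s₁ := j.support) (Finset.subset_univ _) (by intro v _ hv; simp at hv; simp [hv])]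
  rw [Fintype.sum_prod_type]
  rw [Finset.sum_eq_single h]
  · simp
  · intro h' _ hne
    simp [Pi.single_apply, hne.symm]
  · simp

end BH

/-- blockwise linear substitution -/
noncomputable def bsub {m : ℕ} {ι : Type*} [Fintype ι] {R S : Type*} [CommRing R] [CommRing S] (g : R →+* S)
    (E : Fin m → Matrix ι ι S) : MvPolynomial (Fin m × ι) R →+* MvPolynomial (Fin m × ι) S :=
  eval₂Hom (C.comp g) fun p => ∑ i, C (E p.1 p.2 i) * X (p.1, i)

section bsub
variable {m : ℕ} {ι : Type*} [Fintype ι] {R S : Type*} [CommRing R] [CommRing S]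

@[simp] lemma bsub_C (g : R →+* S) (E : Fin m → Matrix ι ι S) (r : R) : bsub g E (C r) = C (g r) := by
  simp [bsub]

@[simp] lemma bsub_X (g : R →+* S) (E : Fin m → Matrix ι ι S) (p : Fin m × ι) :
    bsub g E (X p) = ∑ i, C (E p.1 p.2 i) * X (p.1, i) := by
  simp [bsub]

lemma bsub_BH [DecidableEq ι] (g : R →+* S) (E : Fin m → Matrix ι ι S) {d : Fin m → ℕ} {f : MvPolynomial (Fin m × ι) R}
    (hf : BH d f) : BH d (bsub g E f) := by
  refine BH.hom _ ?_ ?_ hf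
  · intro r; rw [bsub_C]; exact BH.C _
  · intro h i
    rw [bsub_X]
    refine BH.sum _ fun i' _ => ?_
    simpa using (BH.C (m := m) (ι := ι) (E h i i')).mul (BH.X h i')

end bsub

end Sst


namespace Sst
open MvPolynomial
set_option linter.unusedSectionVars false
set_option linter.unusedSimpArgs false
set_option linter.unusedVariables false

attribute [local instance] Matrix.seminormedAddCommGroup in
lemma siegel {α β : Type*} [Fintype α] [Fintype β] (A : α → β → ℤ) (B : ℝ) (hB : 1 ≤ B)
    (hA : ∀ a b, |(A a b : ℝ)| ≤ B) (hc : 2 * Fintype.card α ≤ Fintype.card β) (hβ : 0 < Fintype.card β) :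
    ∃ t : β → ℤ, t ≠ 0 ∧ (∀ a, ∑ b, t b * A a b = 0) ∧ ∀ b, |(t b : ℝ)| ≤ Fintype.card β * B := by
  classical
  have hβ1 : (1:ℝ) ≤ Fintype.card β := by exact_mod_cast hβ
  rcases Nat.eq_zero_or_pos (Fintype.card α) with h0 | h0
  · have : IsEmpty α := Fintype.card_eq_zero_iff.1 h0
    refine ⟨fun _ => 1, ?_, fun a => this.elim a, ?_⟩
    · obtain ⟨b⟩ := Fintype.card_pos_iff.1 hβ
      intro h; simpa using congrFun h b
    · intro b; simp; nlinarith
  · obtain ⟨t, ht0, ht1, ht2⟩ := Int.Matrix.exists_ne_zero_int_vec_norm_le (Matrix.of A) (by omega) h0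
    refine ⟨t, ht0, ?_, ?_⟩
    · intro a
      have := congrFun ht1 a
      simp [Matrix.mulVec, dotProduct] at this
      rw [← this]
      exact Finset.sum_congr rfl fun b _ => mul_comm _ _
    · intro b
      have h1 : |(t b : ℝ)| ≤ ‖t‖ := by
        have := norm_le_pi_norm t b
        rwa [Int.norm_eq_abs] at this
      refine h1.trans (ht2.trans ?_)
      have hn : ‖(Matrix.of A : Matrix α β ℤ)‖ ≤ B := by
        rw [Matrix.norm_le_iff (by linarith)]
        intro a b
        rw [Int.norm_eq_abs]; exact hA a b
      have hm : max 1 ‖(Matrix.of A : Matrix α β ℤ)‖ ≤ B := max_le hB hn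
      have hm1 : 1 ≤ max 1 ‖(Matrix.of A : Matrix α β ℤ)‖ := le_max_left _ _
      have hca : 2 * (Fintype.card α : ℝ) ≤ Fintype.card β := by exact_mod_cast hc
      have hca0 : (1:ℝ) ≤ Fintype.card α := by exact_mod_cast h0
      calc _ ≤ ((Fintype.card β : ℝ) * max 1 ‖(Matrix.of A : Matrix α β ℤ)‖) ^ (1:ℝ) := by
            refine Real.rpow_le_rpow_of_exponent_le (by nlinarith) ?_
            rw [div_le_one (by linarith)]
            linarith
        _ ≤ _ := by
            rw [Real.rpow_one]
            exact mul_le_mul_of_nonneg_left hm (by positivity)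

lemma norm_intCast_le_abs {O : Type*} [SeminormedCommRing O] [NormOneClass O] (n : ℤ) : ‖(n : O)‖ ≤ ‖n‖ := by
  have := norm_zsmul_le n (1 : O)
  simpa [Int.norm_eq_abs] using this

section aux
variable {m : ℕ} {ι : Type*} [Fintype ι] [DecidableEq ι]

lemma BH.prod_const {R : Type*} [CommRing R] {d : Fin m → ℕ} {f : MvPolynomial (Fin m × ι) R} (hf : BH d f) (e : ℝ)
    {j} (hj : j ∈ f.support) : ∏ v, e ^ j v = e ^ (∑ h, d h) := by
  rw [Finset.prod_pow_eq_pow_sum, Fintype.sum_prod_type]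
  congr 1
  exact Finset.sum_congr rfl fun h _ => hf j hj h

lemma bsub_wn {R : Type*} [SeminormedCommRing R] {O : Type*} [SeminormedCommRing O] [NormOneClass O]
    (g : R →+* O) (hg : ∀ r, ‖g r‖ ≤ ‖r‖)
    (E : Fin m → Matrix ι ι O) (e : ℝ) (he : ∀ h i, ∑ i', ‖E h i i'‖ ≤ e) (he0 : 0 ≤ e)
    {d : Fin m → ℕ} {f : MvPolynomial (Fin m × ι) R} (hf : BH d f) :
    wn 1 (bsub g E f) ≤ wn 1 f * e ^ (∑ h, d h) := by
  refine (wn_hom_le (ρ := 1) (ρ' := fun _ => e) (by simp) (bsub g E) ?_ ?_ f).trans ?_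
  · intro r; rw [bsub_C, wn_C]; exact hg r
  · intro v
    rw [bsub_X]
    refine (wn_sum_le (by simp) _ _).trans (le_trans ?_ (he v.1 v.2))
    refine Finset.sum_le_sum fun i _ => ?_
    refine (wn_mul_le (by simp) _ _).trans ?_
    rw [wn_C, wn_X]; simp
  · refine wn_le_of_le_one (fun _ => he0) f _ ?_
    intro j hj
    rw [hf.prod_const e hj]

lemma card_simplex_le (d : ℕ) : ((Finset.piAntidiag (Finset.univ : Finset ι) d).card : ℝ) ≤
    Real.exp (Fintype.card ι * d) := by
  have h1 : Finset.piAntidiag (Finset.univ : Finset ι) d ⊆ Fintype.piFinset fun _ => Finset.range (d+1) := by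
    intro j hj
    rw [Fintype.mem_piFinset]
    intro i
    have : ∑ i, j i = d := by simpa using hj
    have := Finset.single_le_sum (f := j) (fun _ _ => Nat.zero_le _) (Finset.mem_univ i)
    rw [Finset.mem_range]; omega
  have h2 := Finset.card_le_card h1
  rw [Fintype.card_piFinset] at h2
  simp at h2
  have h3 : ((Finset.piAntidiag (Finset.univ : Finset ι) d).card : ℝ) ≤ ((d:ℝ)+1)^(Fintype.card ι) := by exact_mod_cast h2
  refine h3.trans ?_
  rw [Real.exp_nat_mul]
  exact pow_le_pow_left₀ (by positivity) (Real.add_one_le_exp _) _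

theorem exists_aux [Nonempty ι] {O : Type*} [SeminormedCommRing O] [NormOneClass O] {κ : Type*} [Fintype κ]
    (ψ : O →+ (κ → ℤ)) (hψ : Function.Injective ψ) (hψb : ∀ x k, |(ψ x k : ℝ)| ≤ ‖x‖)
    (E : Matrix ι ι O) (c : ι → ℝ) (ε : ℝ) (hε : 0 < ε) :
    ∃ m : ℕ, 0 < m ∧ ∃ C3 : ℝ, 0 < C3 ∧ ∀ d : Fin m → ℕ, (∀ h, 1 ≤ d h) →
      ∃ P : MvPolynomial (Fin m × ι) ℤ, P ≠ 0 ∧ BH d P ∧ wn 1 P ≤ Real.exp (C3 * ∑ h, (d h : ℝ)) ∧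
      wn 1 (bsub (Int.castRingHom O) (fun _ => E) P) ≤ Real.exp (C3 * ∑ h, (d h : ℝ)) ∧
      ∀ j ∈ (bsub (Int.castRingHom O) (fun _ => E) P).support,
        ∑ h, (∑ i, c i * (j (h, i) : ℝ)) / d h ≤ m * ((∑ i, c i) / Fintype.card ι + ε) := by
  classical
  set N : ℝ := (Fintype.card ι : ℝ) with hN
  have hN1 : 1 ≤ N := by rw [hN]; exact_mod_cast Fintype.card_pos
  set μ := (∑ i, c i) / N with hμ
  set Cc := ∑ i, |c i| with hCc
  have hCc0 : 0 ≤ Cc := Finset.sum_nonneg fun _ _ => abs_nonneg _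
  set B := 2 * (Cc + 1) with hB
  have hB0 : 0 < B := by linarith
  obtain ⟨m, hm⟩ := exists_nat_gt (2 * (Fintype.card κ : ℝ) * B ^ 2 / ε ^ 2)
  have hm0 : 0 < m := by
    have : (0:ℝ) < m := lt_of_le_of_lt (by positivity) hm
    exact_mod_cast this
  have hm' : 2 * (Fintype.card κ : ℝ) * B ^ 2 ≤ m * ε ^ 2 := by
    rw [div_lt_iff₀ (by positivity)] at hm; exact hm.le
  set e1 : ℝ := max 1 (∑ i, ∑ i', ‖E i i'‖) with he1
  have he1one : 1 ≤ e1 := le_max_left _ _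
  have he1E : ∀ (h : Fin m) i, ∑ i', ‖E i i'‖ ≤ e1 := fun _ i =>
    le_trans (Finset.single_le_sum (f := fun i => ∑ i', ‖E i i'‖)
      (fun _ _ => Finset.sum_nonneg fun _ _ => norm_nonneg _) (Finset.mem_univ i)) (le_max_right _ _)
  refine ⟨m, hm0, 2 * N + 2 * Real.log e1 + 1, by linarith [Real.log_nonneg he1one], ?_⟩
  intro d hd
  set D := ∑ h, d h with hD
  have hDc : ∑ h, (d h : ℝ) = D := by rw [hD]; push_cast; rfl
  rw [hDc]
  let S : Fin m → Finset (ι → ℕ) := fun h => Finset.piAntidiag Finset.univ (d h)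
  have hS : ∀ h j, j ∈ S h ↔ ∑ i, j i = d h := by intro h j; simp [S]
  let tot := Fintype.piFinset S
  have htot : (tot.card : ℝ) ≤ Real.exp (N * D) := by
    rw [← hDc, Finset.mul_sum, Real.exp_sum]
    simp only [tot, Fintype.card_piFinset, Nat.cast_prod]
    exact Finset.prod_le_prod (fun _ _ => by positivity) fun h _ => card_simplex_le (d h)
  have hSne : ∀ h, (S h).Nonempty := by
    intro h
    obtain ⟨i0⟩ := (inferInstance : Nonempty ι)
    exact ⟨Pi.single i0 (d h), by rw [hS]; simp⟩
  have htotne : tot.Nonempty := Fintype.piFinset_nonempty.2 hSne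
  have htot1 : (1:ℝ) ≤ tot.card := by exact_mod_cast htotne.card_pos
  let f : Fin m → (ι → ℕ) → ℝ := fun h j => (∑ i, c i * (j i : ℝ)) / d h - μ
  let bad := tot.filter fun j => (Fintype.card (Fin m) : ℝ) * ε < ∑ h, f h (j h)
  have hd0 : ∀ h, (0:ℝ) < d h := fun h => by exact_mod_cast hd h
  have hcheb := chebyshev S f B ?_ ?_ ε hε bad (Finset.filter_subset _ _)
    (fun j hj => (Finset.mem_filter.1 hj).2)
  rotate_left
  · intro h
    simp only [f, Finset.sum_sub_distrib, ← Finset.sum_div]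
    have := simplex_mean c (d h)
    rw [Finset.sum_const, nsmul_eq_mul, hμ, sub_eq_zero]
    rw [div_eq_iff (hd0 h).ne']
    have hN0 : N ≠ 0 := by linarith
    field_simp
    simp only [S]
    rw [hN]
    linear_combination this
  · intro h j hj
    rw [hS] at hj
    have hji : ∀ i, (j i : ℝ) ≤ d h := fun i => by
      have := Finset.single_le_sum (f := j) (fun _ _ => Nat.zero_le _) (Finset.mem_univ i)
      rw [hj] at this; exact_mod_cast this
    have h1 : |(∑ i, c i * (j i : ℝ)) / d h| ≤ Cc := by
      rw [abs_div, abs_of_pos (hd0 h), div_le_iff₀ (hd0 h)]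
      refine (Finset.abs_sum_le_sum_abs _ _).trans ?_
      rw [hCc, Finset.sum_mul]
      refine Finset.sum_le_sum fun i _ => ?_
      rw [abs_mul, Nat.abs_cast]
      exact mul_le_mul_of_nonneg_left (hji i) (abs_nonneg _)
    have h2 : |μ| ≤ Cc := by
      rw [hμ, abs_div, abs_of_pos (by linarith : 0 < N), div_le_iff₀ (by linarith)]
      refine (Finset.abs_sum_le_sum_abs _ _).trans ?_
      rw [← hCc]; nlinarith
    calc |f h j| ≤ |(∑ i, c i * (j i : ℝ)) / d h| + |μ| := abs_sub _ _
      _ ≤ B := by rw [hB]; linarith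
  have hbad : 2 * (bad.card * Fintype.card κ) ≤ tot.card := by
    have hmR : (0:ℝ) < m := by exact_mod_cast hm0
    rw [Fintype.card_fin] at hcheb
    have h1 : (bad.card : ℝ) * (m * ε^2) ≤ B^2 * tot.card := by
      have : (m:ℝ) * (bad.card * (m * ε^2)) ≤ m * (B^2 * tot.card) := by
        calc (m:ℝ) * (bad.card * (m * ε^2)) = bad.card * (m * ε)^2 := by ring
          _ ≤ m * B^2 * tot.card := hcheb
          _ = _ := by ring
      exact le_of_mul_le_mul_left this hmR
    have h2 : (bad.card : ℝ) * (2 * Fintype.card κ * B^2) ≤ bad.card * (m * ε^2) :=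
      mul_le_mul_of_nonneg_left hm' (by positivity)
    have h3 : B^2 * (2 * (bad.card * Fintype.card κ) : ℝ) ≤ B^2 * tot.card := by nlinarith
    have h4 := le_of_mul_le_mul_left h3 (by positivity)
    exact_mod_cast h4
  -- Siegel
  let Φ := bsub (m := m) (Int.castRingHom O) (fun _ => E)
  have hmono : ∀ b ∈ tot, BH d (monomial (toF b) (1:ℤ)) := by
    intro b hb j hj h
    have : j = toF b := by
      by_contra hne
      rw [mem_support_iff, coeff_monomial] at hj
      exact hj (if_neg (Ne.symm hne))
    subst this
    exact (hS h _).1 (Fintype.mem_piFinset.1 hb h)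
  have hΦ : ∀ P, BH d P → wn 1 (Φ P) ≤ wn 1 P * e1 ^ D := fun P hP =>
    bsub_wn _ (fun r => norm_intCast_le_abs r) (fun _ => E) e1 he1E (by linarith) hP
  have hs1 : ∀ (a : bad × κ) (b : tot), |((ψ (coeff (toF a.1.1) (Φ (monomial (toF b.1) 1))) a.2 : ℤ) : ℝ)| ≤ e1 ^ D := by
    rintro ⟨a, k⟩ b
    refine (hψb _ _).trans ?_
    have h1 := coeff_le_wn (ρ := (1 : Fin m × ι → ℝ)) (by simp) (Φ (monomial (toF b.1) 1)) (toF a.1)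
    simp at h1
    refine h1.trans ((hΦ _ (hmono b.1 b.2)).trans ?_)
    rw [wn_monomial]; simp
  obtain ⟨t, ht0, ht1, ht2⟩ := siegel (α := bad × κ) (β := tot)
    (fun a b => ψ (coeff (toF a.1.1) (Φ (monomial (toF b.1) 1))) a.2) (e1 ^ D) (one_le_pow₀ he1one) hs1
    (by simpa using hbad) (by simpa using htotne)
  rw [Fintype.card_coe] at ht2
  let P : MvPolynomial (Fin m × ι) ℤ := ∑ b : tot, monomial (toF b.1) (t b)
  have hPc : ∀ b : tot, coeff (toF b.1) P = t b := by
    intro b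
    simp only [P, coeff_sum, coeff_monomial]
    rw [Finset.sum_eq_single b]
    · simp
    · intro b' _ hne
      rw [if_neg]
      intro h; exact hne (Subtype.ext (toF_inj h))
    · simp
  have hmC : ∀ (b : tot) , monomial (toF b.1) (t b) = C (t b) * monomial (toF b.1) (1:ℤ) := by
    intro b; rw [C_mul_monomial, mul_one]
  have hPBH : BH d P := by
    refine BH.sum _ fun b _ => ?_
    rw [hmC]
    simpa using (BH.C (m := m) (ι := ι) (t b)).mul (hmono b.1 b.2)
  have hPwn : wn 1 P ≤ Real.exp (N * D) * (Real.exp (N * D) * e1 ^ D) := by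
    refine (wn_sum_le (by simp) _ _).trans ?_
    calc ∑ b : tot, wn 1 (monomial (toF b.1) (t b)) ≤ ∑ b : tot, (tot.card * e1 ^ D : ℝ) := by
          refine Finset.sum_le_sum fun b _ => ?_
          rw [wn_monomial]
          simpa [Int.norm_eq_abs] using ht2 b
      _ = tot.card * (tot.card * e1 ^ D) := by simp
      _ ≤ _ := by gcongr
  have he1exp : e1 ^ D = Real.exp (Real.log e1 * D) := by
    rw [mul_comm, Real.exp_nat_mul, Real.exp_log (by linarith)]
  have hD0 : (0:ℝ) ≤ D := Nat.cast_nonneg _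
  have hl := Real.log_nonneg he1one
  refine ⟨P, ?_, hPBH, ?_, ?_, ?_⟩
  · intro h
    apply ht0
    funext b
    rw [← hPc b, h]; simp
  · refine hPwn.trans ?_
    rw [he1exp, ← Real.exp_add, ← Real.exp_add]
    apply Real.exp_le_exp.2
    nlinarith [mul_nonneg hl hD0]
  · refine (hΦ P hPBH).trans ((mul_le_mul_of_nonneg_right hPwn (by positivity)).trans ?_)
    rw [he1exp, ← Real.exp_add, ← Real.exp_add, ← Real.exp_add]
    apply Real.exp_le_exp.2
    nlinarith [mul_nonneg hl hD0]
  · intro j' hj'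
    have hj'BH := bsub_BH (Int.castRingHom O) (fun _ : Fin m => E) hPBH j' hj'
    let j : Fin m → ι → ℕ := fun h i => j' (h, i)
    have hjj : j' = toF j := by ext p; rfl
    have hjt : j ∈ tot := Fintype.mem_piFinset.2 fun h => (hS h _).2 (hj'BH h)
    by_contra hlt
    push Not at hlt
    have hjb : j ∈ bad := by
      refine Finset.mem_filter.2 ⟨hjt, ?_⟩
      simp only [f, Finset.sum_sub_distrib, j]
      simp
      linarith
    rw [mem_support_iff] at hj'
    apply hj'
    apply hψ
    rw [map_zero]
    funext k
    have h1 := ht1 (⟨j, hjb⟩, k)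
    have h2 : coeff j' (Φ P) = ∑ b : tot, t b • coeff j' (Φ (monomial (toF b.1) 1)) := by
      simp only [P, map_sum, coeff_sum]
      refine Finset.sum_congr rfl fun b _ => ?_
      rw [hmC, map_mul]
      simp only [Φ, bsub_C]
      rw [coeff_C_mul]; simp
    change ψ (coeff j' (Φ P)) k = 0
    rw [h2, map_sum, Finset.sum_apply, ← h1]
    refine Finset.sum_congr rfl fun b _ => ?_
    rw [map_zsmul, hjj]; simp

end aux
end Sst


namespace Sst
open MvPolynomial
set_option linter.unusedSectionVars false
set_option linter.unusedSimpArgs false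
set_option linter.unusedVariables false

/-- Filtration on a nested polynomial ring. -/
def WFil {σ ρ R : Type*} [Fintype σ] [CommRing R] (w : σ → ℝ) (θ : ℝ) (f : MvPolynomial ρ (MvPolynomial σ R)) : Prop :=
  ∀ μ, WGe w θ (coeff μ f)

section fil
variable {σ ρ R : Type*} [Fintype σ] [CommRing R] {w : σ → ℝ}

lemma WFil.sum {θ : ℝ} {α : Type*} (s : Finset α) {f : α → MvPolynomial ρ (MvPolynomial σ R)}
    (hf : ∀ a ∈ s, WFil w θ (f a)) : WFil w θ (∑ a ∈ s, f a) := by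
  intro μ
  rw [coeff_sum]
  exact WGe.sum _ fun a ha => hf a ha μ

lemma WFil.mul {θ θ' : ℝ} {f g : MvPolynomial ρ (MvPolynomial σ R)} (hf : WFil w θ f) (hg : WFil w θ' g) :
    WFil w (θ + θ') (f * g) := by
  classical
  intro μ
  rw [coeff_mul]
  exact WGe.sum _ fun a ha => (hf _).mul (hg _)

lemma WFil.of_nonneg (hw : ∀ i, 0 ≤ w i) (f : MvPolynomial ρ (MvPolynomial σ R)) : WFil w 0 f :=
  fun μ => WGe.of_nonneg hw _

lemma WFil.pow (hw : ∀ i, 0 ≤ w i) {θ : ℝ} {f : MvPolynomial ρ (MvPolynomial σ R)} (hf : WFil w θ f) (k : ℕ) :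
    WFil w (θ * k) (f ^ k) := by
  induction k with
  | zero => simpa using WFil.of_nonneg hw _
  | succ k ih => rw [pow_succ]; push_cast; rw [mul_add, mul_one]; exact ih.mul hf

lemma WFil.prod (hw : ∀ i, 0 ≤ w i) {α : Type*} (s : Finset α) {θ : α → ℝ}
    {f : α → MvPolynomial ρ (MvPolynomial σ R)}
    (hf : ∀ a ∈ s, WFil w (θ a) (f a)) : WFil w (∑ a ∈ s, θ a) (∏ a ∈ s, f a) := by
  classical
  induction s using Finset.induction_on with
  | empty => simpa using WFil.of_nonneg hw 1
  | insert a s ha ih =>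
    rw [Finset.sum_insert ha, Finset.prod_insert ha]
    exact (hf a (Finset.mem_insert_self _ _)).mul (ih fun b hb => hf b (Finset.mem_insert_of_mem hb))

lemma WFil.hom (hw : ∀ i, 0 ≤ w i) {S σ' : Type*} [CommRing S] [Fintype σ'] (H : MvPolynomial σ' S →+* MvPolynomial ρ (MvPolynomial σ R))
    (v : σ' → ℝ) (hX : ∀ s, WFil w (v s) (H (X s))) {θ : ℝ} {f : MvPolynomial σ' S}
    (hf : ∀ j ∈ f.support, θ ≤ ∑ s, v s * j s) : WFil w θ (H f) := by
  classical
  rw [f.as_sum, map_sum]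
  refine WFil.sum _ fun j hj => ?_
  rw [monomial_eq, map_mul, Finsupp.prod_fintype _ _ (by simp), map_prod]
  have h1 := (WFil.of_nonneg hw (H (C (coeff j f)))).mul (WFil.prod hw Finset.univ (θ := fun s => v s * j s)
    (f := fun s => H (X s ^ j s)) (fun s _ => by rw [map_pow]; exact (hX s).pow hw _))
  rw [zero_add] at h1
  exact fun μ => (h1 μ).mono (hf j hj)
end fil

section desc
variable {m : ℕ} {ι : Type*} [Fintype ι] [DecidableEq ι]

/-- The matrix with columns `b_J`, `J ≠ τ`, and column `τ` replaced by `e_u`. -/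
def Bp (τ : ι) (B : Fin m → Matrix ι ι ℤ) (u : Fin m → ι) (h : Fin m) : Matrix ι ι ℤ :=
  Matrix.of fun i J => if J = τ then (if i = u h then 1 else 0) else B h i J

noncomputable def rr (u l : Fin m → ι) (p : Fin m × ι) : (Fin m × ι) →₀ ℕ :=
  if p.2 = u p.1 ∨ p.2 = l p.1 then 0 else Finsupp.single p 1
noncomputable def ss (u : Fin m → ι) (p : Fin m × ι) : (Fin m) →₀ ℕ :=
  if p.2 = u p.1 then Finsupp.single p.1 1 else 0

noncomputable def res (u l : Fin m → ι) (j : (Fin m × ι) →₀ ℕ) : (Fin m × ι) →₀ ℕ := ∑ p, j p • rr u l p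
noncomputable def uu (u : Fin m → ι) (j : (Fin m × ι) →₀ ℕ) : (Fin m) →₀ ℕ := ∑ p, j p • ss u p

lemma uu_apply (u : Fin m → ι) (j : (Fin m × ι) →₀ ℕ) (h : Fin m) : uu u j h = j (h, u h) := by
  simp only [uu, ss, Finsupp.coe_finsetSum, Finset.sum_apply, Finsupp.smul_apply]
  rw [Finset.sum_eq_single (h, u h)]
  · simp
  · rintro ⟨h', i⟩ - hne
    dsimp only
    split_ifs with hc
    · by_cases hh : h' = h
      · subst hh; exact absurd (by rw [← hc]) hne
      · simp [Finsupp.single_apply, hh]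
    · simp
  · simp

lemma res_apply (u l : Fin m → ι) (j : (Fin m × ι) →₀ ℕ) (p : Fin m × ι) (h1 : p.2 ≠ u p.1) (h2 : p.2 ≠ l p.1) :
    res u l j p = j p := by
  simp only [res, rr, Finsupp.coe_finsetSum, Finset.sum_apply, Finsupp.smul_apply]
  rw [Finset.sum_eq_single p]
  · simp [h1, h2]
  · intro p' _ hne
    split_ifs with hc
    · simp
    · simp [Finsupp.single_apply, hne]
  · simp

lemma resuu_inj (u l : Fin m → ι) (hul : ∀ h, l h ≠ u h) {d : Fin m → ℕ} {j j' : (Fin m × ι) →₀ ℕ}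
    (hj : ∀ h, ∑ i, j (h, i) = d h) (hj' : ∀ h, ∑ i, j' (h, i) = d h)
    (h1 : res u l j = res u l j') (h2 : uu u j = uu u j') : j = j' := by
  have key : ∀ h i, i ≠ l h → j (h, i) = j' (h, i) := by
    intro h i hi
    by_cases hu : i = u h
    · subst hu; rw [← uu_apply, ← uu_apply, h2]
    · have e1 := res_apply u l j (h, i) hu hi
      have e2 := res_apply u l j' (h, i) hu hi
      rw [← e1, ← e2, h1]
  ext ⟨h, i⟩
  by_cases hi : i = l h
  · subst hi
    have e := (hj h).trans (hj' h).symm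
    rw [← Finset.add_sum_erase _ _ (Finset.mem_univ (l h)), ← Finset.add_sum_erase _ _ (Finset.mem_univ (l h))] at e
    rw [Finset.sum_congr rfl (fun i hi => key h i (Finset.ne_of_mem_erase hi))] at e
    omega
  · exact key h i hi

noncomputable def P1 (u l : Fin m → ι) (P : MvPolynomial (Fin m × ι) ℤ) : MvPolynomial (Fin m × ι) (MvPolynomial (Fin m) ℤ) :=
  ∑ j ∈ P.support, monomial (res u l j) (monomial (uu u j) (coeff j P))

lemma coeff_P1 (u l : Fin m → ι) (P : MvPolynomial (Fin m × ι) ℤ) (μ) : coeff μ (P1 u l P) =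
    ∑ j ∈ P.support, if res u l j = μ then monomial (uu u j) (coeff j P) else 0 := by
  simp only [P1, coeff_sum, coeff_monomial]

lemma P1_ne {u l : Fin m → ι} (hul : ∀ h, l h ≠ u h) {d : Fin m → ℕ} {P : MvPolynomial (Fin m × ι) ℤ} (hP : BH d P)
    (h0 : P ≠ 0) : P1 u l P ≠ 0 := by
  classical
  obtain ⟨j0, hj0⟩ := support_nonempty.2 h0
  intro h
  have h1 : coeff (uu u j0) (coeff (res u l j0) (P1 u l P)) = 0 := by rw [h]; simp
  rw [coeff_P1, coeff_sum, Finset.sum_eq_single j0] at h1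
  · simp at h1
    exact (mem_support_iff.1 hj0) h1
  · intro j hj hne
    split_ifs with hc
    · rw [coeff_monomial, if_neg]
      intro h2
      exact hne (resuu_inj u l hul (hP j hj) (hP j0 hj0) hc h2)
    · simp
  · intro h; exact absurd hj0 h

lemma P1_wn (u l : Fin m → ι) (P : MvPolynomial (Fin m × ι) ℤ) (μ) : wn 1 (coeff μ (P1 u l P)) ≤ wn 1 P := by
  rw [coeff_P1]
  refine (wn_sum_le (by simp) _ _).trans ?_
  unfold wn
  refine Finset.sum_le_sum fun j hj => ?_
  have := wn_monomial (1 : Fin m → ℝ) (uu u j) (coeff j P)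
  split_ifs
  · change wn 1 _ ≤ _
    rw [this]; simp
  · change wn 1 _ ≤ _
    rw [wn_zero]; simp

lemma P1_deg {u l : Fin m → ι} {d : Fin m → ℕ} {P : MvPolynomial (Fin m × ι) ℤ} (hP : BH d P) (μ) (h : Fin m) :
    degreeOf h (coeff μ (P1 u l P)) ≤ d h := by
  classical
  rw [coeff_P1]
  refine (degreeOf_sum_le _ _ _).trans ?_
  refine Finset.sup_le fun j hj => ?_
  split_ifs
  · rw [degreeOf_monomial_eq _ _ (mem_support_iff.1 hj), uu_apply, ← hP j hj h]
    exact Finset.single_le_sum (f := fun i => j (h, i)) (fun _ _ => Nat.zero_le _) (Finset.mem_univ (u h))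
  · simp

/-- An eval hom applied to `P1` . -/
lemma eval_P1 {T : Type*} [CommRing T] (u l : Fin m → ι) (P : MvPolynomial (Fin m × ι) ℤ) (x : Fin m × ι → T) (z : Fin m → T)
    (y : Fin m × ι → T) (hu : ∀ h, x (h, u h) = z h) (hul : ∀ h, l h ≠ u h) (hl : ∀ h, x (h, l h) = 1)
    (hy : ∀ p : Fin m × ι, p.2 ≠ u p.1 → p.2 ≠ l p.1 → x p = y p) :
    eval₂Hom (Int.castRingHom T) x P = eval₂Hom (eval₂Hom (Int.castRingHom T) z) y (P1 u l P) := by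
  classical
  have hx : ∀ p, x p = (∏ q, y q ^ (rr u l p q)) * ∏ h, z h ^ (ss u p h) := by
    rintro ⟨h, i⟩
    by_cases h1 : i = u h
    · subst h1
      simp [rr, ss, hu, Finsupp.single_apply]
    · by_cases h2 : i = l h
      · subst h2
        simp [rr, ss, h1, hl]
      · simp [rr, ss, h1, h2, Finsupp.single_apply, hy (h, i) h1 h2]
  conv_lhs => rw [P.as_sum]
  rw [P1, map_sum, map_sum]
  refine Finset.sum_congr rfl fun j _ => ?_
  simp only [coe_eval₂Hom, eval₂_monomial]
  rw [mul_assoc]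
  congr 1
  rw [Finsupp.prod_fintype _ _ (by simp), Finsupp.prod_fintype _ _ (by simp), Finsupp.prod_fintype _ _ (by simp)]
  simp only [hx, mul_pow, Finset.prod_mul_distrib, ← Finset.prod_pow, ← pow_mul]
  rw [mul_comm]
  congr 1
  · rw [Finset.prod_comm]
    refine Finset.prod_congr rfl fun h _ => ?_
    rw [Finset.prod_pow_eq_pow_sum]
    congr 1
    simp [uu, mul_comm]
  · rw [Finset.prod_comm]
    refine Finset.prod_congr rfl fun h _ => ?_
    rw [Finset.prod_pow_eq_pow_sum]
    congr 1
    simp [res, mul_comm]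

/-- The values of the coordinates. -/
noncomputable def xv (τ : ι) (A : Fin m → Matrix ι ι ℤ) (u l : Fin m → ι) (p : Fin m × ι) :
    MvPolynomial (Fin m × ι) (MvPolynomial (Fin m) ℚ) :=
  if p.2 = u p.1 then C (X p.1 + C (-((A p.1 τ (l p.1) : ℚ) / A p.1 τ (u p.1)))) -
      ∑ I ∈ Finset.univ.filter (fun I => I ≠ u p.1 ∧ I ≠ l p.1), C (C ((A p.1 τ I : ℚ) / A p.1 τ (u p.1))) * X (p.1, I)
    else if p.2 = l p.1 then 1 else X p

lemma xv_pair (τ : ι) (A : Fin m → Matrix ι ι ℤ) (u l : Fin m → ι) (hul : ∀ h, l h ≠ u h) (hau : ∀ h, A h τ (u h) ≠ 0) (h : Fin m) :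
    ∑ i, (A h τ i : MvPolynomial (Fin m × ι) (MvPolynomial (Fin m) ℚ)) * xv τ A u l (h, i) = (A h τ (u h) : MvPolynomial (Fin m × ι) (MvPolynomial (Fin m) ℚ)) * C (X h) := by
  classical
  have key : ∀ I, (A h τ (u h) : MvPolynomial (Fin m × ι) (MvPolynomial (Fin m) ℚ)) * C (C ((A h τ I : ℚ) / A h τ (u h))) = (A h τ I : MvPolynomial (Fin m × ι) (MvPolynomial (Fin m) ℚ)) := by
    intro I
    have : (A h τ (u h) : MvPolynomial (Fin m × ι) (MvPolynomial (Fin m) ℚ)) = C (C (A h τ (u h) : ℚ)) := by simp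
    rw [this, ← C_mul, ← C_mul, mul_div_cancel₀ _ (by exact_mod_cast hau h)]; simp
  have h1 : (Finset.univ : Finset ι) = insert (u h) (insert (l h) (Finset.univ.filter (fun I => I ≠ u h ∧ I ≠ l h))) := by
    ext I; simp; tauto
  have h2 : ∀ I ∈ Finset.univ.filter (fun I => I ≠ u h ∧ I ≠ l h), 
      (A h τ I : MvPolynomial (Fin m × ι) (MvPolynomial (Fin m) ℚ)) * xv τ A u l (h, I) =
      (A h τ (u h) : MvPolynomial (Fin m × ι) (MvPolynomial (Fin m) ℚ)) * (C (C ((A h τ I : ℚ) / A h τ (u h))) * X (h, I)) := by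
    intro I hI
    simp at hI
    rw [← mul_assoc, key]
    simp [xv, hI]
  rw [h1, Finset.sum_insert (by simp [Ne.symm (hul h)]), Finset.sum_insert (by simp), Finset.sum_congr rfl h2, ← Finset.mul_sum]
  have h3 : xv τ A u l (h, l h) = 1 := by simp [xv, hul h]
  rw [h3]
  have h4 : xv τ A u l (h, u h) = C (X h) - C (C ((A h τ (l h) : ℚ) / A h τ (u h))) -
      ∑ I ∈ Finset.univ.filter (fun I => I ≠ u h ∧ I ≠ l h), C (C ((A h τ I : ℚ) / A h τ (u h))) * X (h, I) := by
    simp [xv]; ring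
  rw [h4, mul_sub, mul_sub, key]
  ring

lemma bsum_aux {T : Type*} [CommRing T] (b a : ι → ι → ℤ)
    (hBA : ∀ i I, ∑ J, b i J * a J I = if i = I then 1 else 0) (y : ι → T) (i : ι) :
    ∑ J, (b i J : T) * (∑ I, (a J I : T) * y I) = y i := by
  simp only [Finset.mul_sum]
  rw [Finset.sum_comm]
  have : ∀ I, ∑ J, (b i J : T) * ((a J I : T) * y I) = (if i = I then 1 else 0) * y I := by
    intro I
    simp only [← mul_assoc, ← Finset.sum_mul]
    congr 1
    have := congrArg (Int.castRingHom T) (hBA i I)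
    simp only [map_sum, map_mul, eq_intCast] at this
    rw [this]; split_ifs <;> simp
  rw [Finset.sum_congr rfl fun I _ => this I]
  simp

theorem descend (τ : ι) (A B : Fin m → Matrix ι ι ℤ) (hAB : ∀ h, A h * B h = 1) (u l : Fin m → ι)
    (hul : ∀ h, l h ≠ u h) (hau : ∀ h, A h τ (u h) ≠ 0) (d : Fin m → ℕ) (P : MvPolynomial (Fin m × ι) ℤ)
    (hP0 : P ≠ 0) (hBH : BH d P) (θ : ℝ)
    (hR : ∀ j ∈ (bsub (RingHom.id ℤ) (Bp τ B u) P).support, θ ≤ ∑ h, (1 / (d h : ℝ)) * j (h, τ)) :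
    ∃ F : MvPolynomial (Fin m) ℤ, F ≠ 0 ∧ (∀ i, degreeOf i F ≤ d i) ∧ wn 1 F ≤ wn 1 P ∧
      WGe (fun i => 1 / (d i : ℝ)) θ (tr (fun h => -((A h τ (l h) : ℚ) / (A h τ (u h)))) (map (Int.castRingHom ℚ) F)) := by
  classical
  let T := MvPolynomial (Fin m × ι) (MvPolynomial (Fin m) ℚ)
  let t : Fin m × ι → T := fun p => if p.2 = τ then C (X p.1) else
    ∑ I, (A p.1 p.2 I : T) * (xv τ A u l (p.1, I) - if I = u p.1 then C (X p.1) else 0)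
  let Θ : MvPolynomial (Fin m × ι) ℤ →+* T := eval₂Hom (Int.castRingHom T) t
  have hw : ∀ i, 0 ≤ (fun i => 1 / (d i : ℝ)) i := fun i => by positivity
  have hfil : WFil (fun i => 1 / (d i : ℝ)) θ (Θ (bsub (RingHom.id ℤ) (Bp τ B u) P)) := by
    refine WFil.hom hw Θ (fun p => if p.2 = τ then 1 / (d p.1 : ℝ) else 0) ?_ ?_
    · intro p
      simp only [Θ, eval₂Hom_X', t]
      split_ifs with hp
      · intro μ j hj
        rw [coeff_C] at hj
        split_ifs at hj
        · rw [mem_support_iff, coeff_X] at hj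
          have : Finsupp.single p.1 1 = j := by
            by_contra hh; rw [if_neg hh] at hj; exact hj rfl
          subst this
          simp [wt, Finsupp.single_apply]
        · simp at hj
      · exact WFil.of_nonneg hw _
    · intro j hj
      refine (hR j hj).trans (le_of_eq ?_)
      rw [Fintype.sum_prod_type]
      refine Finset.sum_congr rfl fun h _ => ?_
      simp
  have hx : Θ (bsub (RingHom.id ℤ) (Bp τ B u) P) = eval₂Hom (Int.castRingHom T) (xv τ A u l) P := by
    have : Θ.comp (bsub (RingHom.id ℤ) (Bp τ B u)) = eval₂Hom (Int.castRingHom T) (xv τ A u l) := by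
      apply MvPolynomial.ringHom_ext
      · intro r; simp
      · rintro ⟨h, i⟩
        simp only [RingHom.comp_apply, bsub_X, map_sum, map_mul, Θ, eval₂Hom_X', eval₂Hom_C]
        have hBA : ∀ i I, ∑ J, B h i J * A h J I = if i = I then 1 else 0 := by
          intro i I
          have := mul_eq_one_comm.1 (hAB h)
          have := congrFun (congrFun this i) I
          rwa [Matrix.mul_apply, Matrix.one_apply] at this
        let y : ι → T := fun I => xv τ A u l (h, I) - if I = u h then C (X h) else 0
        have hy : ∑ I, (A h τ I : T) * y I = 0 := by
          simp only [y, mul_sub, Finset.sum_sub_distrib]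
          rw [xv_pair τ A u l hul hau h]; simp
        have e1 : ∀ J, (Int.castRingHom T) (Bp τ B u h i J) * t (h, J) =
            (B h i J : T) * (∑ I, (A h J I : T) * y I) + if J = τ then (if i = u h then C (X h) else 0) else 0 := by
          intro J
          by_cases hJ : J = τ
          · subst hJ
            rw [hy]
            simp [Bp, t]
          · simp [Bp, t, hJ, y]
        rw [Finset.sum_congr rfl fun J _ => e1 J, Finset.sum_add_distrib]
        have e2 : ∑ J, (B h i J : T) * (∑ I, (A h J I : T) * y I) = y i := by
          exact bsum_aux (B h) (A h) hBA y i
        rw [e2]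
        simp [y]
    rw [← this]; rfl
  rw [hx, eval_P1 u l P (xv τ A u l) (fun h => xv τ A u l (h, u h)) X (fun h => rfl) hul
    (fun h => by simp [xv, hul h]) (fun p h1 h2 => by simp [xv, h1, h2])] at hfil
  obtain ⟨μ0, hμ0⟩ := Finset.exists_minimal (support_nonempty.2 (P1_ne hul hBH hP0))
  refine ⟨coeff μ0 (P1 u l P), mem_support_iff.1 hμ0.1, P1_deg hBH μ0, P1_wn u l P μ0, ?_⟩
  have h1 := hfil μ0
  let g : MvPolynomial (Fin m) ℤ →+* T := eval₂Hom (Int.castRingHom T) (fun h => xv τ A u l (h, u h))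
  have h2 : coeff μ0 (eval₂Hom g X (P1 u l P)) = constantCoeff (g (coeff μ0 (P1 u l P))) := by
    conv_lhs => rw [(P1 u l P).as_sum]
    rw [map_sum, coeff_sum, Finset.sum_eq_single μ0]
    · simp only [coe_eval₂Hom, eval₂_monomial]
      have : (μ0.prod fun n e => (X n : T) ^ e) = monomial μ0 1 := by rw [monomial_eq]; simp
      rw [this, coeff_mul_monomial', if_pos le_rfl]
      simp [constantCoeff_eq]
    · intro μ hμ hne
      simp only [coe_eval₂Hom, eval₂_monomial]
      have : (μ.prod fun n e => (X n : T) ^ e) = monomial μ 1 := by rw [monomial_eq]; simp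
      rw [this, coeff_mul_monomial', if_neg]
      intro hle
      exact hne (le_antisymm hle (hμ0.2 hμ hle))
    · intro h; exact absurd hμ0.1 h
  have h3 : ∀ F : MvPolynomial (Fin m) ℤ, constantCoeff (g F) =
      tr (fun h => -((A h τ (l h) : ℚ) / (A h τ (u h)))) (map (Int.castRingHom ℚ) F) := by
    intro F
    have : constantCoeff.comp g = (tr (fun h => -((A h τ (l h) : ℚ) / (A h τ (u h))))).toRingHom.comp (map (Int.castRingHom ℚ)) := by
      apply MvPolynomial.ringHom_ext
      · intro r; simp
      · intro h
        simp [g, xv, tr]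
    exact congrArg (fun f => f F) this
  rw [← h3, ← h2]
  exact h1
end desc
end Sst


namespace Sst
open MvPolynomial
set_option linter.unusedSectionVars false
set_option linter.unusedSimpArgs false
set_option linter.unusedVariables false

/-- A normed order in a real number field. -/
structure Mdl (O : Type*) [SeminormedCommRing O] where
  k : ℕ
  ψ : O →+ (Fin k → ℤ)
  inj : Function.Injective ψ
  bd : ∀ x i, |(ψ x i : ℝ)| ≤ ‖x‖
  φ : O →+* ℝ
  hφ : ∀ x, |φ x| ≤ ‖x‖
  liou : ∃ C : ℝ, ∃ D : ℕ, 0 < C ∧ ∀ x, x ≠ 0 → 1 ≤ C * ‖x‖ ^ D * |φ x|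

section core
variable {m : ℕ} {ι : Type*} [Fintype ι] [DecidableEq ι]

lemma bsub_comp {R S U : Type*} [CommRing R] [CommRing S] [CommRing U] (g : R →+* S) (g' : S →+* U)
    (E : Fin m → Matrix ι ι S) (E' : Fin m → Matrix ι ι U) (f : MvPolynomial (Fin m × ι) R) :
    bsub g' E' (bsub g E f) = bsub (g'.comp g) (fun h => (E h).map g' * E' h) f := by
  have : (bsub g' E').comp (bsub g E) = bsub (g'.comp g) (fun h => (E h).map g' * E' h) := by
    apply MvPolynomial.ringHom_ext
    · intro r; simp
    · rintro ⟨h, i⟩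
      simp only [RingHom.comp_apply, bsub_X, map_sum, map_mul, bsub_C, Matrix.mul_apply, Matrix.map_apply,
        Finset.sum_mul, Finset.mul_sum]
      rw [Finset.sum_comm]
      refine Finset.sum_congr rfl fun _ _ => Finset.sum_congr rfl fun _ _ => by ring
  rw [← this]; rfl

lemma map_bsub {R S U : Type*} [CommRing R] [CommRing S] [CommRing U] (g : R →+* S) (g' : S →+* U)
    (E : Fin m → Matrix ι ι S) (f : MvPolynomial (Fin m × ι) R) :
    map g' (bsub g E f) = bsub (g'.comp g) (fun h => (E h).map g') f := by
  have : (MvPolynomial.map g').comp (bsub g E) = bsub (g'.comp g) (fun h => (E h).map g') := by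
    apply MvPolynomial.ringHom_ext
    · intro r; simp
    · rintro ⟨h, i⟩
      simp [map_sum]
  rw [← this]; rfl

lemma adj_cancel {O : Type*} [CommRing O] (φ : O →+* ℝ) (L : Matrix ι ι O) (hdet : φ L.det ≠ 0) (B : Matrix ι ι ℝ) :
    L.adjugate.map φ * ((φ L.det)⁻¹ • (L.map φ * B)) = B := by
  have h1 : L.adjugate.map φ * L.map φ = φ L.det • 1 := by
    have := congrArg (fun M : Matrix ι ι O => M.map φ) (Matrix.adjugate_mul L)
    simp only [Matrix.map_mul] at this
    rw [this]
    ext i j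
    by_cases hij : i = j <;> simp [Matrix.one_apply, hij]
  rw [Matrix.mul_smul, ← Matrix.mul_assoc, h1, Matrix.smul_mul, Matrix.one_mul, smul_smul, inv_mul_cancel₀ hdet, one_smul]

theorem vanish {O : Type*} [SeminormedCommRing O] [NormOneClass O] (Md : Mdl O) (L : Matrix ι ι O)
    (hdet : Md.φ L.det ≠ 0) (c : ι → ℝ) (Cc : ℝ) (hCc : ∀ i, |c i| ≤ Cc) (τ : ι) (B : Fin m → Matrix ι ι ℤ)
    (u : Fin m → ι) (q : Fin m → ℝ) (hq : ∀ h, 0 ≤ q h)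
    (hB : ∀ h I J, J ≠ τ → |((L.map Md.φ) * (B h).map (Int.castRingHom ℝ)) I J| ≤ Real.exp (q h * c I))
    (d : Fin m → ℕ) (hd : ∀ h, 1 ≤ d h) (E1 η : ℝ) (hη : 0 ≤ η) (hE1 : 0 ≤ E1) (hE : ∀ h, E1 ≤ d h * q h) (hE' : ∀ h, d h * q h ≤ (1 + η) * E1)
    (P : MvPolynomial (Fin m × ι) ℤ) (hBH : BH d P) (C3 s : ℝ)
    (hΦ : wn 1 (bsub (Int.castRingHom O) (fun _ => L.adjugate) P) ≤ Real.exp (C3 * ∑ h, (d h : ℝ)))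
    (hs : ∀ j ∈ (bsub (Int.castRingHom O) (fun _ => L.adjugate) P).support,
        ∑ h, (∑ i, c i * (j (h, i) : ℝ)) / d h ≤ - s)
    (C2 : ℝ) (hC21 : 1 ≤ C2) (hC2 : |(Md.φ L.det)⁻¹| * (Fintype.card ι + ∑ I, ∑ J, |Md.φ (L I J)|) ≤ C2)
    (θ : ℝ) (hθ : 0 ≤ θ)
    (hnum : (C3 + Real.log C2) * ∑ h, (d h : ℝ) + E1 * (- s + η * m * Cc + (1 + η) * Cc * θ) < 0) :
    ∀ j ∈ (bsub (RingHom.id ℤ) (Bp τ B u) P).support, θ ≤ ∑ h, (1 / (d h : ℝ)) * j (h, τ) := by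
  classical
  set ΦP := bsub (Int.castRingHom O) (fun _ : Fin m => L.adjugate) P with hΦP
  set R := bsub (RingHom.id ℤ) (Bp τ B u) P with hRdef
  set M : Fin m → Matrix ι ι ℝ := fun h => (Md.φ L.det)⁻¹ • (L.map Md.φ * (Bp τ B u h).map (Int.castRingHom ℝ)) with hM
  have hRe : map (Int.castRingHom ℝ) R = bsub Md.φ M ΦP := by
    rw [hRdef, hΦP, map_bsub, bsub_comp]
    congr 2
    · ext; simp
    · funext h
      rw [hM]
      exact (adj_cancel Md.φ L hdet _).symm
  have hd0 : ∀ h, (0:ℝ) < d h := fun h => by exact_mod_cast hd h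
  let ρ : Fin m × ι → ℝ := fun p => if p.2 = τ then Real.exp (- Cc * q p.1) else 1
  let ρ' : Fin m × ι → ℝ := fun p => C2 * Real.exp (q p.1 * c p.2)
  have hρ : ∀ p, 0 ≤ ρ p := by intro p; simp only [ρ]; split_ifs <;> positivity
  have hρ' : ∀ p, 0 ≤ ρ' p := by intro p; simp only [ρ']; positivity
  have hwn1 : wn ρ (bsub Md.φ M ΦP) ≤ wn ρ' ΦP := by
    refine wn_hom_le hρ _ ?_ ?_ _
    · intro r; rw [bsub_C, wn_C]; exact Md.hφ r
    · rintro ⟨h, I⟩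
      rw [bsub_X]
      refine (wn_sum_le hρ _ _).trans ?_
      have h1 : ∀ J, wn ρ (C (M h I J) * X (h, J)) ≤ |(Md.φ L.det)⁻¹| * (1 + |Md.φ (L I (u h))| * if J = τ then 1 else 0) * Real.exp (q h * c I) := by
        intro J
        refine (wn_mul_le hρ _ _).trans ?_
        rw [wn_C, wn_X, Real.norm_eq_abs]
        have hMe : |M h I J| = |(Md.φ L.det)⁻¹| * |(L.map Md.φ * (Bp τ B u h).map (Int.castRingHom ℝ)) I J| := by
          rw [hM, ← abs_mul]; rfl
        rw [hMe, mul_assoc, mul_assoc]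
        refine mul_le_mul_of_nonneg_left ?_ (abs_nonneg _)
        by_cases hJ : J = τ
        · subst hJ
          have e1 : (L.map Md.φ * (Bp J B u h).map (Int.castRingHom ℝ)) I J = Md.φ (L I (u h)) := by
            simp [Matrix.mul_apply, Bp]
          rw [e1]
          simp only [ρ, if_true, mul_one]
          have e2 : Real.exp (-Cc * q h) ≤ Real.exp (q h * c I) := by
            apply Real.exp_le_exp.2
            nlinarith [(abs_le.1 (hCc I)).1, hq h]
          have e3 := Real.exp_pos (q h * c I)
          nlinarith [abs_nonneg (Md.φ (L I (u h))), Real.exp_pos (-Cc * q h)]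
        · have e1 : (L.map Md.φ * (Bp τ B u h).map (Int.castRingHom ℝ)) I J =
              (L.map Md.φ * (B h).map (Int.castRingHom ℝ)) I J := by
            simp [Matrix.mul_apply, Bp, hJ]
          rw [e1]
          simp only [ρ, hJ, if_false, mul_zero, mul_one, add_zero, one_mul]
          exact hB h I J hJ
      refine (Finset.sum_le_sum fun J _ => h1 J).trans ?_
      rw [← Finset.sum_mul, ← Finset.mul_sum, Finset.sum_add_distrib]
      refine mul_le_mul_of_nonneg_right (le_trans ?_ hC2) (Real.exp_pos _).le
      refine mul_le_mul_of_nonneg_left ?_ (abs_nonneg _)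
      simp
      refine (Finset.single_le_sum (f := fun J => |Md.φ (L I J)|) (fun _ _ => abs_nonneg _) (Finset.mem_univ (u h))).trans ?_
      exact Finset.single_le_sum (f := fun I => ∑ J, |Md.φ (L I J)|) (fun _ _ => Finset.sum_nonneg fun _ _ => abs_nonneg _) (Finset.mem_univ I)
  have hBHΦ : BH d ΦP := bsub_BH _ _ hBH
  set D := ∑ h, (d h : ℝ) with hD
  have hwn2 : wn ρ' ΦP ≤ Real.exp (C3 * D) * Real.exp (Real.log C2 * D + E1 * (-s + η * m * Cc)) := by
    refine (wn_le_of_le_one hρ' ΦP _ ?_).trans (mul_le_mul_of_nonneg_right hΦ (Real.exp_pos _).le)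
    intro j hj
    have e0 : ∀ h, (∑ i, (j (h, i) : ℝ)) = d h := fun h => by exact_mod_cast hBHΦ j hj h
    have e1 : ∏ v, ρ' v ^ j v = Real.exp (∑ v : Fin m × ι, (j v : ℝ) * (Real.log C2 + q v.1 * c v.2)) := by
      rw [Real.exp_sum]
      refine Finset.prod_congr rfl fun v _ => ?_
      rw [Real.exp_nat_mul, Real.exp_add, Real.exp_log (by linarith)]
    rw [e1]
    apply Real.exp_le_exp.2
    rw [Fintype.sum_prod_type]
    have e2 : ∀ h, ∑ i, (j (h, i) : ℝ) * (Real.log C2 + q h * c i) ≤ Real.log C2 * d h +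
        (E1 * ((∑ i, c i * (j (h, i) : ℝ)) / d h) + η * E1 * Cc) := by
      intro h
      have f1 : ∑ i, (j (h, i) : ℝ) * (Real.log C2 + q h * c i) = Real.log C2 * d h + (d h * q h) * ((∑ i, c i * (j (h, i) : ℝ)) / d h) := by
        have : (d h * q h) * ((∑ i, c i * (j (h, i) : ℝ)) / d h) = q h * ∑ i, c i * (j (h, i) : ℝ) := by
          field_simp [(hd0 h).ne']
        rw [this, ← e0 h, Finset.mul_sum, Finset.mul_sum, ← Finset.sum_add_distrib]
        exact Finset.sum_congr rfl fun i _ => by ring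
      rw [f1]
      have f2 : |(∑ i, c i * (j (h, i) : ℝ)) / d h| ≤ Cc := by
        rw [abs_div, abs_of_pos (hd0 h), div_le_iff₀ (hd0 h)]
        refine (Finset.abs_sum_le_sum_abs _ _).trans ?_
        rw [← e0 h, Finset.mul_sum]
        refine Finset.sum_le_sum fun i _ => ?_
        rw [abs_mul, Nat.abs_cast]
        exact mul_le_mul_of_nonneg_right (hCc i) (Nat.cast_nonneg _)
      have f3 := abs_le.1 f2
      have f4 : (d h * q h - E1) * ((∑ i, c i * (j (h, i) : ℝ)) / d h) ≤ (η * E1) * Cc := by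
        have g1 : d h * q h - E1 ≤ η * E1 := by linarith [hE' h]
        have g2 : 0 ≤ d h * q h - E1 := by linarith [hE h]
        have g3 : 0 ≤ Cc := by linarith [abs_nonneg ((∑ i, c i * (j (h, i) : ℝ)) / d h)]
        calc _ ≤ (d h * q h - E1) * Cc := mul_le_mul_of_nonneg_left f3.2 g2
          _ ≤ _ := mul_le_mul_of_nonneg_right g1 g3
      linarith
    refine (Finset.sum_le_sum fun h _ => e2 h).trans ?_
    rw [Finset.sum_add_distrib, Finset.sum_add_distrib, ← Finset.mul_sum, ← Finset.mul_sum]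
    have e3 := mul_le_mul_of_nonneg_left (hs j hj) hE1
    simp
    linarith
  intro j hj
  by_contra hlt
  push Not at hlt
  have hc1 : |((coeff j R : ℤ) : ℝ)| * ∏ v, ρ v ^ j v ≤ wn ρ (bsub Md.φ M ΦP) := by
    rw [← hRe]
    have := coeff_le_wn hρ (map (Int.castRingHom ℝ) R) j
    rw [coeff_map] at this
    simpa using this
  have hinteg : 1 ≤ |((coeff j R : ℤ) : ℝ)| := by
    have := Int.one_le_abs (mem_support_iff.1 hj)
    exact_mod_cast this
  have hprod : Real.exp (- (E1 * ((1 + η) * Cc * θ))) ≤ ∏ v, ρ v ^ j v := by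
    have e1 : ∏ v, ρ v ^ j v = Real.exp (∑ h, (j (h, τ) : ℝ) * (- Cc * q h)) := by
      rw [Fintype.prod_prod_type, Real.exp_sum]
      refine Finset.prod_congr rfl fun h _ => ?_
      rw [Finset.prod_eq_single τ]
      · simp only [ρ, if_true]; rw [Real.exp_nat_mul]
      · intro i _ hi; simp [ρ, hi]
      · simp
    rw [e1]
    apply Real.exp_le_exp.2
    have hτ : 0 ≤ Cc := (abs_nonneg _).trans (hCc τ)
    have e2 : ∀ h, Cc * ((1 + η) * E1) * ((1 / (d h : ℝ)) * j (h, τ)) ≥ (j (h, τ) : ℝ) * (Cc * q h) := by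
      intro h
      have : (j (h, τ) : ℝ) * (Cc * q h) = (Cc * (d h * q h)) * ((1 / (d h : ℝ)) * j (h, τ)) := by
        field_simp [(hd0 h).ne']
      rw [this]
      apply mul_le_mul_of_nonneg_right _ (by positivity)
      exact mul_le_mul_of_nonneg_left (hE' h) hτ
    have e3 : ∑ h, (j (h, τ) : ℝ) * (Cc * q h) ≤ Cc * ((1 + η) * E1) * θ := by
      refine (Finset.sum_le_sum fun h _ => e2 h).trans ?_
      rw [← Finset.mul_sum]
      exact mul_le_mul_of_nonneg_left hlt.le (by positivity)
    have e4 : ∑ h, (j (h, τ) : ℝ) * (- Cc * q h) = - ∑ h, (j (h, τ) : ℝ) * (Cc * q h) := by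
      rw [← Finset.sum_neg_distrib]; exact Finset.sum_congr rfl fun _ _ => by ring
    rw [e4]; linarith
  have hfin : Real.exp (- (E1 * ((1 + η) * Cc * θ))) ≤ Real.exp (C3 * D) * Real.exp (Real.log C2 * D + E1 * (-s + η * m * Cc)) := by
    calc _ ≤ ∏ v, ρ v ^ j v := hprod
      _ ≤ |((coeff j R : ℤ) : ℝ)| * ∏ v, ρ v ^ j v := le_mul_of_one_le_left ((Real.exp_pos _).le.trans hprod) hinteg
      _ ≤ _ := hc1.trans (hwn1.trans hwn2)
  rw [← Real.exp_add, Real.exp_le_exp] at hfin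
  linarith

lemma den_exists (a b : ι → ℤ) (hab : ∑ i, a i * b i = 1) (u : ι) (hu : 1 < |a u|) :
    ∃ l, l ≠ u ∧ (|a u| : ℝ) ≤ ((((a l : ℚ) / a u).den : ℕ) : ℝ) ^ (Fintype.card ι) := by
  classical
  have hu0 : a u ≠ 0 := by intro h; rw [h] at hu; simp at hu
  let D : ι → ℕ := fun l => ((a l : ℚ) / a u).den
  obtain ⟨l, -, hl⟩ := Finset.exists_max_image Finset.univ D ⟨u, Finset.mem_univ _⟩
  have hdiv : ∀ i, a u ∣ a i * D i := by
    intro i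
    refine ⟨((a i : ℚ) / a u).num, ?_⟩
    have h1 : ((a i : ℚ) / a u) * D i = ((a i : ℚ) / a u).num := Rat.mul_den_eq_num _
    have h2 : (a u : ℚ) ≠ 0 := by exact_mod_cast hu0
    have h3 : (a i : ℚ) * D i = a u * ((a i : ℚ) / a u).num := by
      rw [← h1]; field_simp
    exact_mod_cast h3
  have hdiv2 : a u ∣ ((∏ i, D i : ℕ) : ℤ) := by
    have : ((∏ i, D i : ℕ) : ℤ) = ∑ i, b i * (a i * ((∏ i, D i : ℕ) : ℤ)) := by
      calc ((∏ i, D i : ℕ) : ℤ) = (∑ i, a i * b i) * ((∏ i, D i : ℕ) : ℤ) := by rw [hab, one_mul]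
        _ = _ := by rw [Finset.sum_mul]; exact Finset.sum_congr rfl fun _ _ => by ring
    rw [this]
    refine Finset.dvd_sum fun i _ => Dvd.dvd.mul_left ?_ _
    refine (hdiv i).trans (mul_dvd_mul_left _ ?_)
    exact_mod_cast Finset.dvd_prod_of_mem D (Finset.mem_univ i)
  have hDpos : 0 < ∏ i, D i := Finset.prod_pos fun i _ => Rat.den_pos _
  have hle : |a u| ≤ ((∏ i, D i : ℕ) : ℤ) := by
    apply Int.le_of_dvd (by exact_mod_cast hDpos)
    rwa [abs_dvd]
  have hle2 : ∏ i, D i ≤ D l ^ (Fintype.card ι) := by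
    calc ∏ i, D i ≤ ∏ i : ι, D l := Finset.prod_le_prod' fun i hi => hl i hi
      _ = _ := by simp
  have hle3 : |a u| ≤ ((D l ^ (Fintype.card ι) : ℕ) : ℤ) := hle.trans (by exact_mod_cast hle2)
  refine ⟨l, ?_, ?_⟩
  · intro hlu
    have : D l = 1 := by
      simp only [D, hlu]
      rw [div_self (by exact_mod_cast hu0)]; rfl
    rw [this] at hle3
    simp at hle3
    omega
  · have : ((|a u| : ℤ) : ℝ) ≤ (((D l ^ (Fintype.card ι) : ℕ) : ℤ) : ℝ) := by exact_mod_cast hle3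
    push_cast at this
    exact this

end core
end Sst


namespace Sst
open MvPolynomial
set_option linter.unusedSectionVars false
set_option linter.unusedSimpArgs false
set_option linter.unusedVariables false

theorem core {ι : Type*} [Fintype ι] [DecidableEq ι] {O : Type*} [SeminormedCommRing O] [NormOneClass O] (Md : Mdl O) (L : Matrix ι ι O)
    (hdet : Md.φ L.det ≠ 0) (c : ι → ℝ) (hc : ∑ i, c i < 0) (κ : ℝ) (hκ : 0 < κ) (τ : ι) :
    ∃ Λ : ℝ, ∀ q, Λ ≤ q → ∀ A B : Matrix ι ι ℤ, A * B = 1 →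
      (∀ I J, J ≠ τ → |((L.map Md.φ) * B.map (Int.castRingHom ℝ)) I J| ≤ Real.exp (q * c I)) →
      ∀ u, Real.exp (κ * q) ≤ |(A τ u : ℝ)| → False := by
  classical
  by_contra hcon
  push Not at hcon
  have : Nonempty ι := ⟨τ⟩
  obtain ⟨N, hN⟩ : ∃ N : ℝ, N = (Fintype.card ι : ℝ) := ⟨_, rfl⟩
  have hN1 : 1 ≤ N := by rw [hN]; exact_mod_cast Fintype.card_pos
  obtain ⟨Cc, hCcd⟩ : ∃ Cc, Cc = ∑ i, |c i| := ⟨_, rfl⟩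
  have hCcs : |∑ i, c i| ≤ Cc := by rw [hCcd]; exact Finset.abs_sum_le_sum_abs _ _
  have hCc0 : 0 < Cc := lt_of_lt_of_le (abs_pos.2 hc.ne) hCcs
  have hCc : ∀ i, |c i| ≤ Cc := fun i => by
    rw [hCcd]; exact Finset.single_le_sum (f := fun i => |c i|) (fun _ _ => abs_nonneg _) (Finset.mem_univ i)
  obtain ⟨ν, hν⟩ : ∃ ν, ν = - (∑ i, c i) / N := ⟨_, rfl⟩
  have hν0 : 0 < ν := by rw [hν]; apply div_pos <;> linarith
  have hνC : ν ≤ Cc := by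
    rw [hν, div_le_iff₀ (by linarith)]
    have := neg_le_abs (∑ i, c i)
    nlinarith
  obtain ⟨m, hm0, C3, hC3, haux⟩ := exists_aux Md.ψ Md.inj Md.bd L.adjugate c (ν / 4) (by positivity)
  have hm1 : (1:ℝ) ≤ m := by exact_mod_cast hm0
  obtain ⟨ω, hω, hroth⟩ := roth m (m * ν / (4 * Cc)) (by positivity)
  obtain ⟨C2, hC2d⟩ : ∃ C2, C2 = max 1 (|(Md.φ L.det)⁻¹| * (Fintype.card ι + ∑ I, ∑ J, |Md.φ (L I J)|)) := ⟨_, rfl⟩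
  have hC21 : 1 ≤ C2 := by rw [hC2d]; exact le_max_left _ _
  have hlC2 := Real.log_nonneg hC21
  obtain ⟨η, hη⟩ : ∃ η, η = ν / (16 * Cc) := ⟨_, rfl⟩
  have hη0 : 0 < η := by rw [hη]; positivity
  have hη1 : η ≤ 1 / 16 := by rw [hη, div_le_iff₀ (by positivity)]; linarith
  obtain ⟨η', hη'⟩ : ∃ η', η' = min (m * ν / (8 * (C3 + Real.log C2 + 1))) (ω * κ / (N * (C3 + 1))) := ⟨_, rfl⟩
  have hη'0 : 0 < η' := by rw [hη']; apply lt_min <;> positivity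
  have hη'1 : η' * (C3 + Real.log C2) ≤ m * ν / 8 := by
    have h1 : η' ≤ m * ν / (8 * (C3 + Real.log C2 + 1)) := by rw [hη']; exact min_le_left _ _
    rw [le_div_iff₀ (by positivity)] at h1
    nlinarith
  have hη'2 : η' * (C3 + 1) ≤ ω * (κ / N) := by
    have h1 : η' ≤ ω * κ / (N * (C3 + 1)) := by rw [hη']; exact min_le_right _ _
    rw [le_div_iff₀ (by positivity)] at h1
    rw [← mul_div_assoc, le_div_iff₀ (by positivity)]
    linarith
  let Λ0 : ℝ := 2 * m / η'
  have hΛ0 : 0 < Λ0 := by positivity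
  choose f hf A B hAB hB u hu using hcon
  let y : ℕ → ℝ := fun k => Nat.rec Λ0 (fun _ y => max Λ0 (max (f y) ((2 / ω) * f y))) k
  have hy1 : ∀ k, Λ0 ≤ y k := by
    intro k; cases k with
    | zero => exact le_rfl
    | succ k => exact le_max_left _ _
  have hys1 : ∀ k, f (y k) ≤ y (k+1) := fun k => (le_max_left _ _).trans (le_max_right _ _)
  have hys2 : ∀ k, (2 / ω) * f (y k) ≤ y (k+1) := fun k => (le_max_right _ _).trans (le_max_right _ _)
  have hymono : Monotone y := monotone_nat_of_le_succ fun k => (hf (y k)).trans (hys1 k)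
  have hyy : ∀ k k', k < k' → (2 / ω) * f (y k) ≤ f (y k') := fun k k' hk =>
    (hys2 k).trans ((hymono hk).trans (hf _))
  let yy : Fin m → ℝ := fun h => y (m - h)
  let q : Fin m → ℝ := fun h => f (yy h)
  have hqΛ : ∀ h, Λ0 ≤ q h := fun h => (hy1 _).trans (hf _)
  have hq0 : ∀ h, 0 < q h := fun h => hΛ0.trans_le (hqΛ h)
  have hqq : ∀ i j : Fin m, i < j → (2 / ω) * q j ≤ q i := fun i j hij => hyy _ _ (by
    have : (i:ℕ) < j := hij
    have := j.2
    omega)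
  obtain ⟨E1, hE1⟩ : ∃ E1, E1 = (∑ h, q h) / η := ⟨_, rfl⟩
  have hE1q : ∀ h, q h ≤ η * E1 := fun h => by
    rw [hE1, mul_div_cancel₀ _ hη0.ne']
    exact Finset.single_le_sum (f := q) (fun h _ => (hq0 h).le) (Finset.mem_univ h)
  have hE10 : 0 < E1 := by
    have := (hq0 ⟨0, hm0⟩).trans_le (hE1q ⟨0, hm0⟩)
    exact pos_of_mul_pos_right this hη0.le
  let d : Fin m → ℕ := fun h => ⌈E1 / q h⌉₊
  have hdE : ∀ h, E1 ≤ d h * q h := fun h => by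
    have := Nat.le_ceil (E1 / q h)
    rwa [div_le_iff₀ (hq0 h)] at this
  have hdE' : ∀ h, d h * q h ≤ (1 + η) * E1 := fun h => by
    have := (Nat.ceil_lt_add_one (div_nonneg hE10.le (hq0 h).le)).le
    have h2 := mul_le_mul_of_nonneg_right this (hq0 h).le
    rw [add_mul, div_mul_cancel₀ _ (hq0 h).ne', one_mul] at h2
    linarith [hE1q h]
  have hd1 : ∀ h, 1 ≤ d h := fun h => Nat.ceil_pos.2 (div_pos hE10 (hq0 h))
  have hd2 : ∀ h, (d h : ℝ) * q h ≤ 2 * E1 := fun h => by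
    have := hdE' h
    nlinarith
  have hDsum : ∑ h, (d h : ℝ) ≤ η' * E1 := by
    have h1 : ∀ h, (d h : ℝ) ≤ 2 * E1 / Λ0 := fun h => by
      rw [le_div_iff₀ hΛ0]
      exact (mul_le_mul_of_nonneg_left (hqΛ h) (Nat.cast_nonneg _)).trans (hd2 h)
    calc ∑ h, (d h : ℝ) ≤ ∑ h : Fin m, 2 * E1 / Λ0 := Finset.sum_le_sum fun h _ => h1 h
      _ = η' * E1 := by
        simp [Λ0]
        field_simp
  have hD0 : 0 ≤ ∑ h, (d h : ℝ) := Finset.sum_nonneg fun _ _ => Nat.cast_nonneg _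
  obtain ⟨P, hP0, hBH, hPwn, hΦwn, hsupp⟩ := haux d hd1
  have hv := vanish Md L hdet c Cc hCc τ (fun h => B (yy h)) (fun h => u (yy h)) q (fun h => (hq0 h).le)
    (fun h => hB (yy h)) d hd1 E1 η hη0.le hE10.le hdE hdE' P hBH C3 (m * (3 / 4 * ν)) hΦwn
    (fun j hj => (hsupp j hj).trans (le_of_eq (by rw [hν, hN]; ring))) C2 hC21 (by rw [hC2d]; exact le_max_right _ _)
    (m * ν / (4 * Cc)) (by positivity) (by
      have e1 : η * m * Cc = m * ν / 16 := by rw [hη]; field_simp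
      have e2 : (1 + η) * Cc * (m * ν / (4 * Cc)) = (1 + η) * (m * ν / 4) := by field_simp
      rw [e1, e2]
      have e3 : (C3 + Real.log C2) * ∑ h, (d h : ℝ) ≤ m * ν / 8 * E1 := by
        calc _ ≤ (C3 + Real.log C2) * (η' * E1) := mul_le_mul_of_nonneg_left hDsum (by positivity)
          _ = (η' * (C3 + Real.log C2)) * E1 := by ring
          _ ≤ _ := mul_le_mul_of_nonneg_right hη'1 hE10.le
      have hmν : 0 < m * ν := by positivity
      have e4 : (1 + η) * (m * ν / 4) ≤ (17 / 16) * (m * ν / 4) := mul_le_mul_of_nonneg_right (by linarith) (by positivity)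
      have e5 : E1 * (-(m * (3 / 4 * ν)) + m * ν / 16 + (1 + η) * (m * ν / 4)) ≤ E1 * (- (m * ν / 4)) := by
        apply mul_le_mul_of_nonneg_left _ hE10.le
        linarith
      have e6 : 0 < E1 * (m * ν) := by positivity
      linarith)
  have hau1 : ∀ h, 1 < |A (yy h) τ (u (yy h))| := fun h => by
    have h1 : (1:ℝ) < |(A (yy h) τ (u (yy h)) : ℝ)| := lt_of_lt_of_le (Real.one_lt_exp_iff.2 (mul_pos hκ (hq0 h))) (hu (yy h)).1
    exact_mod_cast h1
  have hl : ∀ h, ∃ l, l ≠ u (yy h) ∧ (|A (yy h) τ (u (yy h))| : ℝ) ≤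
      ((((A (yy h) τ l : ℚ) / A (yy h) τ (u (yy h))).den : ℕ) : ℝ) ^ (Fintype.card ι) := fun h =>
    den_exists (A (yy h) τ) (fun i => B (yy h) i τ) (by
      have := congrFun (congrFun (hAB (yy h)) τ) τ
      rwa [Matrix.mul_apply, Matrix.one_apply_eq] at this) (u (yy h)) (hau1 h)
  choose l hlu hlden using hl
  obtain ⟨F, hF0, hFd, hFwn, hFW⟩ := descend τ (fun h => A (yy h)) (fun h => B (yy h)) (fun h => hAB (yy h)) (fun h => u (yy h)) l hlu
    (fun h h0 => by have := hau1 h; rw [h0] at this; simp at this) d P hP0 hBH _ hv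
  refine hroth d _ (κ * E1 / N) F hd1 ?_ ?_ hF0 hFd ?_ hFW
  · intro i j hij
    have h1 := hqq i j hij
    have h2 := hd2 i
    have h3 := hdE j
    have h4 : (d i : ℝ) * ((2 / ω) * q j) ≤ 2 * (d j * q j) :=
      (mul_le_mul_of_nonneg_left h1 (Nat.cast_nonneg _)).trans (h2.trans (by linarith))
    have h5 : (2 * q j) * (d i : ℝ) ≤ (2 * q j) * (ω * d j) := by
      have := mul_le_mul_of_nonneg_left h4 hω.le
      calc _ = ω * ((d i : ℝ) * ((2 / ω) * q j)) := by field_simp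
        _ ≤ _ := this
        _ = _ := by ring
    exact le_of_mul_le_mul_left h5 (by linarith [hq0 j])
  · intro h
    rw [Rat.neg_den]
    obtain ⟨D, hD⟩ : ∃ D : ℕ, D = ((A (yy h) τ (l h) : ℚ) / A (yy h) τ (u (yy h))).den := ⟨_, rfl⟩
    have h1 := hlden h
    rw [← hD] at h1
    rw [← hD]
    have hDpos : (0:ℝ) < D := by rw [hD]; exact_mod_cast Rat.den_pos _
    have h2 : Real.exp (κ * q h) ≤ (D:ℝ) ^ (Fintype.card ι) := (hu (yy h)).1.trans h1
    have h3 := Real.log_le_log (Real.exp_pos _) h2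
    rw [Real.log_exp, Real.log_pow, ← hN] at h3
    rw [div_le_iff₀ (by linarith)]
    calc κ * E1 ≤ κ * (d h * q h) := mul_le_mul_of_nonneg_left (hdE h) hκ.le
      _ = d h * (κ * q h) := by ring
      _ ≤ d h * (N * Real.log D) := mul_le_mul_of_nonneg_left h3 (Nat.cast_nonneg _)
      _ = _ := by ring
  · have h1 : Real.log (wn 1 F) ≤ C3 * ∑ h, (d h : ℝ) := by
      rw [Real.log_le_iff_le_exp (lt_of_lt_of_le one_pos (one_le_wn F hF0))]
      exact hFwn.trans hPwn
    calc _ ≤ (C3 + 1) * ∑ h, (d h : ℝ) := by linarith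
      _ ≤ (C3 + 1) * (η' * E1) := mul_le_mul_of_nonneg_left hDsum (by linarith)
      _ = η' * (C3 + 1) * E1 := by ring
      _ ≤ ω * (κ / N) * E1 := mul_le_mul_of_nonneg_right hη'2 hE10.le
      _ = _ := by ring

end Sst


namespace Sst
open MvPolynomial Filter Topology
set_option linter.unusedSectionVars false
set_option linter.unusedSimpArgs false
set_option linter.unusedVariables false

section pen
variable {ι : Type*} [Fintype ι] [DecidableEq ι]

lemma adj_bound (M : Matrix ι ι ℝ) (τ : ι) (q : ℝ) (c : ι → ℝ)
    (hM : ∀ I J, J ≠ τ → |M I J| ≤ Real.exp (q * c I)) (I : ι) :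
    |M.adjugate τ I| ≤ (Fintype.card ι).factorial * Real.exp (q * (∑ i, c i - c I)) := by
  rw [Matrix.adjugate_apply, Matrix.det_apply]
  refine (Finset.abs_sum_le_sum_abs _ _).trans ?_
  have key : ∀ σ : Equiv.Perm ι, |Equiv.Perm.sign σ • ∏ i, M.updateRow I (Pi.single τ 1) (σ i) i| ≤ Real.exp (q * (∑ i, c i - c I)) := by
    intro σ
    have h0 : |Equiv.Perm.sign σ • ∏ i, M.updateRow I (Pi.single τ 1) (σ i) i| = |∏ i, M.updateRow I (Pi.single τ 1) (σ i) i| := by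
      rcases Int.units_eq_one_or (Equiv.Perm.sign σ) with h | h <;> simp [h]
    rw [h0]
    by_cases hσ : σ τ = I
    · rw [← Finset.mul_prod_erase _ _ (Finset.mem_univ τ)]
      have h1 : M.updateRow I (Pi.single τ 1) (σ τ) τ = 1 := by rw [hσ]; simp
      rw [h1, one_mul, Finset.abs_prod]
      have h2 : q * (∑ i, c i - c I) = ∑ i ∈ Finset.univ.erase τ, q * c (σ i) := by
        rw [← Equiv.sum_comp σ c, ← Finset.add_sum_erase _ _ (Finset.mem_univ τ), hσ, ← Finset.mul_sum]
        ring
      rw [h2, Real.exp_sum]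
      refine Finset.prod_le_prod (fun _ _ => abs_nonneg _) fun i hi => ?_
      have hi' := Finset.ne_of_mem_erase hi
      have : σ i ≠ I := by rw [← hσ]; exact fun h => hi' (σ.injective h)
      rw [Matrix.updateRow_ne this]
      exact hM _ _ hi'
    · rw [Finset.prod_eq_zero (Finset.mem_univ (σ.symm I))]
      · simp; positivity
      · rw [Equiv.apply_symm_apply, Matrix.updateRow_self]
        rw [Pi.single_eq_of_ne]
        intro h; apply hσ; rw [← h]; simp
  refine (Finset.sum_le_sum fun σ _ => key σ).trans ?_
  simp [Fintype.card_perm]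

lemma exp_small {X Y : ℝ} (hY : 0 < Y) : ∃ Λ : ℝ, ∀ q, Λ ≤ q → X * Real.exp (- (Y * q)) < 1 := by
  have h1 : Tendsto (fun q : ℝ => X * Real.exp (- (Y * q))) atTop (𝓝 (X * 0)) := by
    apply Tendsto.const_mul
    apply Real.tendsto_exp_neg_atTop_nhds_zero.comp
    exact tendsto_id.const_mul_atTop hY
  rw [mul_zero] at h1
  obtain ⟨Λ, hΛ⟩ := (h1.eventually_lt_const one_pos).exists_forall_of_atTop
  exact ⟨Λ, hΛ⟩

theorem pen_fixed {O : Type*} [SeminormedCommRing O] [NormOneClass O] (Md : Mdl O) (L : Matrix ι ι O)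
    (hdet : Md.φ L.det ≠ 0) (c : ι → ℝ) (δ : ℝ) (hδ : 0 < δ) (hc : ∑ i, c i ≤ - δ) (τ : ι)
    (q : ℕ → ℝ) (hq : Tendsto q atTop atTop) (A B : ℕ → Matrix ι ι ℤ) (hAB : ∀ h, A h * B h = 1)
    (hB : ∀ᶠ h in atTop, ∀ I J, J ≠ τ → |((L.map Md.φ) * (B h).map (Int.castRingHom ℝ)) I J| ≤ Real.exp (q h * c I)) :
    ∃ a : ι → ℤ, ∀ᶠ h in atTop, A h τ = a ∨ A h τ = - a := by
  classical
  obtain ⟨C, D, hC, hliou⟩ := Md.liou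
  obtain ⟨κ, hκd⟩ : ∃ κ, κ = δ / (4 * (D + 1)) := ⟨_, rfl⟩
  have hκ : 0 < κ := by rw [hκd]; positivity
  have hκD : D * κ ≤ δ / 4 := by
    have : κ * (4 * (D + 1)) = δ := by rw [hκd]; field_simp
    nlinarith
  obtain ⟨Λ, hΛ⟩ := core Md L hdet c (by linarith) κ hκ τ
  obtain ⟨K, hK⟩ : ∃ K, K = ∑ I, ∑ u, ‖L.adjugate u I‖ := ⟨_, rfl⟩
  have hK0 : 0 ≤ K := by rw [hK]; exact Finset.sum_nonneg fun _ _ => Finset.sum_nonneg fun _ _ => norm_nonneg _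
  let Y : ℕ → Matrix ι ι O := fun h => (A h).map (Int.castRingHom O) * L.adjugate
  obtain ⟨Λ2, hΛ2⟩ := exp_small (X := C * K ^ D * (Fintype.card ι).factorial) (Y := δ / 4) (by positivity)
  have hYz : ∀ᶠ h in atTop, ∀ I, - (δ / 2) < c I → Y h τ I = 0 := by
    filter_upwards [hB, hq.eventually_ge_atTop Λ, hq.eventually_ge_atTop Λ2, hq.eventually_ge_atTop 0] with h hB hq1 hq2 hq3 I hI
    by_contra hne
    have h1 := hliou _ hne
    have ha : ∀ u, |(A h τ u : ℝ)| ≤ Real.exp (κ * q h) := fun u => by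
      by_contra hlt
      push Not at hlt
      exact hΛ (q h) hq1 (A h) (B h) (hAB h) hB u hlt.le
    have h2 : ‖Y h τ I‖ ≤ Real.exp (κ * q h) * K := by
      simp only [Y, Matrix.mul_apply, Matrix.map_apply]
      refine (norm_sum_le _ _).trans ?_
      have : ∑ u, ‖L.adjugate u I‖ ≤ K := by
        rw [hK]; exact Finset.single_le_sum (f := fun I => ∑ u, ‖L.adjugate u I‖) (fun _ _ => Finset.sum_nonneg fun _ _ => norm_nonneg _) (Finset.mem_univ I)
      refine le_trans ?_ (mul_le_mul_of_nonneg_left this (Real.exp_pos _).le)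
      rw [Finset.mul_sum]
      refine Finset.sum_le_sum fun u _ => (norm_mul_le _ _).trans (mul_le_mul_of_nonneg_right ?_ (norm_nonneg _))
      refine (norm_intCast_le_abs _).trans ?_
      rw [Int.norm_eq_abs]; exact ha u
    have h3 : |Md.φ (Y h τ I)| ≤ (Fintype.card ι).factorial * Real.exp (q h * (-δ - c I)) := by
      have e1 := adj_bound _ τ (q h) c hB I
      rw [Matrix.adjugate_mul_distrib] at e1
      have hBadj : ((B h).map (Int.castRingHom ℝ)).adjugate = (((B h).det : ℤ) : ℝ) • (A h).map (Int.castRingHom ℝ) := by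
        have f1 : (B h).adjugate = (B h).det • A h := by
          calc (B h).adjugate = (A h * B h) * (B h).adjugate := by rw [hAB, Matrix.one_mul]
            _ = _ := by rw [Matrix.mul_assoc, Matrix.mul_adjugate, Matrix.mul_smul, Matrix.mul_one]
        have f2 := RingHom.map_adjugate (Int.castRingHom ℝ) (B h)
        rw [RingHom.mapMatrix_apply, RingHom.mapMatrix_apply] at f2
        rw [← f2, f1]
        ext i j; rw [Matrix.map_apply, Matrix.smul_apply, Matrix.smul_apply, Matrix.map_apply]; simp only [smul_eq_mul, eq_intCast, Int.cast_mul]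
      have hLadj : (L.map Md.φ).adjugate = L.adjugate.map Md.φ := by
        have f2 := RingHom.map_adjugate Md.φ L
        rw [RingHom.mapMatrix_apply, RingHom.mapMatrix_apply] at f2
        exact f2.symm
      have hdetB : |(((B h).det : ℤ) : ℝ)| = 1 := by
        have f1 : (A h).det * (B h).det = 1 := by rw [← Matrix.det_mul, hAB, Matrix.det_one]
        have f2 : IsUnit (B h).det := IsUnit.of_mul_eq_one_right _ f1
        have := Int.isUnit_iff_abs_eq.1 f2
        exact_mod_cast this
      rw [hBadj, hLadj, Matrix.smul_mul, Matrix.smul_apply, smul_eq_mul, abs_mul, hdetB, one_mul] at e1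
      have e2 : Md.φ (Y h τ I) = ((A h).map (Int.castRingHom ℝ) * L.adjugate.map Md.φ) τ I := by
        simp [Y, Matrix.mul_apply]
      rw [e2]
      refine e1.trans (mul_le_mul_of_nonneg_left (Real.exp_le_exp.2 ?_) (by positivity))
      exact mul_le_mul_of_nonneg_left (by linarith) hq3
    have h4 : C * ‖Y h τ I‖ ^ D * |Md.φ (Y h τ I)| ≤ (C * K ^ D * (Fintype.card ι).factorial) * Real.exp (- (δ / 4 * q h)) := by
      calc _ ≤ C * (Real.exp (κ * q h) * K) ^ D * ((Fintype.card ι).factorial * Real.exp (q h * (-δ - c I))) := by gcongr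
        _ = (C * K ^ D * (Fintype.card ι).factorial) * Real.exp (D * (κ * q h) + q h * (-δ - c I)) := by
          rw [Real.exp_add, mul_pow, Real.exp_nat_mul]; ring
        _ ≤ _ := by
          refine mul_le_mul_of_nonneg_left (Real.exp_le_exp.2 ?_) (by positivity)
          nlinarith
    linarith [hΛ2 _ hq2]
  obtain ⟨h0, hY0⟩ := hYz.exists
  refine ⟨A h0 τ, ?_⟩
  obtain ⟨W, hW⟩ : ∃ W, W = ∑ I, |Md.φ (Y h0 τ I)| := ⟨_, rfl⟩
  obtain ⟨Λ3, hΛ3⟩ := exp_small (X := |(Md.φ L.det)⁻¹| * W) (Y := δ / 2) (by positivity)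
  filter_upwards [hB, hq.eventually_ge_atTop Λ3, hq.eventually_ge_atTop 0] with h hB hq1 hq2
  have hinteg : ∀ J, J ≠ τ → (A h0 * B h) τ J = 0 := by
    intro J hJ
    have e1 : ((A h0).map (Int.castRingHom ℝ)) * (B h).map (Int.castRingHom ℝ) =
        (A h0).map (Int.castRingHom ℝ) * (L.adjugate.map Md.φ * ((Md.φ L.det)⁻¹ • (L.map Md.φ * (B h).map (Int.castRingHom ℝ)))) := by
      rw [adj_cancel Md.φ L hdet]
    rw [← Matrix.mul_assoc, Matrix.mul_smul] at e1
    have e2 : (((A h0 * B h) τ J : ℤ) : ℝ) = (Md.φ L.det)⁻¹ * ∑ I, Md.φ (Y h0 τ I) * ((L.map Md.φ) * (B h).map (Int.castRingHom ℝ)) I J := by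
      have := congrFun (congrFun e1 τ) J
      rw [← Matrix.map_mul] at this
      rw [Matrix.smul_apply, smul_eq_mul, Matrix.mul_apply] at this
      simp only [Matrix.map_apply, eq_intCast] at this
      rw [this]
      congr 1
      refine Finset.sum_congr rfl fun I _ => ?_
      congr 1
      simp [Y, Matrix.mul_apply]
    have e3 : |∑ I, Md.φ (Y h0 τ I) * ((L.map Md.φ) * (B h).map (Int.castRingHom ℝ)) I J| ≤ W * Real.exp (- (δ / 2 * q h)) := by
      refine (Finset.abs_sum_le_sum_abs _ _).trans ?_
      rw [hW, Finset.sum_mul]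
      refine Finset.sum_le_sum fun I _ => ?_
      rw [abs_mul]
      by_cases hI : - (δ / 2) < c I
      · rw [hY0 I hI]; simp
      · push Not at hI
        refine mul_le_mul_of_nonneg_left ((hB I J hJ).trans (Real.exp_le_exp.2 ?_)) (abs_nonneg _)
        nlinarith
    have e4 : |(((A h0 * B h) τ J : ℤ) : ℝ)| < 1 := by
      rw [e2, abs_mul]
      refine lt_of_le_of_lt (mul_le_mul_of_nonneg_left e3 (abs_nonneg _)) ?_
      rw [← mul_assoc]; exact hΛ3 _ hq1
    have e5 : |(A h0 * B h) τ J| < 1 := by exact_mod_cast e4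
    exact Int.abs_lt_one_iff.1 e5
  obtain ⟨t, ht⟩ : ∃ t, t = (A h0 * B h) τ τ := ⟨_, rfl⟩
  have hBA : B h * A h = 1 := mul_eq_one_comm.1 (hAB h)
  have hta : ∀ i, A h0 τ i = t * A h τ i := by
    intro i
    have e1 : A h0 = (A h0 * B h) * A h := by rw [Matrix.mul_assoc, hBA, Matrix.mul_one]
    have e2 := congrFun (congrFun e1 τ) i
    rw [Matrix.mul_apply, Finset.sum_eq_single τ] at e2
    · rw [ht]; exact e2
    · intro J _ hJ; rw [hinteg J hJ, zero_mul]
    · simp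
  have htu : IsUnit t := by
    have e1 := congrFun (congrFun (hAB h0) τ) τ
    rw [Matrix.mul_apply, Matrix.one_apply_eq] at e1
    apply IsUnit.of_mul_eq_one (∑ i, A h τ i * B h0 i τ)
    rw [← e1, Finset.mul_sum]
    exact Finset.sum_congr rfl fun i _ => by rw [hta i]; ring
  rcases Int.isUnit_iff.1 htu with h1 | h1
  · left; funext i; rw [hta i, h1, one_mul]
  · right; funext i; simp [hta i, h1]

theorem pen {O : Type*} [SeminormedCommRing O] [NormOneClass O] (Md : Mdl O) (L : Matrix ι ι O)
    (hdet : Md.φ L.det ≠ 0) (c : ℕ → ι → ℝ) (Cc : ℝ) (hCc : ∀ h i, |c h i| ≤ Cc) (δ : ℝ) (hδ : 0 < δ) (hc : ∀ h, ∑ i, c h i ≤ - δ) (τ : ι)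
    (q : ℕ → ℝ) (hq : Tendsto q atTop atTop) (A B : ℕ → Matrix ι ι ℤ) (hAB : ∀ h, A h * B h = 1)
    (hB : ∀ h, ∀ I J, J ≠ τ → |((L.map Md.φ) * (B h).map (Int.castRingHom ℝ)) I J| ≤ Real.exp (q h * c h I)) :
    ∃ a : ι → ℤ, ∃ᶠ h in atTop, A h τ = a := by
  have : Nonempty ι := ⟨τ⟩
  have hcomp : IsCompact (Set.pi Set.univ fun _ : ι => Set.Icc (-Cc) Cc) := isCompact_univ_pi fun _ => isCompact_Icc
  obtain ⟨c0, -, s, hs, hlim⟩ := hcomp.tendsto_subseq (x := c) fun h i _ => abs_le.1 (hCc h i)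
  have hN : (0:ℝ) < Fintype.card ι := by exact_mod_cast Fintype.card_pos
  have hlim' : ∀ i, Tendsto (fun h => c (s h) i) atTop (𝓝 (c0 i)) := fun i => (tendsto_pi_nhds.1 hlim) i
  have hsum0 : ∑ i, c0 i ≤ - δ := le_of_tendsto (tendsto_finsetSum _ fun i _ => hlim' i) (Eventually.of_forall fun h => hc (s h))
  have hev : ∀ᶠ h in atTop, ∀ i, c (s h) i ≤ c0 i + δ / (2 * Fintype.card ι) := by
    rw [eventually_all]
    intro i
    exact (hlim' i).eventually_le_const (by linarith [(by positivity : 0 < δ / (2 * Fintype.card ι))])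
  have hqs := hq.comp hs.tendsto_atTop
  obtain ⟨a, ha⟩ := pen_fixed Md L hdet (fun i => c0 i + δ / (2 * Fintype.card ι)) (δ / 2) (by positivity) (by
      rw [Finset.sum_add_distrib]
      simp
      have : (Fintype.card ι : ℝ) * (δ / (2 * Fintype.card ι)) = δ / 2 := by field_simp
      linarith) τ (q ∘ s) hqs (fun h => A (s h)) (fun h => B (s h)) (fun h => hAB (s h)) (by
      filter_upwards [hev, hqs.eventually_ge_atTop 0] with h h1 h2 I J hJ
      refine (hB (s h) I J hJ).trans (Real.exp_le_exp.2 ?_)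
      exact mul_le_mul_of_nonneg_left (h1 I) h2)
  have h2 : ∃ᶠ h in atTop, A h τ = a ∨ A h τ = - a := hs.tendsto_atTop.frequently ha.frequently
  rcases frequently_or_distrib.1 h2 with h3 | h3
  · exact ⟨a, h3⟩
  · exact ⟨-a, h3⟩

end pen
end Sst


namespace Sst
open Filter Topology
set_option linter.unusedSectionVars false
set_option linter.unusedSimpArgs false
set_option linter.unusedVariables false

section cmp
variable {R S : Type*} [CommRing R] [CommRing S] {n : ℕ}

noncomputable instance fintypePC (p : ℕ) : Fintype (Set.powersetCard (Fin n) p) := Fintype.ofFinite _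

/-- increasing enumeration -/
noncomputable def em {p : ℕ} (s : Set.powersetCard (Fin n) p) : Fin p ↪o Fin n :=
  Set.powersetCard.ofFinEmbEquiv.symm s

/-- compound matrix -/
noncomputable def cmp (p : ℕ) (M : Matrix (Fin n) (Fin n) R) :
    Matrix (Set.powersetCard (Fin n) p) (Set.powersetCard (Fin n) p) R :=
  fun I J => (M.submatrix (em I) (em J)).det

lemma cmp_eq (p : ℕ) (M : Matrix (Fin n) (Fin n) R) :
    cmp p M = LinearMap.toMatrix ((Pi.basisFun R (Fin n)).exteriorPower p) ((Pi.basisFun R (Fin n)).exteriorPower p)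
      (exteriorPower.map p (Matrix.toLin' M)) := by
  classical
  ext I J
  rw [LinearMap.toMatrix_apply, exteriorPower.basis_repr_apply, exteriorPower.basis_apply,
    exteriorPower.map_apply_ιMulti_family, exteriorPower.ιMulti_family, exteriorPower.ιMultiDual_apply_ιMulti,
    cmp, ← Matrix.det_transpose]
  congr 1
  ext i j
  simp [em, Matrix.mulVec_single_one]

lemma cmp_mul (p : ℕ) (M N : Matrix (Fin n) (Fin n) R) : cmp p (M * N) = cmp p M * cmp p N := by
  classical
  rw [cmp_eq, cmp_eq, cmp_eq, Matrix.toLin'_mul, exteriorPower.map_comp, LinearMap.toMatrix_comp _ ((Pi.basisFun R (Fin n)).exteriorPower p)]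

lemma cmp_one (p : ℕ) : cmp p (1 : Matrix (Fin n) (Fin n) R) = 1 := by
  classical
  rw [cmp_eq, Matrix.toLin'_one, exteriorPower.map_id, LinearMap.toMatrix_id]

lemma cmp_map (p : ℕ) (f : R →+* S) (M : Matrix (Fin n) (Fin n) R) : cmp p (M.map f) = (cmp p M).map f := by
  ext I J
  simp only [cmp, Matrix.map_apply]
  rw [RingHom.map_det, RingHom.mapMatrix_apply, Matrix.submatrix_map]

lemma cmp_det_ne (p : ℕ) (M : Matrix (Fin n) (Fin n) ℝ) (h : M.det ≠ 0) : (cmp p M).det ≠ 0 := by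
  classical
  have h1 : M * M⁻¹ = 1 := Matrix.mul_nonsing_inv M (Ne.isUnit h)
  have h2 : cmp p M * cmp p M⁻¹ = 1 := by rw [← cmp_mul, h1, cmp_one]
  intro h0
  have := congrArg Matrix.det h2
  rw [Matrix.det_mul, h0, zero_mul, Matrix.det_one] at this
  exact zero_ne_one this

lemma em_mem {p : ℕ} (s : Set.powersetCard (Fin n) p) (i : Fin p) : em s i ∈ s.1 :=
  Finset.orderEmbOfFin_mem s.val s.prop i

lemma prod_em {p : ℕ} (s : Set.powersetCard (Fin n) p) {β : Type*} [CommMonoid β] (f : Fin n → β) : ∏ i, f (em s i) = ∏ i ∈ s.1, f i := by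
  have : Finset.univ.map (em s).toEmbedding = s.1 := by
    apply Finset.coe_injective
    rw [Finset.coe_map]
    simp [em, Set.powersetCard.ofFinEmbEquiv_symm_apply]
    exact Finset.range_orderEmbOfFin _ _
  rw [← this, Finset.prod_map]; rfl

/-- any minor with columns `g` is `0` or `±` a sorted minor -/
lemma minor_abs_le {p : ℕ} (N : Matrix (Fin p) (Fin n) ℤ) (K : ℤ) (hK0 : 0 ≤ K)
    (hK : ∀ J : Set.powersetCard (Fin n) p, |(N.submatrix id (em J)).det| ≤ K) (g : Fin p → Fin n) :
    |(N.submatrix id g).det| ≤ K := by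
  by_cases hg : Function.Injective g
  · let s : Set.powersetCard (Fin n) p := ⟨Finset.univ.map ⟨g, hg⟩, by simp [Set.powersetCard]⟩
    have hmem : ∀ i, ∃ j, em s j = g i := by
      intro i
      have : g i ∈ s := by
        rw [← Set.powersetCard.mem_coe_iff]; simp [s]
      obtain ⟨j, hj⟩ := (Set.powersetCard.mem_range_ofFinEmbEquiv_symm_iff_mem s (g i)).2 this
      exact ⟨j, hj⟩
    choose σ hσ using hmem
    have hinj : Function.Injective σ := fun i j hij => hg (by rw [← hσ i, ← hσ j, hij])
    let e : Equiv.Perm (Fin p) := Equiv.ofBijective σ (Finite.injective_iff_bijective.1 hinj)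
    have h1 : N.submatrix id g = (N.submatrix id (em s)).submatrix id e := by
      ext i j; simp [e, hσ]
    rw [h1, Matrix.det_permute', abs_mul]
    have : |((Equiv.Perm.sign e : ℤˣ) : ℤ)| = 1 := by
      rcases Int.units_eq_one_or (Equiv.Perm.sign e) with h | h <;> simp [h]
    push_cast at this ⊢
    rw [this, one_mul]
    exact hK s
  · rw [Function.Injective] at hg
    push Not at hg
    obtain ⟨i, j, hij, hne⟩ := hg
    rw [Matrix.det_zero_of_column_eq hne (by intro k; simp [hij])]
    simpa using hK0

/-- the annihilating form -/
lemma ann_form {p : ℕ} (hp : 0 < p) (N : Matrix (Fin p) (Fin n) ℤ) (K : ℤ) (hK0 : 0 ≤ K)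
    (hK : ∀ J : Set.powersetCard (Fin n) p, |(N.submatrix id (em J)).det| ≤ K)
    (J0 : Set.powersetCard (Fin n) p) (hJ0 : (N.submatrix id (em J0)).det ≠ 0) :
    ∃ ω : Fin n → ℤ, ω ≠ 0 ∧ (∀ u, |ω u| ≤ K) ∧ ∀ x : Fin n → ℤ, N.mulVec x = 0 → ∑ u, ω u * x u = 0 := by
  let i0 : Fin p := ⟨0, hp⟩
  refine ⟨fun u => (N.submatrix id (Function.update (em J0) i0 u)).det, ?_, fun u => minor_abs_le N K hK0 hK _, ?_⟩
  · intro h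
    apply hJ0
    have := congrFun h (em J0 i0)
    simpa using this
  · intro x hx
    have h1 : ∀ u, N.submatrix id (Function.update (em J0) i0 u) = (N.submatrix id (em J0)).updateCol i0 (fun i => N i u) := by
      intro u; ext i j
      by_cases h : j = i0
      · subst h; simp
      · simp [Matrix.updateCol_ne h, Function.update_of_ne h]
    have h2 : ∑ u, (N.submatrix id (Function.update (em J0) i0 u)).det * x u = ((N.submatrix id (em J0)).updateCol i0 (N.mulVec x)).det := by
      have : ∀ u, (N.submatrix id (Function.update (em J0) i0 u)).det * x u = (Matrix.cramer (N.submatrix id (em J0)) (x u • fun i => N i u)) i0 := by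
        intro u
        rw [h1, map_smul, Pi.smul_apply, smul_eq_mul, Matrix.cramer_apply, mul_comm]
      simp only [this]
      have hs : ∑ u, (x u • fun i => N i u) = N.mulVec x := by
        ext i
        simp [Matrix.mulVec, dotProduct, mul_comm]
      rw [← Matrix.cramer_apply, ← Finset.sum_apply, ← map_sum, hs]
    rw [h2, hx, ← Matrix.cramer_apply]
    simp

lemma det_abs_le {p : ℕ} (M : Matrix (Fin p) (Fin p) ℝ) (C : ℝ) (hC : 0 ≤ C) (a b : Fin p → ℝ)
    (ha : ∀ i j, |M i j| ≤ C * a i) (hb : ∀ i j, |M i j| ≤ C * b j) :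
    |M.det| ≤ p.factorial * C ^ p * ∏ i, a i ∧ |M.det| ≤ p.factorial * C ^ p * ∏ i, b i := by
  have key : ∀ X, (∀ σ : Equiv.Perm (Fin p), ∏ i, |M (σ i) i| ≤ X) → |M.det| ≤ p.factorial * X := by
    intro X hX
    rw [Matrix.det_apply]
    refine (Finset.abs_sum_le_sum_abs _ _).trans ?_
    have : ∀ σ ∈ (Finset.univ : Finset (Equiv.Perm (Fin p))), |Equiv.Perm.sign σ • ∏ i, M (σ i) i| ≤ X := by
      intro σ _
      have h0 : |Equiv.Perm.sign σ • ∏ i, M (σ i) i| = |∏ i, M (σ i) i| := by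
        rcases Int.units_eq_one_or (Equiv.Perm.sign σ) with h | h <;> simp [h]
      rw [h0, Finset.abs_prod]; exact hX σ
    refine (Finset.sum_le_sum this).trans ?_
    simp [Fintype.card_perm]
  constructor
  · rw [mul_assoc]
    refine key _ fun σ => ?_
    refine (Finset.prod_le_prod (fun _ _ => abs_nonneg _) fun i _ => ha (σ i) i).trans ?_
    rw [Finset.prod_mul_distrib, Equiv.prod_comp σ a]; simp
  · rw [mul_assoc]
    refine key _ fun σ => ?_
    refine (Finset.prod_le_prod (fun _ _ => abs_nonneg _) fun i _ => hb (σ i) i).trans ?_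
    rw [Finset.prod_mul_distrib]; simp

/-- number of `p`-sets containing `i` does not depend on `i` -/
lemma sum_sum_sets (p : ℕ) : ∃ N : ℝ, 0 ≤ N ∧ ∀ f : Fin n → ℝ, ∑ s : Set.powersetCard (Fin n) p, ∑ i ∈ s.1, f i = N * ∑ i, f i := by
  classical
  rcases Nat.eq_zero_or_pos n with rfl | hn
  · refine ⟨0, le_rfl, fun f => ?_⟩
    simp [Finset.sum_eq_zero, Finset.eq_empty_of_isEmpty]
  let i0 : Fin n := ⟨0, hn⟩
  have hcount : ∀ i, ∑ s : Set.powersetCard (Fin n) p, (if i ∈ s.1 then (1:ℝ) else 0) = ∑ s : Set.powersetCard (Fin n) p, (if i0 ∈ s.1 then (1:ℝ) else 0) := by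
    intro i
    let F : Set.powersetCard (Fin n) p → Set.powersetCard (Fin n) p := fun s => ⟨s.1.map (Equiv.swap i i0).toEmbedding, by
      have := s.2
      simp only [Set.powersetCard, Set.mem_ofPred_eq] at this ⊢
      rw [Finset.card_map, this]⟩
    have hF : Function.Involutive F := by
      intro s; apply Subtype.ext
      simp only [F]
      ext u; simp [Finset.mem_map_equiv]
    refine Fintype.sum_equiv hF.toPerm _ _ fun s => ?_
    simp only [Function.Involutive.coe_toPerm, F, Finset.mem_map_equiv]
    simp
  refine ⟨∑ s : Set.powersetCard (Fin n) p, (if i0 ∈ s.1 then (1:ℝ) else 0), Finset.sum_nonneg fun s _ => by split_ifs <;> norm_num, fun f => ?_⟩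
  have : ∀ s : Set.powersetCard (Fin n) p, ∑ i ∈ s.1, f i = ∑ i, (if i ∈ s.1 then (1:ℝ) else 0) * f i := by
    intro s
    simp [Finset.sum_ite_mem]
  simp only [this]
  rw [Finset.sum_comm, Finset.mul_sum]
  refine Finset.sum_congr rfl fun i _ => ?_
  rw [← Finset.sum_mul, hcount i]

end cmp
end Sst


namespace Sst
open Filter Topology
set_option linter.unusedSectionVars false
set_option linter.unusedSimpArgs false
set_option linter.unusedVariables false

section rb

/-- integer vector as real vector -/
def cv {n : ℕ} (x : Fin n → ℤ) : Fin n → ℝ := fun i => (x i : ℝ)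

lemma finite_ball {n : ℕ} (A : Matrix (Fin n) (Fin n) ℝ) (hA : A.det ≠ 0) (R : ℝ) :
    {x : Fin n → ℤ | ‖A.mulVec (cv x)‖ ≤ R}.Finite := by
  obtain ⟨K, hK⟩ : ∃ K : ℝ, K = ∑ i, ∑ j, |A⁻¹ i j| := ⟨_, rfl⟩
  refine (Set.finite_Icc (fun _ : Fin n => -(⌈K * R⌉)) (fun _ => ⌈K * R⌉)).subset fun x hx => ?_
  have hx' : ‖A.mulVec (cv x)‖ ≤ R := hx
  have h1 : cv x = A⁻¹.mulVec (A.mulVec (cv x)) := by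
    rw [Matrix.mulVec_mulVec, Matrix.nonsing_inv_mul _ (Ne.isUnit hA), Matrix.one_mulVec]
  have h2 : ∀ i, |(x i : ℝ)| ≤ K * R := by
    intro i
    have e1 : (x i : ℝ) = ∑ j, A⁻¹ i j * (A.mulVec (cv x)) j := by
      have := congrFun h1 i
      simpa [Matrix.mulVec, dotProduct, cv] using this
    rw [e1]
    refine (Finset.abs_sum_le_sum_abs _ _).trans ?_
    have e2 : ∑ j, |A⁻¹ i j| ≤ K := by
      rw [hK]; exact Finset.single_le_sum (f := fun i => ∑ j, |A⁻¹ i j|) (fun _ _ => Finset.sum_nonneg fun _ _ => abs_nonneg _) (Finset.mem_univ i)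
    have hR : 0 ≤ R := (norm_nonneg _).trans hx'
    refine le_trans ?_ (mul_le_mul_of_nonneg_right e2 hR)
    rw [Finset.sum_mul]
    refine Finset.sum_le_sum fun j _ => ?_
    rw [abs_mul]
    refine mul_le_mul_of_nonneg_left ?_ (abs_nonneg _)
    exact (norm_le_pi_norm (A.mulVec (cv x)) j).trans hx'
  refine ⟨fun i => ?_, fun i => ?_⟩
  · have := (abs_le.1 (h2 i)).1
    have h3 := Int.le_ceil (K * R)
    have : (-(⌈K * R⌉) : ℝ) ≤ x i := by linarith
    exact_mod_cast this
  · have := (abs_le.1 (h2 i)).2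
    have h3 := Int.le_ceil (K * R)
    have : (x i : ℝ) ≤ ⌈K * R⌉ := by linarith
    exact_mod_cast this

/-- every integer vector is a multiple of the first column of a unimodular matrix -/
lemma exists_unimodular {n : ℕ} (x : Fin (n + 1) → ℤ) (hx : x ≠ 0) :
    ∃ G G' : Matrix (Fin (n + 1)) (Fin (n + 1)) ℤ, G' * G = 1 ∧ ∃ k : ℤ, k ≠ 0 ∧ ∀ i, x i = k * G i 0 := by
  classical
  obtain ⟨m, S⟩ := Submodule.smithNormalForm (Pi.basisFun ℤ (Fin (n + 1))) (Submodule.span ℤ {x})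
  have hm : m = 1 := by
    have h1 := Module.finrank_eq_card_basis S.bN
    have h2 : Module.finrank ℤ (Submodule.span ℤ {x}) = 1 := by
      rw [← Set.finrank, Set.finrank, finrank_span_set_eq_card]
      · simp
      · exact LinearIndepOn.singleton (v := id) hx
    rw [h2] at h1; simpa using h1.symm
  subst hm
  let xs : Submodule.span ℤ {x} := ⟨x, Submodule.mem_span_singleton_self x⟩
  have h1 := S.bN.sum_repr xs
  simp only [Fin.sum_univ_one] at h1
  have h2 := congrArg Subtype.val h1
  rw [Submodule.coe_smul, S.snf] at h2
  obtain ⟨k, hk⟩ : ∃ k : ℤ, k = S.bN.repr xs 0 * S.a 0 := ⟨_, rfl⟩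
  have h3 : x = k • S.bM (S.f 0) := by rw [hk, mul_smul]; exact h2.symm
  let b := S.bM.reindex (Equiv.swap (S.f 0) 0)
  have hb0 : b 0 = S.bM (S.f 0) := by simp [b]
  refine ⟨(Pi.basisFun ℤ (Fin (n + 1))).toMatrix b, b.toMatrix (Pi.basisFun ℤ (Fin (n + 1))), ?_, k, ?_, fun i => ?_⟩
  · rw [Module.Basis.toMatrix_mul_toMatrix_flip]
  · rintro rfl; rw [zero_smul] at h3; exact hx h3
  · rw [Module.Basis.toMatrix_apply, hb0]
    have := congrFun h3 i
    simpa using this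

lemma exists_short {n : ℕ} (A : Matrix (Fin (n + 1)) (Fin (n + 1)) ℝ) (hA : A.det ≠ 0) :
    ∃ G G' : Matrix (Fin (n + 1)) (Fin (n + 1)) ℤ, G' * G = 1 ∧ ∃ r,
      (∀ i, |(A * G.map (Int.castRingHom ℝ)) i 0| ≤ |(A * G.map (Int.castRingHom ℝ)) r 0|) ∧
      (∀ x : Fin (n + 1) → ℤ, x ≠ 0 → ∃ i, |(A * G.map (Int.castRingHom ℝ)) r 0| ≤ |A.mulVec (cv x) i|) := by
  classical
  let e0 : Fin (n + 1) → ℤ := Pi.single 0 1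
  have he0 : e0 ≠ 0 := by
    intro h; have := congrFun h 0; simp [e0] at this
  have hfin : ({x : Fin (n + 1) → ℤ | ‖A.mulVec (cv x)‖ ≤ ‖A.mulVec (cv e0)‖} ∩ {x | x ≠ 0}).Finite := (finite_ball A hA _).inter_of_left _
  obtain ⟨x0, ⟨hx0, hx0'⟩, hmin⟩ := Set.exists_min_image _ (fun x => ‖A.mulVec (cv x)‖) hfin ⟨e0, le_refl ‖A.mulVec (cv e0)‖, he0⟩
  have hmin' : ∀ x : Fin (n + 1) → ℤ, x ≠ 0 → ‖A.mulVec (cv x0)‖ ≤ ‖A.mulVec (cv x)‖ := by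
    intro x hx
    by_cases h : ‖A.mulVec (cv x)‖ ≤ ‖A.mulVec (cv e0)‖
    · exact hmin x ⟨h, hx⟩
    · push Not at h
      exact le_trans hx0 h.le
  have hx0'' : x0 ≠ 0 := hx0'
  obtain ⟨G, G', hG, k, hk, hkx⟩ := exists_unimodular x0 hx0''
  have hcol : ∀ i, A.mulVec (cv x0) i = k * (A * G.map (Int.castRingHom ℝ)) i 0 := by
    intro i
    rw [Matrix.mul_apply, Finset.mul_sum]
    simp only [Matrix.mulVec, dotProduct, cv]
    refine Finset.sum_congr rfl fun j _ => ?_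
    rw [hkx j]; simp; ring
  obtain ⟨r, -, hr⟩ := Finset.exists_max_image Finset.univ (fun i => |(A * G.map (Int.castRingHom ℝ)) i 0|) Finset.univ_nonempty
  refine ⟨G, G', hG, r, fun i => hr i (Finset.mem_univ _), fun x hx => ?_⟩
  have h1 : |(A * G.map (Int.castRingHom ℝ)) r 0| ≤ ‖A.mulVec (cv x0)‖ := by
    refine le_trans ?_ (norm_le_pi_norm (A.mulVec (cv x0)) r)
    rw [hcol, Real.norm_eq_abs, abs_mul]
    have : (1:ℝ) ≤ |(k:ℝ)| := by exact_mod_cast Int.one_le_abs hk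
    nlinarith [abs_nonneg ((A * G.map (Int.castRingHom ℝ)) r 0)]
  obtain ⟨i, -, hi⟩ := Finset.exists_max_image Finset.univ (fun i => |A.mulVec (cv x) i|) Finset.univ_nonempty
  refine ⟨i, h1.trans ((hmin' x hx).trans ?_)⟩
  rw [pi_norm_le_iff_of_nonneg (abs_nonneg _)]
  intro j; exact hi j (Finset.mem_univ _)

/-- Schur complement -/
noncomputable def schur {n : ℕ} (A : Matrix (Fin (n + 1)) (Fin (n + 1)) ℝ) (r : Fin (n + 1)) : Matrix (Fin n) (Fin n) ℝ :=
  fun i j => A (r.succAbove i) j.succ - A (r.succAbove i) 0 / A r 0 * A r j.succ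

lemma schur_det {n : ℕ} (A : Matrix (Fin (n + 1)) (Fin (n + 1)) ℝ) (r : Fin (n + 1)) (hr : A r 0 ≠ 0) :
    |A.det| = |A r 0| * |(schur A r).det| := by
  let c : Fin (n + 1) → ℝ := fun i => if i = r then 0 else A i 0 / A r 0
  let A' : Matrix (Fin (n + 1)) (Fin (n + 1)) ℝ := fun i j => A i j - c i * A r j
  have h1 : A.det = A'.det := by
    apply Matrix.det_eq_of_forall_row_eq_smul_add_const c r
    · simp [c]
    · intro i j; simp [A', c]
  rw [h1, Matrix.det_succ_column_zero, Finset.sum_eq_single r]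
  · rw [abs_mul, abs_mul, abs_pow]
    simp only [abs_neg, abs_one, one_pow, one_mul]
    congr 1
    · simp [A', c]
    · congr 2
      ext i j
      rw [Matrix.submatrix_apply]
      simp [A', c, schur, Fin.succAbove_ne]
  · intro i _ hi
    have : A' i 0 = 0 := by simp [A', c, hi, hr]
    rw [this]; ring
  · simp

/-- bordered unimodular matrix -/
def bord {n : ℕ} (t : Fin n → ℤ) (B : Matrix (Fin n) (Fin n) ℤ) : Matrix (Fin (n + 1)) (Fin (n + 1)) ℤ :=
  fun i j => Fin.cases (Fin.cases 1 (fun j => t j) j) (fun i => Fin.cases 0 (fun j => B i j) j) i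

lemma bord_mul {n : ℕ} (t s : Fin n → ℤ) (B B' : Matrix (Fin n) (Fin n) ℤ) (h : B' * B = 1) (hs : ∀ j, s j = - ∑ k, t k * B' k j)
    (hBB : B * B' = 1) :
    bord s B' * bord t B = 1 := by
  have h' : ∀ i j, ∑ k, B' i k * B k j = if i = j then 1 else 0 := by
    intro i j
    have := congrFun (congrFun h i) j
    rwa [Matrix.mul_apply, Matrix.one_apply] at this
  ext i j
  rw [Matrix.mul_apply, Fin.sum_univ_succ]
  refine Fin.cases ?_ (fun i => ?_) i
  · refine Fin.cases ?_ (fun j => ?_) j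
    · simp [bord]
    · simp only [bord, Fin.cases_zero, Fin.cases_succ, hs]
      have : ∑ x, (-∑ k, t k * B' k x) * B x j = - t j := by
        have e : ∀ x, (-∑ k, t k * B' k x) * B x j = - ∑ k, t k * (B' k x * B x j) := by
          intro x; rw [neg_mul, Finset.sum_mul]; simp only [mul_assoc]
        simp only [e]
        rw [Finset.sum_neg_distrib, Finset.sum_comm]
        simp only [← Finset.mul_sum, h']
        simp
      rw [this, Matrix.one_apply_ne (Fin.succ_ne_zero j).symm]; ring
  · refine Fin.cases ?_ (fun j => ?_) j
    · simp [bord, Matrix.one_apply_ne (Fin.succ_ne_zero i)]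
    · simp only [bord, Fin.cases_zero, Fin.cases_succ, h', zero_mul, zero_add]
      simp [Matrix.one_apply]

end rb
end Sst


namespace Sst
open Filter Topology
set_option linter.unusedSectionVars false
set_option linter.unusedSimpArgs false
set_option linter.unusedVariables false

section rb

lemma mulVec_map {n : ℕ} (A : Matrix (Fin n) (Fin n) ℝ) (G G' : Matrix (Fin n) (Fin n) ℤ) (h : G * G' = 1) (x : Fin n → ℤ) :
    A.mulVec (cv x) = (A * G.map (Int.castRingHom ℝ)).mulVec (cv (G'.mulVec x)) := by
  have h1 : cv (G'.mulVec x) = (G'.map (Int.castRingHom ℝ)).mulVec (cv x) := by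
    ext i; simp [cv, Matrix.mulVec, dotProduct]
  rw [h1, Matrix.mulVec_mulVec, Matrix.mul_assoc, ← Matrix.map_mul, h]
  simp

theorem rb (n : ℕ) : ∃ C : ℝ, 1 ≤ C ∧ ∀ A : Matrix (Fin n) (Fin n) ℝ, A.det ≠ 0 →
    ∃ B B' : Matrix (Fin n) (Fin n) ℤ, B' * B = 1 ∧ ∃ π : Fin n → Fin n, Function.Injective π ∧ ∃ d : Fin n → ℝ,
      (∀ i, 0 < d i) ∧ (∀ i j, |(A * B.map (Int.castRingHom ℝ)) (π i) j| ≤ C * d i) ∧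
      (∀ i j, |(A * B.map (Int.castRingHom ℝ)) (π i) j| ≤ C * d j) ∧ (∀ i j, i ≤ j → d i ≤ C * d j) ∧
      ∏ i, d i = |A.det| ∧ ∀ (x : Fin n → ℤ) j, B'.mulVec x j ≠ 0 → ∃ i, d j ≤ C * |A.mulVec (cv x) i| := by
  induction n with
  | zero =>
    refine ⟨1, le_rfl, fun A _ => ⟨1, 1, by simp, id, Function.injective_id, fun _ => 1, ?_⟩⟩
    refine ⟨fun i => i.elim0, fun i => i.elim0, fun i => i.elim0, fun i => i.elim0, by simp, fun x j => j.elim0⟩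
  | succ n ih =>
    obtain ⟨C, hC, ih⟩ := ih
    refine ⟨3 * C, by linarith, fun A hA => ?_⟩
    obtain ⟨G, G', hG, r, hr, hshort⟩ := exists_short A hA
    obtain ⟨A1, hA1⟩ : ∃ A1, A1 = A * G.map (Int.castRingHom ℝ) := ⟨_, rfl⟩
    rw [← hA1] at hr hshort
    have hGG : G * G' = 1 := mul_eq_one_comm.1 hG
    have hdetG : |((G.det : ℤ) : ℝ)| = 1 := by
      have f1 : G'.det * G.det = 1 := by rw [← Matrix.det_mul, hG, Matrix.det_one]
      have := Int.isUnit_iff_abs_eq.1 (IsUnit.of_mul_eq_one_right _ f1)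
      exact_mod_cast this
    have hdetA1 : |A1.det| = |A.det| := by
      have : (G.map (Int.castRingHom ℝ)).det = ((G.det : ℤ) : ℝ) := by
        have := RingHom.map_det (Int.castRingHom ℝ) G
        rw [RingHom.mapMatrix_apply] at this
        rw [← this]; rfl
      rw [hA1, Matrix.det_mul, abs_mul, this, hdetG, mul_one]
    have hr0 : A1 r 0 ≠ 0 := by
      intro h
      have : A1.det = 0 := Matrix.det_eq_zero_of_column_eq_zero 0 fun i => by
        have := hr i; rw [h, abs_zero] at this
        exact abs_eq_zero.1 (le_antisymm this (abs_nonneg _))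
      rw [this, abs_zero] at hdetA1
      exact hA (abs_eq_zero.1 hdetA1.symm)
    obtain ⟨d0, hd0⟩ : ∃ d0, d0 = |A1 r 0| := ⟨_, rfl⟩
    have hd0pos : 0 < d0 := by rw [hd0]; exact abs_pos.2 hr0
    have hsd := schur_det A1 r hr0
    have hA2 : (schur A1 r).det ≠ 0 := by
      intro h; rw [h, abs_zero, mul_zero, hdetA1] at hsd
      exact hA (abs_eq_zero.1 hsd)
    obtain ⟨B2, B2', hB2, π2, hπ2, d2, hd2, hr2, hc2, hm2, hp2, hs2⟩ := ih _ hA2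
    have hBB2 : B2 * B2' = 1 := mul_eq_one_comm.1 hB2
    obtain ⟨y, hy⟩ : ∃ y : Fin n → ℝ, ∀ j, y j = (∑ k, A1 r (Fin.succ k) * (B2 k j : ℝ)) / A1 r 0 := ⟨_, fun _ => rfl⟩
    obtain ⟨t, ht⟩ : ∃ t : Fin n → ℤ, ∀ j, t j = - round (y j) := ⟨_, fun _ => rfl⟩
    obtain ⟨s, hs⟩ : ∃ s : Fin n → ℤ, ∀ j, s j = - ∑ k, t k * B2' k j := ⟨_, fun _ => rfl⟩
    have hbord := bord_mul t s B2 B2' hB2 hs hBB2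
    obtain ⟨F, hF⟩ : ∃ F, F = A1 * (bord t B2).map (Int.castRingHom ℝ) := ⟨_, rfl⟩
    have hF0 : ∀ i, F i 0 = A1 i 0 := by
      intro i; rw [hF, Matrix.mul_apply, Fin.sum_univ_succ]; simp [bord]
    have hFs : ∀ i j, F i (Fin.succ j) = A1 i 0 * t j + ∑ k, A1 i (Fin.succ k) * (B2 k j : ℝ) := by
      intro i j; rw [hF, Matrix.mul_apply, Fin.sum_univ_succ]; simp [bord]
    have hFr : ∀ j, |F r (Fin.succ j)| ≤ d0 / 2 := by
      intro j
      have e : F r (Fin.succ j) = A1 r 0 * (y j - round (y j)) := by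
        rw [hFs, ht]
        have : ∑ k, A1 r (Fin.succ k) * (B2 k j : ℝ) = A1 r 0 * y j := by rw [hy]; field_simp
        rw [this]; push_cast; ring
      rw [e, abs_mul, ← hd0]
      have := abs_sub_round (y j)
      nlinarith
    have hrat : ∀ i, |A1 i 0 / A1 r 0| ≤ 1 := by
      intro i; rw [abs_div, div_le_one (abs_pos.2 hr0)]; exact hr i
    have hFsA : ∀ i j, F (r.succAbove i) (Fin.succ j) = (schur A1 r * B2.map (Int.castRingHom ℝ)) i j + A1 (r.succAbove i) 0 / A1 r 0 * F r (Fin.succ j) := by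
      intro i j
      rw [hFs, hFs, Matrix.mul_apply]
      simp only [schur, Matrix.map_apply, eq_intCast, sub_mul, Finset.sum_sub_distrib, mul_assoc, ← Finset.mul_sum]
      rw [mul_add, ← mul_assoc, div_mul_cancel₀ _ hr0]; ring
    have hFb : ∀ i j X, |(schur A1 r * B2.map (Int.castRingHom ℝ)) i j| ≤ X → |F (r.succAbove i) (Fin.succ j)| ≤ X + d0 / 2 := by
      intro i j X hX
      rw [hFsA]
      refine (abs_add_le _ _).trans (add_le_add hX ?_)
      rw [abs_mul]
      calc _ ≤ 1 * (d0 / 2) := mul_le_mul (hrat _) (hFr j) (abs_nonneg _) zero_le_one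
        _ = _ := one_mul _
    have hBF : A * (G * bord t B2).map (Int.castRingHom ℝ) = F := by
      rw [hF, hA1, Matrix.map_mul, Matrix.mul_assoc]
    have hB'B : (bord s B2' * G') * (G * bord t B2) = 1 := by
      calc _ = bord s B2' * ((G' * G) * bord t B2) := by simp only [Matrix.mul_assoc]
        _ = 1 := by rw [hG, Matrix.one_mul, hbord]
    have hd0le : ∀ j, d0 ≤ 2 * C * d2 j := by
      intro j
      have hne : (fun i => (G * bord t B2) i (Fin.succ j)) ≠ 0 := by
        intro h
        have e := congrFun (congrFun hB'B (Fin.succ j)) (Fin.succ j)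
        rw [Matrix.mul_apply, Matrix.one_apply_eq, Finset.sum_eq_zero] at e
        · exact zero_ne_one e
        · intro i _; rw [show (G * bord t B2) i (Fin.succ j) = 0 from congrFun h i, mul_zero]
      obtain ⟨i, hi⟩ := hshort _ hne
      rw [← hd0] at hi
      have e : A.mulVec (cv fun i => (G * bord t B2) i (Fin.succ j)) i = F i (Fin.succ j) := by
        rw [← hBF, Matrix.mul_apply]; simp only [Matrix.mulVec, dotProduct, cv, Matrix.map_apply, eq_intCast]
      rw [e] at hi
      by_cases hir : i = r
      · rw [hir] at hi; linarith [hFr j]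
      · obtain ⟨i', rfl⟩ := Fin.exists_succAbove_eq hir
        obtain ⟨i'', rfl⟩ := (Finite.injective_iff_surjective.1 hπ2) i'
        have := hFb _ j _ (hc2 i'' j)
        linarith
    refine ⟨G * bord t B2, bord s B2' * G', hB'B, Fin.cons r (r.succAbove ∘ π2), ?_, Fin.cons d0 d2, ?_, ?_, ?_, ?_, ?_, ?_⟩
    · rw [Fin.cons_injective_iff]
      refine ⟨?_, (Fin.succAbove_right_injective).comp hπ2⟩
      rintro ⟨i, hi⟩
      exact Fin.succAbove_ne r _ hi
    · intro i; refine Fin.cases ?_ (fun i => ?_) i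
      · simpa using hd0pos
      · simpa using hd2 i
    · rw [hBF]
      intro i j
      refine Fin.cases ?_ (fun i => ?_) i
      · simp only [Fin.cons_zero]
        refine Fin.cases ?_ (fun j => ?_) j
        · rw [hF0, ← hd0]; nlinarith
        · nlinarith [hFr j]
      · simp only [Fin.cons_succ, Function.comp]
        have hdi := hd2 i
        refine Fin.cases ?_ (fun j => ?_) j
        · rw [hF0]; have := hr (r.succAbove (π2 i)); rw [← hd0] at this; nlinarith [hd0le i]
        · have := hFb _ j _ (hr2 i j)
          nlinarith [hd0le i]
    · rw [hBF]
      intro i j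
      refine Fin.cases ?_ (fun j => ?_) j
      · simp only [Fin.cons_zero]
        rw [hF0]; have := hr ((Fin.cons r (r.succAbove ∘ π2) : Fin (n + 1) → Fin (n + 1)) i); rw [← hd0] at this; nlinarith
      · simp only [Fin.cons_succ]
        have hdj := hd2 j
        refine Fin.cases ?_ (fun i => ?_) i
        · simp only [Fin.cons_zero]; nlinarith [hFr j, hd0le j]
        · simp only [Fin.cons_succ, Function.comp]
          have := hFb _ j _ (hc2 i j)
          nlinarith [hd0le j]
    · intro i j
      refine Fin.cases ?_ (fun j => ?_) j
      · refine Fin.cases ?_ (fun i => ?_) i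
        · intro _; simp only [Fin.cons_zero]; nlinarith
        · intro h; exact absurd h (by simp)
      · have hdj := hd2 j
        refine Fin.cases ?_ (fun i => ?_) i
        · intro _; simp only [Fin.cons_zero, Fin.cons_succ]; nlinarith [hd0le j]
        · intro h; simp only [Fin.cons_succ]
          have := hm2 i j (by simpa using h)
          nlinarith
    · rw [Fin.prod_univ_succ]
      simp only [Fin.cons_zero, Fin.cons_succ]
      rw [hp2, hd0, ← hsd, hdetA1]
    · intro x j
      refine Fin.cases ?_ (fun j => ?_) j
      · intro h
        have hx : x ≠ 0 := by rintro rfl; simp at h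
        obtain ⟨i, hi⟩ := hshort x hx
        rw [← hd0] at hi
        refine ⟨i, ?_⟩
        simp only [Fin.cons_zero]
        nlinarith
      · intro h
        obtain ⟨z, hz⟩ : ∃ z, z = G'.mulVec x := ⟨_, rfl⟩
        have hAx : A.mulVec (cv x) = A1.mulVec (cv z) := by rw [hA1, hz, ← mulVec_map A G G' hGG]
        rw [← Matrix.mulVec_mulVec, ← hz] at h
        have e1 : (bord s B2').mulVec z (Fin.succ j) = B2'.mulVec (fun k => z (Fin.succ k)) j := by
          simp [Matrix.mulVec, dotProduct, Fin.sum_univ_succ, bord]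
        rw [e1] at h
        obtain ⟨i, hi⟩ := hs2 _ j h
        have e2 : (schur A1 r).mulVec (cv fun k => z (Fin.succ k)) i = A1.mulVec (cv z) (r.succAbove i) - A1 (r.succAbove i) 0 / A1 r 0 * A1.mulVec (cv z) r := by
          simp only [Matrix.mulVec, dotProduct, Fin.sum_univ_succ, schur, cv, sub_mul, Finset.sum_sub_distrib, mul_assoc, ← Finset.mul_sum]
          rw [mul_add, ← mul_assoc (A1 (r.succAbove i) 0 / A1 r 0) (A1 r 0), div_mul_cancel₀ _ hr0]; ring
        have e3 : |(schur A1 r).mulVec (cv fun k => z (Fin.succ k)) i| ≤ |A1.mulVec (cv z) (r.succAbove i)| + |A1.mulVec (cv z) r| := by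
          rw [e2]
          refine (abs_sub _ _).trans (add_le_add le_rfl ?_)
          rw [abs_mul]
          nlinarith [hrat (r.succAbove i), abs_nonneg (A1.mulVec (cv z) r)]
        simp only [Fin.cons_succ]
        rw [hAx]
        rcases le_total |A1.mulVec (cv z) (r.succAbove i)| |A1.mulVec (cv z) r| with h1 | h1
        · refine ⟨r, ?_⟩
          have := abs_nonneg (A1.mulVec (cv z) r)
          nlinarith
        · refine ⟨r.succAbove i, ?_⟩
          have := abs_nonneg (A1.mulVec (cv z) (r.succAbove i))
          nlinarith

end rb
end Sst


namespace Sst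
open Filter Topology
set_option linter.unusedSectionVars false
set_option linter.unusedSimpArgs false
set_option linter.unusedVariables false

section step
variable {n : ℕ}

/-- top index set -/
def topS (n k : ℕ) : Finset (Fin n) := Finset.univ.filter fun i => k ≤ (i : ℕ)

lemma topS_card {k : ℕ} (hk : k ≤ n) : (topS n k).card = n - k := by
  have h1 : (Finset.univ.filter fun i : Fin n => (i : ℕ) < k).card = k := by
    rw [Fin.card_filter_val_lt]; omega
  have h2 := Finset.card_filter_add_card_filter_not (s := (Finset.univ : Finset (Fin n))) (fun i : Fin n => (i : ℕ) < k)
  rw [h1, Finset.card_univ, Fintype.card_fin] at h2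
  have : topS n k = Finset.univ.filter fun i : Fin n => ¬ (i : ℕ) < k := by
    ext i; simp [topS]
  rw [this]; omega

lemma gap (d : Fin n → ℝ) (hd : ∀ i, 0 < d i) (C : ℝ) (hC : 1 ≤ C) (hm : ∀ i j, i ≤ j → d i ≤ C * d j)
    (j0 : Fin n) (hj0 : d j0 ≤ C) (u : ℝ) (hu : 1 < u) (huC : C ≤ u) (hP : (C ^ 2 * (u ^ 2) ^ n) ^ n < ∏ i, d i) :
    ∃ k : ℕ, 0 < k ∧ k < n ∧ ∃ lo hi : ℝ, 0 < lo ∧ 0 < hi ∧ (∀ i : Fin n, (i : ℕ) < k → d i ≤ lo) ∧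
      (∀ j : Fin n, k ≤ (j : ℕ) → hi ≤ d j) ∧ lo ≤ u⁻¹ * hi ∧ C < hi := by
  have hn : 0 < n := j0.pos
  have hu2 : 1 < u ^ 2 := one_lt_pow₀ hu (by norm_num)
  have hex : ∃ k : ℕ, ∃ h : k < n, C ^ 2 * (u ^ 2) ^ k < d ⟨k, h⟩ := by
    by_contra hne
    push Not at hne
    have : ∏ i, d i ≤ (C ^ 2 * (u ^ 2) ^ n) ^ n := by
      calc ∏ i, d i ≤ ∏ i : Fin n, (C ^ 2 * (u ^ 2) ^ n) := by
            refine Finset.prod_le_prod (fun i _ => (hd i).le) fun i _ => (hne i i.2).trans ?_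
            refine mul_le_mul_of_nonneg_left (pow_le_pow_right₀ hu2.le i.2.le) (by positivity)
        _ = _ := by simp
    linarith
  classical
  obtain ⟨hkn, hk⟩ := Nat.find_spec hex
  have hmin := fun m => Nat.find_min hex (m := m)
  obtain ⟨k, hkd⟩ : ∃ k, k = Nat.find hex := ⟨_, rfl⟩
  simp only [← hkd] at hkn hk hmin
  have hk0 : 0 < k := by
    rcases Nat.eq_zero_or_pos k with h0 | h0
    · exfalso
      subst h0
      have h1 := hm ⟨0, hn⟩ j0 (Fin.le_def.2 (Nat.zero_le _))
      simp only [pow_zero, mul_one] at hk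
      nlinarith
    · exact h0
  refine ⟨k, hk0, hkn, C ^ 2 * (u ^ 2) ^ (k - 1), C * (u ^ 2) ^ k, by positivity, by positivity, ?_, ?_, ?_, ?_⟩
  · intro i hi
    have := hmin i hi
    push Not at this
    refine (this i.2).trans ?_
    refine mul_le_mul_of_nonneg_left (pow_le_pow_right₀ hu2.le (by omega)) (by positivity)
  · intro j hj
    have := hm ⟨k, hkn⟩ j (Fin.le_def.2 hj)
    nlinarith
  · obtain ⟨m, rfl⟩ : ∃ m, k = m + 1 := ⟨k - 1, by omega⟩
    simp only [Nat.add_sub_cancel]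
    have e : u⁻¹ * (C * (u ^ 2) ^ (m + 1)) = C * u * (u ^ 2) ^ m := by
      field_simp
      ring
    rw [e, pow_two]
    gcongr
  · have : 1 < (u ^ 2) ^ k := one_lt_pow₀ hu2 (by omega)
    nlinarith

lemma prod_top (d : Fin n → ℝ) (hd : ∀ i, 0 < d i) (k : ℕ) (hk : k ≤ n) (lo hi ε : ℝ) (hlo : 0 < lo) (hhi : 0 < hi)
    (h1 : ∀ i : Fin n, (i : ℕ) < k → d i ≤ lo) (h2 : ∀ j : Fin n, k ≤ (j : ℕ) → hi ≤ d j) (hε : lo ≤ ε * hi) (hε1 : ε ≤ 1)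
    (J : Finset (Fin n)) (hJ : J.card = n - k) (hne : J ≠ topS n k) :
    ∏ j ∈ J, d j ≤ ε * ∏ j ∈ topS n k, d j := by
  classical
  have hT := topS_card hk
  obtain ⟨T, hTd⟩ : ∃ T, T = topS n k := ⟨_, rfl⟩
  rw [← hTd] at hT hne ⊢
  have hε0 : 0 < ε := by by_contra h; push Not at h; nlinarith
  have hcard : (J \ T).card = (T \ J).card := by
    have a1 := Finset.card_sdiff_add_card_inter J T
    have a2 := Finset.card_sdiff_add_card_inter T J
    rw [Finset.inter_comm T J] at a2
    omega
  have hpos : (J \ T).card ≠ 0 := by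
    intro h0
    rw [Finset.card_eq_zero, Finset.sdiff_eq_empty_iff_subset] at h0
    exact hne (Finset.eq_of_subset_of_card_le h0 (by omega))
  have e1 : ∏ j ∈ J, d j = (∏ j ∈ J \ T, d j) * ∏ j ∈ J ∩ T, d j := by
    rw [mul_comm, Finset.prod_inter_mul_prod_sdiff]
  have e2 : ∏ j ∈ T, d j = (∏ j ∈ T \ J, d j) * ∏ j ∈ J ∩ T, d j := by
    rw [mul_comm, Finset.inter_comm, Finset.prod_inter_mul_prod_sdiff]
  have b1 : ∏ j ∈ J \ T, d j ≤ lo ^ (J \ T).card := by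
    rw [← Finset.prod_const]
    refine Finset.prod_le_prod (fun i _ => (hd i).le) fun i hmem => ?_
    have := (Finset.mem_sdiff.1 hmem).2
    rw [hTd] at this
    simp [topS] at this
    exact h1 i this
  have b2 : hi ^ (J \ T).card ≤ ∏ j ∈ T \ J, d j := by
    rw [hcard, ← Finset.prod_const]
    refine Finset.prod_le_prod (fun _ _ => hhi.le) fun i hmem => ?_
    have := (Finset.mem_sdiff.1 hmem).1
    rw [hTd] at this
    simp [topS] at this
    exact h2 i this
  have b3 : lo ^ (J \ T).card ≤ ε * hi ^ (J \ T).card := by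
    calc lo ^ (J \ T).card ≤ (ε * hi) ^ (J \ T).card := pow_le_pow_left₀ hlo.le hε _
      _ = ε ^ (J \ T).card * hi ^ (J \ T).card := mul_pow _ _ _
      _ ≤ ε ^ 1 * hi ^ (J \ T).card := by
        refine mul_le_mul_of_nonneg_right (pow_le_pow_of_le_one hε0.le hε1 (by omega)) (by positivity)
      _ = _ := by rw [pow_one]
  have b4 : ∏ j ∈ J \ T, d j ≤ ε * ∏ j ∈ T \ J, d j := b1.trans (b3.trans (mul_le_mul_of_nonneg_left b2 hε0.le))
  rw [e1, e2, ← mul_assoc]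
  exact mul_le_mul_of_nonneg_right b4 (Finset.prod_nonneg fun i _ => (hd i).le)

/-- lower bound on `d` -/
lemma d_lower (M : Matrix (Fin n) (Fin n) ℝ) (hM : M.det ≠ 0) : ∃ K : ℝ, 1 ≤ K ∧ ∀ (b : Fin n → ℤ) (X : ℝ), b ≠ 0 →
    (∀ i, |M.mulVec (cv b) i| ≤ X) → 1 ≤ K * X := by
  obtain ⟨K, hK⟩ : ∃ K : ℝ, K = 1 + ∑ i, ∑ j, |M⁻¹ i j| := ⟨_, rfl⟩
  have hS : 0 ≤ ∑ i, ∑ j, |M⁻¹ i j| := Finset.sum_nonneg fun _ _ => Finset.sum_nonneg fun _ _ => abs_nonneg _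
  refine ⟨K, by linarith, fun b X hb hX => ?_⟩
  obtain ⟨u, hu⟩ := Function.ne_iff.1 hb
  have h1 : cv b = M⁻¹.mulVec (M.mulVec (cv b)) := by
    rw [Matrix.mulVec_mulVec, Matrix.nonsing_inv_mul _ (Ne.isUnit hM), Matrix.one_mulVec]
  have hX0 : 0 ≤ X := (abs_nonneg _).trans (hX u)
  have h2 : (1:ℝ) ≤ |cv b u| := by
    have : 1 ≤ |b u| := Int.one_le_abs hu
    simp only [cv]; exact_mod_cast this
  refine h2.trans ?_
  rw [h1]
  simp only [Matrix.mulVec, dotProduct]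
  refine (Finset.abs_sum_le_sum_abs _ _).trans ?_
  have e2 : ∑ j, |M⁻¹ u j| ≤ K := by
    have : ∑ j, |M⁻¹ u j| ≤ ∑ i, ∑ j, |M⁻¹ i j| := Finset.single_le_sum (f := fun i => ∑ j, |M⁻¹ i j|) (fun _ _ => Finset.sum_nonneg fun _ _ => abs_nonneg _) (Finset.mem_univ u)
    linarith
  refine le_trans ?_ (mul_le_mul_of_nonneg_right e2 hX0)
  rw [Finset.sum_mul]
  refine Finset.sum_le_sum fun j _ => ?_
  rw [abs_mul]
  exact mul_le_mul_of_nonneg_left (hX j) (abs_nonneg _)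

lemma cmp_scale (p : ℕ) (v : Fin n → ℝ) (N : Matrix (Fin n) (Fin n) ℝ) (I J : Set.powersetCard (Fin n) p) :
    cmp p (Matrix.of fun i j => v i * N i j) I J = (∏ i ∈ I.1, v i) * cmp p N I J := by
  rw [← prod_em I v]
  simp only [cmp]
  rw [← Matrix.det_mul_column]
  rfl

end step
end Sst


namespace Sst
open Filter Topology
set_option linter.unusedSectionVars false
set_option linter.unusedSimpArgs false
set_option linter.unusedVariables false

section step
variable {n : ℕ}

lemma scale_mulVec (M : Matrix (Fin n) (Fin n) ℝ) (v : Fin n → ℝ) (x : Fin n → ℝ) (i : Fin n) :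
    (Matrix.of fun i j => v i * M i j).mulVec x i = v i * M.mulVec x i := by
  simp [Matrix.mulVec, dotProduct, Finset.mul_sum, mul_assoc]

lemma scale_mul (M N : Matrix (Fin n) (Fin n) ℝ) (v : Fin n → ℝ) :
    (Matrix.of fun i j => v i * M i j) * N = Matrix.of fun i j => v i * (M * N) i j := by
  ext i j; simp [Matrix.mul_apply, Finset.mul_sum, mul_assoc]

/-- top index as a `powersetCard` element -/
def topP (n k : ℕ) (hk : k ≤ n) : Set.powersetCard (Fin n) (n - k) := ⟨topS n k, topS_card hk⟩

/-- conclusion of the geometric step -/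
def Concl (M : Matrix (Fin n) (Fin n) ℝ) (γ K q : ℝ) (x : Fin n → ℤ) (k : ℕ) (hk : k ≤ n) : Prop :=
  ∃ B B' : Matrix (Fin n) (Fin n) ℤ, B' * B = 1 ∧ (∀ j : Fin n, k ≤ (j : ℕ) → B'.mulVec x j = 0) ∧
    ∃ e : Set.powersetCard (Fin n) (n - k) → ℝ, (∀ s, |e s| ≤ K) ∧ ∑ s, e s ≤ - γ ∧
      ∀ I J, J ≠ topP n k hk → |cmp (n - k) (M * B.map (Int.castRingHom ℝ)) I J| ≤ Real.exp (q * e I)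

set_option maxHeartbeats 1600000 in
lemma step (M : Matrix (Fin n) (Fin n) ℝ) (hM : M.det ≠ 0) (Cc δ : ℝ) (hδ : 0 < δ) :
    ∃ γ K : ℝ, 0 < γ ∧ ∀ᶠ q in atTop, ∀ c : Fin n → ℝ, (∀ i, |c i| ≤ Cc) → ∑ i, c i ≤ - δ →
      ∀ x : Fin n → ℤ, x ≠ 0 → (∀ i, |M.mulVec (cv x) i| ≤ Real.exp (q * c i)) →
      ∃ k : ℕ, ∃ hk : k < n, 0 < k ∧ Concl M γ K q x k hk.le := by
  classical
  obtain ⟨C, hC, hrb⟩ := rb n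
  obtain ⟨K0, hK0, hlow⟩ := d_lower M hM
  choose N hN0 hN using fun p => sum_sum_sets (n := n) p
  obtain ⟨γ, hγ⟩ : ∃ γ, γ = δ / (4 * ((n:ℝ) + 1) ^ 2) := ⟨_, rfl⟩
  have hγ0 : 0 < γ := by rw [hγ]; positivity
  have hγn : 2 * γ * (n * n) ≤ δ / 2 := by
    have h1 : γ * (4 * ((n:ℝ) + 1) ^ 2) = δ := by rw [hγ]; field_simp
    have h2 : (0:ℝ) ≤ n := Nat.cast_nonneg n
    nlinarith [mul_nonneg hγ0.le h2]
  obtain ⟨E, hE⟩ : ∃ E : ℝ, E = n.factorial * C ^ n := ⟨_, rfl⟩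
  have hE1 : 1 ≤ E := by
    rw [hE]
    have h1 : (1:ℝ) ≤ n.factorial := by exact_mod_cast n.factorial_pos
    have h2 : 1 ≤ C ^ n := one_le_pow₀ hC
    nlinarith
  have hlE : 0 ≤ Real.log E := Real.log_nonneg hE1
  obtain ⟨D, hD⟩ : ∃ D, D = |M.det| := ⟨_, rfl⟩
  have hD0 : 0 < D := by rw [hD]; exact abs_pos.2 hM
  obtain ⟨W, hW⟩ : ∃ W : ℕ → ℝ, ∀ p, W p = N p * |Real.log D| + Fintype.card (Set.powersetCard (Fin n) p) * Real.log E := ⟨_, fun _ => rfl⟩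
  have hW0 : ∀ p, 0 ≤ W p := fun p => by rw [hW]; have := hN0 p; positivity
  obtain ⟨K1, hK1⟩ : ∃ K1 : ℝ, K1 = 2 * n * (Cc + 1) + 1 := ⟨_, rfl⟩
  refine ⟨γ / 2, n * (Cc + K1) + Real.log E + γ, by positivity, ?_⟩
  have E2 : ∀ᶠ q in atTop, C ≤ Real.exp (γ * q) :=
    (Real.tendsto_exp_atTop.comp (tendsto_id.const_mul_atTop hγ0)).eventually_ge_atTop C
  have E3 : ∀ᶠ q in atTop, C ^ (2 * n) / D < Real.exp (δ / 2 * q) :=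
    (Real.tendsto_exp_atTop.comp (tendsto_id.const_mul_atTop (by positivity : 0 < δ / 2))).eventually_gt_atTop _
  have E4 : ∀ᶠ q in atTop, K0 * C ≤ Real.exp q := Real.tendsto_exp_atTop.eventually_ge_atTop _
  have E5 : ∀ᶠ q in atTop, D ≤ Real.exp q := Real.tendsto_exp_atTop.eventually_ge_atTop _
  filter_upwards [eventually_ge_atTop 1, E2, E3, E4, E5, eventually_ge_atTop ((∑ p ∈ Finset.range (n + 1), W p) / (γ / 2))] with q hq1 hq2 hq3 hq4 hq5 hq6 c hc hcs x hx hMx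
  have hq0 : 0 < q := by linarith
  have hn : 0 < n := by
    obtain ⟨i, -⟩ := Function.ne_iff.1 hx
    exact i.pos
  have hn1 : (1:ℝ) ≤ n := by exact_mod_cast hn
  have hCc : 0 ≤ Cc := (abs_nonneg _).trans (hc ⟨0, hn⟩)
  obtain ⟨A, hA⟩ : ∃ A : Matrix (Fin n) (Fin n) ℝ, A = Matrix.of fun i j => Real.exp (-(q * c i)) * M i j := ⟨_, rfl⟩
  have hdetA : |A.det| = Real.exp (-(q * ∑ i, c i)) * D := by
    rw [hA, Matrix.det_mul_column, ← Real.exp_sum, abs_mul, abs_of_pos (Real.exp_pos _), ← hD, Finset.sum_neg_distrib, ← Finset.mul_sum]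
  have hAne : A.det ≠ 0 := by
    intro h; rw [h, abs_zero] at hdetA
    have := mul_pos (Real.exp_pos (-(q * ∑ i, c i))) hD0
    linarith
  obtain ⟨B, B', hBB, π0, hπ0, d, hd, hr, hcol, hm, hprod, hsh⟩ := hrb A hAne
  obtain ⟨π, hπ⟩ : ∃ π : Equiv.Perm (Fin n), ∀ i, π i = π0 i := ⟨Equiv.ofBijective π0 (Finite.injective_iff_bijective.1 hπ0), fun _ => rfl⟩
  have hrow' : ∀ i j, |(A * B.map (Int.castRingHom ℝ)) i j| ≤ C * d (π.symm i) := by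
    intro i j; have := hr (π.symm i) j; rwa [← hπ, Equiv.apply_symm_apply] at this
  have hcol' : ∀ i j, |(A * B.map (Int.castRingHom ℝ)) i j| ≤ C * d j := by
    intro i j; have := hcol (π.symm i) j; rwa [← hπ, Equiv.apply_symm_apply] at this
  have hMB : M * B.map (Int.castRingHom ℝ) = Matrix.of fun i j => Real.exp (q * c i) * (A * B.map (Int.castRingHom ℝ)) i j := by
    rw [hA, scale_mul]
    ext i j
    simp only [Matrix.of_apply]
    rw [← mul_assoc, ← Real.exp_add, add_neg_cancel, Real.exp_zero, one_mul]
  -- bounds on log d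
  have hlsum : ∑ i, Real.log (d i) = - (q * ∑ i, c i) + Real.log D := by
    rw [← Real.log_prod (fun i _ => (hd i).ne'), hprod, hdetA, Real.log_mul (Real.exp_pos _).ne' hD0.ne', Real.log_exp]
  have hlow1 : ∀ j, - (q * (Cc + 1)) ≤ Real.log (d j) := by
    intro j
    have hne : (fun i => B i j) ≠ 0 := by
      intro h
      have e := congrFun (congrFun hBB j) j
      rw [Matrix.mul_apply, Matrix.one_apply_eq, Finset.sum_eq_zero] at e
      · exact zero_ne_one e
      · intro i _; rw [show B i j = 0 from congrFun h i, mul_zero]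
    have h1 := hlow (fun i => B i j) (Real.exp (q * Cc) * (C * d j)) hne (by
      intro i
      have e : M.mulVec (cv fun i => B i j) i = (M * B.map (Int.castRingHom ℝ)) i j := by
        rw [Matrix.mul_apply]; simp only [Matrix.mulVec, dotProduct, cv, Matrix.map_apply, eq_intCast]
      rw [e, hMB, Matrix.of_apply, abs_mul, abs_of_pos (Real.exp_pos _)]
      refine mul_le_mul (Real.exp_le_exp.2 ?_) (hcol' i j) (abs_nonneg _) (Real.exp_pos _).le
      exact mul_le_mul_of_nonneg_left ((le_abs_self _).trans (hc i)) hq0.le)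
    have h2 : 1 ≤ Real.exp (q * (Cc + 1)) * d j := by
      calc (1:ℝ) ≤ K0 * (Real.exp (q * Cc) * (C * d j)) := h1
        _ = (K0 * C) * (Real.exp (q * Cc) * d j) := by ring
        _ ≤ Real.exp q * (Real.exp (q * Cc) * d j) := by
          refine mul_le_mul_of_nonneg_right hq4 ?_
          have := hd j; positivity
        _ = _ := by rw [← mul_assoc, ← Real.exp_add]; ring_nf
    have h3 := Real.log_le_log one_pos h2
    rw [Real.log_one, Real.log_mul (Real.exp_pos _).ne' (hd j).ne', Real.log_exp] at h3
    linarith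
  have hup1 : ∀ j, Real.log (d j) ≤ q * K1 := by
    intro j
    have h1 : Real.log (d j) + ∑ i ∈ Finset.univ.erase j, Real.log (d i) = ∑ i, Real.log (d i) := Finset.add_sum_erase Finset.univ (fun i => Real.log (d i)) (Finset.mem_univ j)
    have h2 : ∑ i ∈ Finset.univ.erase j, (-(q * (Cc + 1))) ≤ ∑ i ∈ Finset.univ.erase j, Real.log (d i) := Finset.sum_le_sum fun i _ => hlow1 i
    have h3 : - (n * (q * (Cc + 1))) ≤ ∑ i ∈ Finset.univ.erase j, (-(q * (Cc + 1))) := by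
      rw [Finset.sum_const, nsmul_eq_mul, Finset.card_erase_of_mem (Finset.mem_univ j), Finset.card_univ, Fintype.card_fin, Nat.cast_pred hn]
      have : 0 ≤ q * (Cc + 1) := by positivity
      nlinarith
    have h4 : Real.log D ≤ q := by
      rw [Real.log_le_iff_le_exp hD0]; exact hq5
    have h5 : - (n * Cc) ≤ ∑ i, c i := by
      have : ∑ i : Fin n, (-Cc) ≤ ∑ i, c i := Finset.sum_le_sum fun i _ => (abs_le.1 (hc i)).1
      simpa using this
    have h6 : - (q * ∑ i, c i) ≤ q * (n * Cc) := by nlinarith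
    rw [hK1]
    have : q * (2 * n * (Cc + 1) + 1) = q * (n * Cc) + q + n * (q * (Cc + 1)) + q * n := by ring
    have : 0 ≤ q * n := by positivity
    linarith
  have hK1' : Cc + 1 ≤ K1 := by rw [hK1]; nlinarith
  have hlabs : ∀ j, |Real.log (d j) / q| ≤ K1 := by
    intro j
    rw [abs_div, abs_of_pos hq0, div_le_iff₀ hq0, abs_le]
    constructor
    · have := hlow1 j; nlinarith
    · have := hup1 j; linarith
  -- gap
  have hB'B : B * B' = 1 := mul_eq_one_comm.1 hBB
  have hB'x : B'.mulVec x ≠ 0 := by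
    intro h
    apply hx
    have : B.mulVec (B'.mulVec x) = x := by rw [Matrix.mulVec_mulVec, hB'B, Matrix.one_mulVec]
    rw [← this, h, Matrix.mulVec_zero]
  have hAx : ∀ i, |A.mulVec (cv x) i| ≤ 1 := by
    intro i
    rw [hA, scale_mulVec, abs_mul, abs_of_pos (Real.exp_pos _)]
    calc _ ≤ Real.exp (-(q * c i)) * Real.exp (q * c i) := mul_le_mul_of_nonneg_left (hMx i) (Real.exp_pos _).le
      _ = 1 := by rw [← Real.exp_add, neg_add_cancel, Real.exp_zero]
  have hsh' : ∀ j, B'.mulVec x j ≠ 0 → d j ≤ C := by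
    intro j hj
    obtain ⟨i, hi⟩ := hsh x j hj
    have := hAx i
    nlinarith
  obtain ⟨j0, hj0⟩ := Function.ne_iff.1 hB'x
  have hP : (C ^ 2 * (Real.exp (γ * q) ^ 2) ^ n) ^ n < ∏ i, d i := by
    rw [hprod, hdetA]
    have h1 : (C ^ 2 * (Real.exp (γ * q) ^ 2) ^ n) ^ n = C ^ (2 * n) * Real.exp (2 * γ * (n * n) * q) := by
      rw [mul_pow, ← pow_mul, ← pow_mul, ← pow_mul, ← Real.exp_nat_mul]
      congr 2
      push_cast; ring
    rw [h1]
    have h2 : Real.exp (2 * γ * (n * n) * q) ≤ Real.exp (δ / 2 * q) := Real.exp_le_exp.2 (mul_le_mul_of_nonneg_right hγn hq0.le)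
    have h3 : Real.exp (δ / 2 * q) * Real.exp (δ / 2 * q) ≤ Real.exp (-(q * ∑ i, c i)) := by
      rw [← Real.exp_add]; apply Real.exp_le_exp.2; have := mul_le_mul_of_nonneg_left hcs hq0.le; linarith
    rw [div_lt_iff₀ hD0] at hq3
    calc C ^ (2 * n) * Real.exp (2 * γ * (n * n) * q) ≤ C ^ (2 * n) * Real.exp (δ / 2 * q) := mul_le_mul_of_nonneg_left h2 (by positivity)
      _ < (Real.exp (δ / 2 * q) * D) * Real.exp (δ / 2 * q) := mul_lt_mul_of_pos_right hq3 (Real.exp_pos _)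
      _ = (Real.exp (δ / 2 * q) * Real.exp (δ / 2 * q)) * D := by ring
      _ ≤ _ := mul_le_mul_of_nonneg_right h3 hD0.le
  have hu1 : 1 < Real.exp (γ * q) := by rw [Real.one_lt_exp_iff]; positivity
  obtain ⟨k, hk0, hkn, lo, hi, hlo, hhi, hlo1, hhi1, hlh, hChi⟩ := gap d hd C hC hm j0 (hsh' j0 hj0) _ hu1 hq2 hP
  refine ⟨k, hkn, hk0, B, B', hBB, ?_, ?_⟩
  · intro j hj
    by_contra h
    linarith [hsh' j h, hhi1 j hj]
  obtain ⟨p, hp⟩ : ∃ p, p = n - k := ⟨_, rfl⟩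
  have hpn : p ≤ n := by omega
  obtain ⟨T, hT⟩ : ∃ T : Finset (Fin n), T = (topS n k).map π.toEmbedding := ⟨_, rfl⟩
  have hpE : (p.factorial : ℝ) * C ^ p ≤ E := by
    rw [hE]
    have h1 : (p.factorial : ℝ) ≤ n.factorial := by exact_mod_cast Nat.factorial_le hpn
    have h2 : C ^ p ≤ C ^ n := pow_le_pow_right₀ hC hpn
    gcongr
  have hTcard : T.card = p := by rw [hT, Finset.card_map, topS_card hkn.le, hp]
  obtain ⟨g, hg⟩ : ∃ g : Fin n → ℝ, ∀ i, g i = c i + Real.log (d (π.symm i)) / q := ⟨_, fun _ => rfl⟩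
  have hgsum : ∑ i, g i = Real.log D / q := by
    simp only [hg]
    rw [Finset.sum_add_distrib, ← Finset.sum_div, Equiv.sum_comp π.symm (fun i => Real.log (d i)), hlsum]
    field_simp; ring
  have hminor : ∀ I J : Set.powersetCard (Fin n) (n - k), |cmp (n - k) (A * B.map (Int.castRingHom ℝ)) I J| ≤ E * ∏ i ∈ I.1, d (π.symm i) ∧
      |cmp (n - k) (A * B.map (Int.castRingHom ℝ)) I J| ≤ E * ∏ i ∈ J.1, d i := by
    intro I J
    have := det_abs_le ((A * B.map (Int.castRingHom ℝ)).submatrix (em I) (em J)) C (by linarith) (fun i => d (π.symm (em I i))) (fun j => d (em J j))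
      (fun i j => hrow' _ _) (fun i j => hcol' _ _)
    rw [prod_em I (fun i => d (π.symm i)), prod_em J d] at this
    have hpE : (((n - k).factorial : ℕ) : ℝ) * C ^ (n - k) ≤ E := by rw [← hp]; exact hpE
    refine ⟨this.1.trans ?_, this.2.trans ?_⟩
    · exact mul_le_mul_of_nonneg_right hpE (Finset.prod_nonneg fun i _ => (hd _).le)
    · exact mul_le_mul_of_nonneg_right hpE (Finset.prod_nonneg fun i _ => (hd _).le)
  have hexp : ∀ I : Set.powersetCard (Fin n) (n - k), Real.exp (q * (∑ i ∈ I.1, g i + Real.log E / q)) = (∏ i ∈ I.1, Real.exp (q * c i)) * (E * ∏ i ∈ I.1, d (π.symm i)) := by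
    intro I
    have e1 : q * (∑ i ∈ I.1, g i + Real.log E / q) = ∑ i ∈ I.1, q * c i + (Real.log E + ∑ i ∈ I.1, Real.log (d (π.symm i))) := by
      simp only [hg]
      rw [Finset.sum_add_distrib, ← Finset.sum_div, ← Finset.mul_sum]
      field_simp; ring
    rw [e1, Real.exp_add, Real.exp_add, Real.exp_sum, Real.exp_sum, Real.exp_log (by linarith)]
    congr 2
    exact Finset.prod_congr rfl fun i _ => Real.exp_log (hd _)
  refine ⟨fun I => ∑ i ∈ I.1, g i + Real.log E / q - if I.1 = T then γ else 0, ?_, ?_, ?_⟩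
  · intro I
    have h1 : |∑ i ∈ I.1, g i| ≤ n * (Cc + K1) := by
      refine (Finset.abs_sum_le_sum_abs _ _).trans ?_
      have h2 : ∀ i ∈ I.1, |g i| ≤ Cc + K1 := fun i _ => by
        rw [hg]; exact (abs_add_le _ _).trans (add_le_add (hc i) (hlabs _))
      refine (Finset.sum_le_sum h2).trans ?_
      rw [Finset.sum_const, nsmul_eq_mul]
      refine mul_le_mul_of_nonneg_right ?_ (by linarith)
      have : I.1.card ≤ n := by simp
      exact_mod_cast this
    have h2 : Real.log E / q ≤ Real.log E := div_le_self hlE hq1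
    have h3 : 0 ≤ Real.log E / q := by positivity
    rw [abs_le] at h1
    show |∑ i ∈ I.1, g i + Real.log E / q - (if I.1 = T then γ else 0)| ≤ _
    rw [abs_le]
    split_ifs <;> constructor <;> linarith [h1.1, h1.2]
  · rw [Finset.sum_sub_distrib, Finset.sum_add_distrib, hN, hgsum]
    have h1 : ∑ I : Set.powersetCard (Fin n) (n - k), (if I.1 = T then γ else 0) = γ := by
      rw [Finset.sum_eq_single (⟨T, by rw [← hp]; exact hTcard⟩ : Set.powersetCard (Fin n) (n - k))]
      · simp
      · intro I _ hI
        rw [if_neg]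
        intro h; exact hI (Subtype.ext h)
      · simp
    rw [h1]
    simp only [Finset.sum_const, nsmul_eq_mul, Finset.card_univ]
    have h2 : W (n - k) ≤ ∑ p ∈ Finset.range (n + 1), W p := Finset.single_le_sum (fun p _ => hW0 p) (Finset.mem_range.2 (by omega))
    rw [div_le_iff₀ (by positivity)] at hq6
    have h3 : N (n - k) * (Real.log D / q) ≤ N (n - k) * |Real.log D| / q := by
      rw [mul_div_assoc]
      refine mul_le_mul_of_nonneg_left ?_ (hN0 _)
      exact div_le_div_of_nonneg_right (le_abs_self _) hq0.le
    have h4 : N (n - k) * |Real.log D| / q + Fintype.card (Set.powersetCard (Fin n) (n - k)) * (Real.log E / q) = W (n - k) / q := by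
      rw [hW]; ring
    have h5 : W (n - k) / q ≤ γ / 2 := by
      rw [div_le_iff₀ hq0]; linarith
    linarith
  · intro I J hJ
    rw [hMB, cmp_scale, abs_mul, abs_of_nonneg (Finset.prod_nonneg fun i _ => (Real.exp_pos _).le), mul_sub, Real.exp_sub, hexp]
    split_ifs with hI
    · have h1 : ∏ i ∈ I.1, d (π.symm i) = ∏ i ∈ topS n k, d i := by
        rw [hI, hT, Finset.prod_map]; simp
      have hJ' : J.1 ≠ topS n k := fun h => hJ (Subtype.ext h)
      have h2 := prod_top d hd k hkn.le lo hi (Real.exp (γ * q))⁻¹ hlo hhi hlo1 hhi1 hlh (inv_le_one_of_one_le₀ hu1.le) J.1 J.2 hJ'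
      have h3 := (hminor I J).2
      rw [h1, mul_comm q γ]
      rw [mul_div_assoc]
      refine mul_le_mul_of_nonneg_left ?_ (Finset.prod_nonneg fun i _ => (Real.exp_pos _).le)
      refine h3.trans ?_
      rw [mul_div_assoc]
      refine mul_le_mul_of_nonneg_left ?_ (by linarith)
      rw [div_eq_inv_mul]; exact h2
    · rw [mul_zero, Real.exp_zero, div_one]
      exact mul_le_mul_of_nonneg_left (hminor I J).1 (Finset.prod_nonneg fun i _ => (Real.exp_pos _).le)

end step
end Sst


namespace Sst
open Filter Topology
set_option linter.unusedSectionVars false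
set_option linter.unusedSimpArgs false
set_option linter.unusedVariables false

lemma freq_pigeon {β : Type*} [Finite β] {l : Filter ℕ} {P : ℕ → β → Prop} (h : ∃ᶠ n in l, ∃ b, P n b) : ∃ b, ∃ᶠ n in l, P n b := by
  by_contra hc
  push Not at hc
  apply h
  have : ∀ᶠ n in l, ∀ b, ¬ P n b := eventually_all.2 fun b => hc b
  filter_upwards [this] with n hn
  rintro ⟨b, hb⟩; exact hn b hb

theorem subsp {n : ℕ} {O : Type*} [SeminormedCommRing O] [NormOneClass O] (Md : Mdl O) (L : Matrix (Fin n) (Fin n) O)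
    (hdet : Md.φ L.det ≠ 0) (c : ℕ → Fin n → ℝ) (Cc : ℝ) (hCc : ∀ h i, |c h i| ≤ Cc) (δ : ℝ) (hδ : 0 < δ)
    (hc : ∀ h, ∑ i, c h i ≤ - δ) (q : ℕ → ℝ) (hq : Tendsto q atTop atTop) (x : ℕ → Fin n → ℤ) (hx : ∀ h, x h ≠ 0)
    (hL : ∀ h i, |(L.map Md.φ).mulVec (cv (x h)) i| ≤ Real.exp (q h * c h i)) :
    ∃ a : Fin n → ℤ, a ≠ 0 ∧ ∃ᶠ h in atTop, ∑ u, a u * x h u = 0 := by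
  classical
  have hM : (L.map Md.φ).det ≠ 0 := by
    rw [← RingHom.mapMatrix_apply, ← RingHom.map_det]; exact hdet
  obtain ⟨γ, K, hγ, hstep⟩ := step (L.map Md.φ) hM Cc δ hδ
  have h1 : ∀ᶠ h in atTop, ∃ k : Fin n, 0 < (k : ℕ) ∧ Concl (L.map Md.φ) γ K (q h) (x h) k k.2.le := by
    filter_upwards [hq.eventually hstep] with h hh
    obtain ⟨k, hk, hk0, hC⟩ := hh (c h) (hCc h) (hc h) (x h) (hx h) (hL h)
    exact ⟨⟨k, hk⟩, hk0, hC⟩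
  obtain ⟨k, hk⟩ := freq_pigeon h1.frequently
  have hk0 : 0 < (k : ℕ) := by obtain ⟨_, h, _⟩ := hk.exists; exact h
  obtain ⟨s, hs, hsC⟩ := extraction_of_frequently_atTop hk
  have hsC' : ∀ h, Concl (L.map Md.φ) γ K (q (s h)) (x (s h)) k k.2.le := fun h => (hsC h).2
  choose B B' hBB hker e he hes hcm using hsC'
  obtain ⟨a, ha⟩ := pen Md (cmp (n - k) L)
    (by
      have := cmp_det_ne (n - k) (L.map Md.φ) hM
      rw [cmp_map, ← RingHom.mapMatrix_apply, ← RingHom.map_det] at this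
      exact this)
    e K he γ hγ hes (topP n k k.2.le) (fun h => q (s h)) (hq.comp hs.tendsto_atTop)
    (fun h => cmp (n - k) (B' h)) (fun h => cmp (n - k) (B h))
    (fun h => by rw [← cmp_mul, hBB, cmp_one])
    (fun h I J hJ => by
      have := hcm h I J hJ
      rwa [cmp_mul, cmp_map, cmp_map] at this)
  have hane : ∃ J0, a J0 ≠ 0 := by
    by_contra hc
    push Not at hc
    obtain ⟨h, hh⟩ := ha.exists
    have e1 : (cmp (n - k) (B' h) * cmp (n - k) (B h)) (topP n k k.2.le) (topP n k k.2.le) = 1 := by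
      rw [← cmp_mul, hBB, cmp_one, Matrix.one_apply_eq]
    rw [Matrix.mul_apply, Finset.sum_eq_zero] at e1
    · exact zero_ne_one e1
    · intro J _
      rw [show cmp (n - k) (B' h) (topP n k k.2.le) J = a J from congrFun hh J, hc J, zero_mul]
  obtain ⟨J0, hJ0⟩ := hane
  obtain ⟨Kz, hKz⟩ : ∃ Kz : ℤ, Kz = ∑ J, |a J| := ⟨_, rfl⟩
  have hKz0 : 0 ≤ Kz := by rw [hKz]; exact Finset.sum_nonneg fun _ _ => abs_nonneg _
  have hKb : ∀ J, |a J| ≤ Kz := fun J => by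
    rw [hKz]; exact Finset.single_le_sum (f := fun J => |a J|) (fun _ _ => abs_nonneg _) (Finset.mem_univ J)
  have h2 : ∃ᶠ h in atTop, ∃ ω : (Set.Icc (fun _ : Fin n => -Kz) (fun _ => Kz) : Set (Fin n → ℤ)), ω.1 ≠ 0 ∧ ∑ u, ω.1 u * x (s h) u = 0 := by
    refine ha.mono fun h hh => ?_
    have hdetJ : ∀ J, (((B' h).submatrix (em (topP n k k.2.le)) id).submatrix id (em J)).det = a J := fun J => congrFun hh J
    obtain ⟨ω, hω0, hωK, hω⟩ := ann_form (p := n - k) (by have := k.2; omega) ((B' h).submatrix (em (topP n k k.2.le)) id) Kz hKz0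
      (fun J => by rw [hdetJ]; exact hKb J) J0 (by rw [hdetJ]; exact hJ0)
    refine ⟨⟨ω, fun u => (abs_le.1 (hωK u)).1, fun u => (abs_le.1 (hωK u)).2⟩, hω0, hω _ ?_⟩
    ext i
    have := hker h (em (topP n k k.2.le) i) (Finset.mem_filter.1 (em_mem (topP n k k.2.le) i)).2
    exact this
  have hfin : Finite (Set.Icc (fun _ : Fin n => -Kz) (fun _ => Kz) : Set (Fin n → ℤ)) := (Set.finite_Icc _ _).to_subtype
  obtain ⟨ω, hω⟩ := freq_pigeon h2
  refine ⟨ω.1, by obtain ⟨_, h, _⟩ := hω.exists; exact h, ?_⟩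
  exact hs.tendsto_atTop.frequently (hω.mono fun h hh => hh.2)

end Sst


namespace Sst
open Filter Topology
set_option linter.unusedSectionVars false
set_option linter.unusedSimpArgs false
set_option linter.unusedVariables false

section mdl
attribute [local instance] Matrix.linftyOpSemiNormedRing

lemma linf_row {d : ℕ} (A : Matrix (Fin d) (Fin d) ℤ) (i : Fin d) : ∑ j, |(A i j : ℝ)| ≤ ‖A‖ := by
  have h : ‖A‖ = _ := Matrix.linfty_opNorm_def A
  rw [h]
  have h1 : ∑ j, ‖A i j‖₊ ≤ Finset.univ.sup fun i => ∑ j, ‖A i j‖₊ := Finset.le_sup (f := fun i => ∑ j, ‖A i j‖₊) (Finset.mem_univ i)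
  have h2 : ((∑ j, ‖A i j‖₊ : NNReal) : ℝ) = ∑ j, |(A i j : ℝ)| := by
    rw [NNReal.coe_sum]; rfl
  rw [← h2]; exact_mod_cast h1

lemma linf_entry {d : ℕ} (A : Matrix (Fin d) (Fin d) ℤ) (i j : Fin d) : |(A i j : ℝ)| ≤ ‖A‖ :=
  (Finset.single_le_sum (f := fun j => |(A i j : ℝ)|) (fun _ _ => abs_nonneg _) (Finset.mem_univ j)).trans (linf_row A i)

lemma adj_entry {d : ℕ} (A : Matrix (Fin d) (Fin d) ℤ) (hA : 1 ≤ ‖A‖) (i j : Fin d) :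
    |((A.adjugate i j : ℤ) : ℝ)| ≤ d.factorial * ‖A‖ ^ d := by
  rw [Matrix.adjugate_apply]
  have h1 : (((A.updateRow j (Pi.single i 1)).det : ℤ) : ℝ) = ((A.updateRow j (Pi.single i 1)).map (Int.castRingHom ℝ)).det := by
    rw [← RingHom.mapMatrix_apply, ← RingHom.map_det]; rfl
  rw [h1]
  have := Matrix.det_le (A := (A.updateRow j (Pi.single i 1)).map (Int.castRingHom ℝ)) (abv := AbsoluteValue.abs) (x := ‖A‖) (by
    intro a b
    rw [AbsoluteValue.abs_apply, Matrix.map_apply, Matrix.updateRow_apply]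
    split_ifs with h
    · rw [Pi.single_apply]; split_ifs <;> simp <;> linarith
    · exact linf_entry A a b)
  rw [AbsoluteValue.abs_apply] at this
  simpa using this

lemma mk_mdl {S : Type} [CommRing S] {d : ℕ} (b : Module.Basis (Fin d) ℤ S) (f : S →+* ℝ) (hf : Function.Injective f) (x0 : S) :
    ∃ (O : Type) (_ : SeminormedCommRing O) (_ : NormOneClass O) (Md : Mdl O) (y : O), Md.φ y = f x0 := by
  classical
  have hdom : IsDomain S := hf.isDomain f
  have hd : Nonempty (Fin d) := b.index_nonempty
  obtain ⟨F, hF⟩ : ∃ F : S →ₐ[ℤ] Matrix (Fin d) (Fin d) ℤ, F = Algebra.leftMulMatrix b := ⟨_, rfl⟩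
  let inst : SeminormedCommRing S := SeminormedCommRing.induced S (Matrix (Fin d) (Fin d) ℤ) F
  have hnorm : ∀ x : S, ‖x‖ = ‖F x‖ := fun x => rfl
  have hone : NormOneClass S := ⟨by rw [hnorm, map_one]; exact (Matrix.linfty_opNormOneClass).norm_one⟩
  have hev : ∀ (x : S) (j : Fin d), f x * f (b j) = ∑ i, (F x i j : ℝ) * f (b i) := by
    intro x j
    rw [← map_mul, ← b.sum_repr (x * b j), map_sum]
    refine Finset.sum_congr rfl fun i _ => ?_
    rw [hF, Algebra.leftMulMatrix_eq_repr_mul, zsmul_eq_mul, map_mul, map_intCast]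
  obtain ⟨j0, hj0⟩ : ∃ j, f (b j) ≠ 0 := ⟨hd.some, fun h => b.ne_zero hd.some (hf (h.trans (map_zero f).symm))⟩
  have hV : 0 < ∑ i, |f (b i)| := Finset.sum_pos' (fun _ _ => abs_nonneg _) ⟨j0, Finset.mem_univ _, abs_pos.2 hj0⟩
  have hFinj : Function.Injective F := by rw [hF]; exact Algebra.leftMulMatrix_injective b
  refine ⟨S, inst, hone, { k := d * d, ψ := ⟨⟨fun x i => F x (finProdFinEquiv.symm i).1 (finProdFinEquiv.symm i).2, ?_⟩, ?_⟩, inj := ?_, bd := ?_, φ := f, hφ := ?_, liou := ?_ }, x0, rfl⟩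
  · ext i; simp [map_zero]
  · intro x y; ext i; simp [map_add]
  · intro x y hxy
    apply hFinj
    ext i j
    have : F x (finProdFinEquiv.symm (finProdFinEquiv (i, j))).1 (finProdFinEquiv.symm (finProdFinEquiv (i, j))).2 =
      F y (finProdFinEquiv.symm (finProdFinEquiv (i, j))).1 (finProdFinEquiv.symm (finProdFinEquiv (i, j))).2 := congrFun hxy (finProdFinEquiv (i, j))
    rwa [Equiv.symm_apply_apply] at this
  · intro x i
    rw [hnorm]; exact linf_entry _ _ _
  · intro x
    have h1 : |f x| * ∑ j, |f (b j)| ≤ ‖F x‖ * ∑ j, |f (b j)| := by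
      calc |f x| * ∑ j, |f (b j)| = ∑ j, |∑ i, (F x i j : ℝ) * f (b i)| := by
            rw [Finset.mul_sum]; refine Finset.sum_congr rfl fun j _ => ?_
            rw [← hev, abs_mul]
        _ ≤ ∑ j, ∑ i, |(F x i j : ℝ)| * |f (b i)| := by
            refine Finset.sum_le_sum fun j _ => (Finset.abs_sum_le_sum_abs _ _).trans_eq ?_
            exact Finset.sum_congr rfl fun i _ => abs_mul _ _
        _ = ∑ i, (∑ j, |(F x i j : ℝ)|) * |f (b i)| := by
            rw [Finset.sum_comm]; exact Finset.sum_congr rfl fun i _ => (Finset.sum_mul _ _ _).symm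
        _ ≤ ∑ i, ‖F x‖ * |f (b i)| := Finset.sum_le_sum fun i _ => mul_le_mul_of_nonneg_right (linf_row _ i) (abs_nonneg _)
        _ = _ := by rw [Finset.mul_sum]
    rw [hnorm]
    exact le_of_mul_le_mul_right h1 hV
  · refine ⟨d.factorial * (∑ i, |f (b i)|) / |f (b j0)|, d, by positivity, fun x hx => ?_⟩
    rw [hnorm]
    have hdet : (F x).det ≠ 0 := by
      rw [hF, ← Algebra.norm_eq_matrix_det]
      exact fun h => hx ((Algebra.norm_eq_zero_iff_of_basis b).1 h)
    have hdet1 : (1:ℝ) ≤ |((F x).det : ℝ)| := by exact_mod_cast Int.one_le_abs hdet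
    have hN1 : 1 ≤ ‖F x‖ := by
      have : F x ≠ 0 := fun h => hx (hFinj (h.trans (map_zero F).symm))
      obtain ⟨i, hi⟩ := Function.ne_iff.1 this
      obtain ⟨j, hj⟩ := Function.ne_iff.1 hi
      have h1 : (1:ℝ) ≤ |(F x i j : ℝ)| := by exact_mod_cast Int.one_le_abs hj
      exact h1.trans (linf_entry _ _ _)
    have e1 : ((F x).det : ℝ) * f (b j0) = f x * ∑ j, f (b j) * ((F x).adjugate j j0 : ℝ) := by
      have e2 : ∀ i, ∑ j, (F x i j : ℝ) * ((F x).adjugate j j0 : ℝ) = if i = j0 then ((F x).det : ℝ) else 0 := by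
        intro i
        have := congrFun (congrFun (Matrix.mul_adjugate (F x)) i) j0
        rw [Matrix.mul_apply, Matrix.smul_apply, Matrix.one_apply] at this
        have t := congrArg (fun z : ℤ => (z : ℝ)) this
        push_cast at t
        rw [t]
        split_ifs <;> simp
      calc ((F x).det : ℝ) * f (b j0) = ∑ i, f (b i) * (if i = j0 then ((F x).det : ℝ) else 0) := by simp [mul_comm]
        _ = ∑ i, ∑ j, f (b i) * ((F x i j : ℝ) * ((F x).adjugate j j0 : ℝ)) := by
            refine Finset.sum_congr rfl fun i _ => ?_
            rw [← e2, Finset.mul_sum]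
        _ = ∑ j, ∑ i, f (b i) * ((F x i j : ℝ) * ((F x).adjugate j j0 : ℝ)) := Finset.sum_comm
        _ = ∑ j, f x * (f (b j) * ((F x).adjugate j j0 : ℝ)) := by
            refine Finset.sum_congr rfl fun j _ => ?_
            rw [← mul_assoc, hev, Finset.sum_mul]
            exact Finset.sum_congr rfl fun i _ => by ring
        _ = _ := by rw [Finset.mul_sum]
    have e3 : |f (b j0)| ≤ |f x| * (d.factorial * ‖F x‖ ^ d * ∑ j, |f (b j)|) := by
      calc |f (b j0)| ≤ |((F x).det : ℝ)| * |f (b j0)| := le_mul_of_one_le_left (abs_nonneg _) hdet1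
        _ = |f x| * |∑ j, f (b j) * ((F x).adjugate j j0 : ℝ)| := by rw [← abs_mul, e1, abs_mul]
        _ ≤ |f x| * (d.factorial * ‖F x‖ ^ d * ∑ j, |f (b j)|) := by
            refine mul_le_mul_of_nonneg_left ?_ (abs_nonneg _)
            refine (Finset.abs_sum_le_sum_abs _ _).trans ?_
            rw [Finset.mul_sum]
            refine Finset.sum_le_sum fun j _ => ?_
            rw [abs_mul, mul_comm]
            exact mul_le_mul_of_nonneg_right (adj_entry _ hN1 _ _) (abs_nonneg _)
    have hb : 0 < |f (b j0)| := abs_pos.2 hj0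
    rw [div_mul_eq_mul_div, div_mul_eq_mul_div, le_div_iff₀ hb]
    linarith

end mdl

theorem exists_mdl (β : ℝ) (hβ : IsIntegral ℤ β) :
    ∃ (O : Type) (_ : SeminormedCommRing O) (_ : NormOneClass O) (Md : Mdl O) (y : O), Md.φ y = β := by
  have pb := Algebra.adjoin.powerBasis' hβ
  obtain ⟨O, i1, i2, Md, y, hy⟩ := mk_mdl pb.basis (Algebra.adjoin ℤ {β}).val.toRingHom Subtype.val_injective ⟨β, Algebra.subset_adjoin rfl⟩
  exact ⟨O, i1, i2, Md, y, hy⟩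

end Sst


namespace Sst
open Filter Topology
set_option linter.unusedSectionVars false
set_option linter.unusedSimpArgs false
set_option linter.unusedVariables false

lemma cv_mulVec {m n : ℕ} (g : Matrix (Fin m) (Fin n) ℤ) (y : Fin n → ℤ) : cv (g.mulVec y) = (g.map (Int.castRingHom ℝ)).mulVec (cv y) := by
  ext i
  simp [cv, Matrix.mulVec, dotProduct]

lemma cv_smul {n : ℕ} (D : ℤ) (y : Fin n → ℤ) : cv (D • y) = (D : ℝ) • cv y := by
  ext i
  simp [cv]

lemma stepR {n : ℕ} {O : Type*} [SeminormedCommRing O] [NormOneClass O] (Md : Mdl O) (FO : Matrix (Fin 4) (Fin 4) O)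
    (x : ℕ → Fin 4 → ℤ) (hx : ∀ h, x h ≠ 0) (T : ℕ → ℝ) (hT : Tendsto T atTop atTop) (E : ℕ → Fin 4 → ℝ) (Cc : ℝ) (hE : ∀ h i, |E h i| ≤ Cc)
    (C : ℝ) (hF : ∀ h i, |(FO.map Md.φ).mulVec (cv (x h)) i| ≤ C * Real.exp (T h * E h i))
    (g : Matrix (Fin 4) (Fin n) ℤ) (D : ℤ) (hD : D ≠ 0) (hg : ∃ᶠ h in atTop, ∃ y, D • x h = g.mulVec y)
    (r : Fin n → Fin 4) (hdet : (((FO.map Md.φ) * g.map (Int.castRingHom ℝ)).submatrix r id).det ≠ 0)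
    (δ : ℝ) (hδ : 0 < δ) (hs : ∀ h, ∑ i, E h (r i) ≤ - δ) :
    ∃ a : Fin n → ℤ, a ≠ 0 ∧ ∃ᶠ h in atTop, ∃ y, D • x h = g.mulVec y ∧ ∑ u, a u * y u = 0 := by
  obtain ⟨η, hη⟩ : ∃ η : ℝ, η = δ / (2 * (n + 1)) := ⟨_, rfl⟩
  have hη0 : 0 < η := by rw [hη]; positivity
  have h1 : ∀ᶠ h in atTop, |(D : ℝ)| * C ≤ Real.exp (T h * η) :=
    (Real.tendsto_exp_atTop.comp (hT.atTop_mul_const hη0)).eventually_ge_atTop _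
  obtain ⟨s, hsm, hsy⟩ := extraction_of_frequently_atTop (hg.and_eventually h1)
  choose hy hb using hsy
  choose y hy using hy
  have hyne : ∀ h, y h ≠ 0 := by
    intro h h0
    have := hy h
    rw [h0, Matrix.mulVec_zero] at this
    exact hx _ ((smul_eq_zero.1 this).resolve_left hD)
  have hmap : ((FO * g.map (Int.castRingHom O)).submatrix r id).map Md.φ = ((FO.map Md.φ) * g.map (Int.castRingHom ℝ)).submatrix r id := by
    rw [← Matrix.submatrix_map, Matrix.map_mul, Matrix.map_map]
    congr 2
    ext i j
    simp
  obtain ⟨a, ha, hfa⟩ := subsp Md ((FO * g.map (Int.castRingHom O)).submatrix r id)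
    (by rw [RingHom.map_det, RingHom.mapMatrix_apply, hmap]; exact hdet)
    (fun h i => E (s h) (r i) + η) (Cc + η) (fun h i => by
      refine (abs_add_le _ _).trans ?_
      rw [abs_of_pos hη0]; linarith [hE (s h) (r i)]) (δ / 2) (by positivity)
    (fun h => by
      rw [Finset.sum_add_distrib]
      simp only [Finset.sum_const, Finset.card_univ, Fintype.card_fin, nsmul_eq_mul]
      have h2 : (n : ℝ) * η ≤ δ / 2 := by
        rw [hη, mul_div_assoc', div_le_div_iff₀ (by positivity) (by positivity)]; nlinarith
      linarith [hs (s h)]) (fun h => T (s h)) (hT.comp hsm.tendsto_atTop) y hyne (by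
      intro h i
      rw [hmap]
      have e1 : (((FO.map Md.φ) * g.map (Int.castRingHom ℝ)).submatrix r id).mulVec (cv (y h)) i = (D : ℝ) * (FO.map Md.φ).mulVec (cv (x (s h))) (r i) := by
        have e2 : (((FO.map Md.φ) * g.map (Int.castRingHom ℝ)).submatrix r id).mulVec (cv (y h)) i = ((FO.map Md.φ) * g.map (Int.castRingHom ℝ)).mulVec (cv (y h)) (r i) := rfl
        rw [e2, ← Matrix.mulVec_mulVec, ← cv_mulVec, ← hy, cv_smul, Matrix.mulVec_smul]; rfl
      rw [e1, abs_mul]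
      calc |(D : ℝ)| * |(FO.map Md.φ).mulVec (cv (x (s h))) (r i)| ≤ |(D : ℝ)| * (C * Real.exp (T (s h) * E (s h) (r i))) :=
            mul_le_mul_of_nonneg_left (hF _ _) (abs_nonneg _)
        _ = (|(D : ℝ)| * C) * Real.exp (T (s h) * E (s h) (r i)) := by ring
        _ ≤ Real.exp (T (s h) * η) * Real.exp (T (s h) * E (s h) (r i)) := mul_le_mul_of_nonneg_right (hb h) (Real.exp_pos _).le
        _ = _ := by rw [← Real.exp_add]; ring_nf)
  exact ⟨a, ha, hsm.tendsto_atTop.frequently (hfa.mono fun h hh => ⟨y h, hy h, hh⟩)⟩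

lemma param {t : ℕ} (a : Fin (t + 1) → ℤ) (ha : a ≠ 0) : ∃ (D : ℤ) (K : Matrix (Fin (t + 1)) (Fin t) ℤ), D ≠ 0 ∧
    (∀ y, ∑ u, a u * y u = 0 → ∃ z, D • y = K.mulVec z) ∧
    ∀ f : Fin (t + 1) → ℝ, Matrix.vecMul f (K.map (Int.castRingHom ℝ)) = 0 → ∃ ρ : ℝ, ∀ i, f i = ρ * a i := by
  obtain ⟨u, hu⟩ := Function.ne_iff.1 ha
  have hu : a u ≠ 0 := hu
  refine ⟨a u, Matrix.of fun i j => u.insertNth (α := fun _ => ℤ) (- a (u.succAbove j)) (fun k => if k = j then a u else 0) i, hu, ?_, ?_⟩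
  · intro y hy
    refine ⟨fun j => y (u.succAbove j), ?_⟩
    rw [Fin.sum_univ_succAbove _ u] at hy
    ext i
    induction i using u.succAboveCases with
    | x =>
      simp only [Matrix.mulVec, dotProduct, Matrix.of_apply, Fin.insertNth_apply_same, Pi.smul_apply, smul_eq_mul, neg_mul, Finset.sum_neg_distrib]
      linarith
    | p k =>
      simp only [Matrix.mulVec, dotProduct, Matrix.of_apply, Fin.insertNth_apply_succAbove, Pi.smul_apply, smul_eq_mul]
      simp
  · intro f hf
    have hur : (a u : ℝ) ≠ 0 := by exact_mod_cast hu
    refine ⟨f u / a u, fun i => ?_⟩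
    induction i using u.succAboveCases with
    | x => field_simp
    | p k =>
      have := congrFun hf k
      rw [Matrix.vecMul, dotProduct, Fin.sum_univ_succAbove _ u] at this
      simp only [Matrix.map_apply, Matrix.of_apply, Fin.insertNth_apply_same, Fin.insertNth_apply_succAbove, eq_intCast, Pi.zero_apply] at this
      simp at this
      field_simp
      linarith

end Sst


namespace Sst
open Filter Topology
set_option linter.unusedSectionVars false
set_option linter.unusedSimpArgs false
set_option linter.unusedVariables false

lemma dep {n : ℕ} (F : Matrix (Fin 4) (Fin 4) ℝ) (g : Matrix (Fin 4) (Fin n) ℤ) (r : Fin n → Fin 4)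
    (h0 : ((F * g.map (Int.castRingHom ℝ)).submatrix r id).det = 0) :
    ∃ v : Fin n → ℝ, v ≠ 0 ∧ (Matrix.vecMul v (F.submatrix r id * g.map (Int.castRingHom ℝ)) = 0) ∧
      ∀ (D : ℤ) (x : Fin 4 → ℤ) (y : Fin n → ℤ), D ≠ 0 → D • x = g.mulVec y → ∑ i, v i * F.mulVec (cv x) (r i) = 0 := by
  obtain ⟨v, hv, hv0⟩ := Matrix.exists_vecMul_eq_zero_iff.2 h0
  have e0 : (F * g.map (Int.castRingHom ℝ)).submatrix r id = F.submatrix r id * g.map (Int.castRingHom ℝ) := rfl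
  rw [e0] at hv0
  refine ⟨v, hv, hv0, fun D x y hD hxy => ?_⟩
  have e1 : dotProduct v ((F.submatrix r id * g.map (Int.castRingHom ℝ)).mulVec (cv y)) = 0 := by
    rw [Matrix.dotProduct_mulVec, hv0, zero_dotProduct]
  rw [← Matrix.mulVec_mulVec, ← cv_mulVec, ← hxy, cv_smul, Matrix.mulVec_smul, dotProduct_smul, smul_eq_mul] at e1
  exact (mul_eq_zero.1 e1).resolve_left (by exact_mod_cast hD)

lemma unb {f b : ℕ → ℝ} (hf : Tendsto (fun h => |f h|) atTop atTop) (c K : ℝ) (hb : ∀ᶠ h in atTop, |b h| ≤ K)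
    (h : ∃ᶠ h in atTop, b h + c * f h = 0) : c = 0 := by
  by_contra hc
  have hc' : 0 < |c| := abs_pos.2 hc
  have h1 := (hf.const_mul_atTop hc').eventually_gt_atTop K
  obtain ⟨k, h2, h3, h4⟩ := (h.and_eventually (h1.and hb)).exists
  have : b k = - (c * f k) := by linarith
  rw [this, abs_neg, abs_mul] at h4
  linarith

lemma irr_rat {α : ℝ} (hα : Irrational α) (u v : ℤ) (h : α * u = v) : u = 0 ∧ v = 0 := by
  have hu : u = 0 := by
    by_contra hu
    apply hα
    refine ⟨(v : ℚ) / u, ?_⟩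
    push_cast
    have : (u : ℝ) ≠ 0 := by exact_mod_cast hu
    rw [← h]; field_simp
  subst hu
  refine ⟨rfl, ?_⟩
  have : (v : ℝ) = 0 := by rw [← h]; simp
  exact_mod_cast this

set_option maxHeartbeats 1000000 in
theorem M2 (α : ℝ) (hirr : Irrational α) (halg : IsAlgebraic ℚ α) (x : ℕ → Fin 4 → ℤ) (T G H : ℕ → ℝ) (hT : Tendsto T atTop atTop)
    (Cc κ C : ℝ) (hκ : 0 < κ) (hH0 : ∀ h, 0 ≤ H h) (hHG : ∀ h, H h ≤ G h) (hG : ∀ h, G h ≤ Cc)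
    (l0 : ∀ h, α ^ 2 * x h 0 - α * (x h 1 + x h 2) + x h 3 ≠ 0)
    (l1 : ∀ h, |α ^ 2 * x h 0 - α * (x h 1 + x h 2) + x h 3| ≤ C * Real.exp (T h * (- G h - κ)))
    (l2 : ∀ h, |α * x h 0 - x h 1| ≤ C * Real.exp (T h * (- H h)))
    (l3 : ∀ h, |α * x h 0 - x h 2| ≤ C * Real.exp (T h * H h))
    (l4 : ∀ h, |(x h 0 : ℝ)| ≤ C * Real.exp (T h * G h))
    (hinf : Tendsto (fun h => |α * x h 0 - x h 2|) atTop atTop) : False := by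
  classical
  obtain ⟨N, hN, hinteg⟩ := ((IsFractionRing.isAlgebraic_iff ℤ ℚ ℝ).2 halg).exists_integral_multiple
  have hNr : (N : ℝ) ≠ 0 := by exact_mod_cast hN
  have hN1 : (1:ℝ) ≤ |(N : ℝ)| := by exact_mod_cast Int.one_le_abs hN
  have hN2 : (1:ℝ) ≤ (N : ℝ) ^ 2 := by rw [← sq_abs]; nlinarith
  have hN3 : |(N : ℝ)| ≤ (N : ℝ) ^ 2 := by rw [← sq_abs]; nlinarith
  obtain ⟨O, i1, i2, Md, y0, hy0⟩ := exists_mdl _ hinteg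
  rw [zsmul_eq_mul] at hy0
  obtain ⟨FO, hFO⟩ : ∃ FO : Matrix (Fin 4) (Fin 4) O, FO = !![y0 ^ 2, - (N * y0), - (N * y0), (N : O) ^ 2; y0, - N, 0, 0; y0, 0, - N, 0; 1, 0, 0, 0] := ⟨_, rfl⟩
  obtain ⟨F, hF⟩ : ∃ F : Matrix (Fin 4) (Fin 4) ℝ, F = FO.map Md.φ := ⟨_, rfl⟩
  have hF' : F = !![(N * α) ^ 2, - (N * (N * α)), - (N * (N * α)), (N : ℝ) ^ 2; N * α, - N, 0, 0; N * α, 0, - N, 0; 1, 0, 0, 0] := by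
    rw [hF, hFO]
    ext i j
    fin_cases i <;> fin_cases j <;> simp [hy0]
  have f0 : ∀ h, F.mulVec (cv (x h)) 0 = N ^ 2 * (α ^ 2 * x h 0 - α * (x h 1 + x h 2) + x h 3) := by
    intro h; rw [hF']; simp [Matrix.mulVec, dotProduct, Fin.sum_univ_four, cv]; ring
  have f1 : ∀ h, F.mulVec (cv (x h)) 1 = N * (α * x h 0 - x h 1) := by
    intro h; rw [hF']; simp [Matrix.mulVec, dotProduct, Fin.sum_univ_four, cv]; ring
  have f2 : ∀ h, F.mulVec (cv (x h)) 2 = N * (α * x h 0 - x h 2) := by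
    intro h; rw [hF']; simp [Matrix.mulVec, dotProduct, Fin.sum_univ_four, cv]; ring
  have f3 : ∀ h, F.mulVec (cv (x h)) 3 = x h 0 := by
    intro h; rw [hF']; simp [Matrix.mulVec, dotProduct, Fin.sum_univ_four, cv]
  have hxne : ∀ h, x h ≠ 0 := by
    intro h h0; apply l0 h; rw [h0]; simp
  have hG0 : ∀ h, 0 ≤ G h := fun h => (hH0 h).trans (hHG h)
  obtain ⟨E, hE⟩ : ∃ E : ℕ → Fin 4 → ℝ, ∀ h, E h = ![- G h - κ, - H h, H h, G h] := ⟨_, fun _ => rfl⟩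
  have hEb : ∀ h i, |E h i| ≤ Cc + κ := by
    intro h i
    have a1 := hH0 h; have a2 := hHG h; have a3 := hG h
    rw [hE, abs_le]
    fin_cases i <;> simp <;> constructor <;> linarith
  have hFb : ∀ h i, |F.mulVec (cv (x h)) i| ≤ (N ^ 2 * C) * Real.exp (T h * E h i) := by
    have key : ∀ (s z B : ℝ), |s| ≤ (N:ℝ) ^ 2 → |z| ≤ B → |s * z| ≤ N ^ 2 * B := fun s z B h1 h2 => by
      rw [abs_mul]; exact mul_le_mul h1 h2 (abs_nonneg _) (by positivity)
    intro h i
    rw [mul_assoc, hE]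
    fin_cases i
    · show |F.mulVec (cv (x h)) 0| ≤ _
      rw [f0]; exact key _ _ _ (by rw [abs_of_nonneg (by positivity)]) (l1 h)
    · show |F.mulVec (cv (x h)) 1| ≤ _
      rw [f1]; exact key _ _ _ hN3 (l2 h)
    · show |F.mulVec (cv (x h)) 2| ≤ _
      rw [f2]; exact key _ _ _ hN3 (l3 h)
    · show |F.mulVec (cv (x h)) 3| ≤ _
      rw [f3]
      have := key 1 _ _ (by simpa using hN2) (l4 h)
      rwa [one_mul] at this
  have hF0ne : ∀ h, F.mulVec (cv (x h)) 0 ≠ 0 := fun h => by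
    rw [f0]; exact mul_ne_zero (by positivity) (l0 h)
  have hF2inf : Tendsto (fun h => |F.mulVec (cv (x h)) 2|) atTop atTop := by
    simp only [f2, abs_mul]
    exact hinf.const_mul_atTop (by linarith)
  have hC0 : 0 ≤ N ^ 2 * C := by
    by_contra hneg
    push Not at hneg
    have h1 := (abs_nonneg _).trans (hFb 0 0)
    have h2 := mul_neg_of_neg_of_pos hneg (Real.exp_pos (T 0 * E 0 0))
    linarith
  have hbd : ∀ᶠ h in atTop, |F.mulVec (cv (x h)) 0| ≤ N ^ 2 * C ∧ |F.mulVec (cv (x h)) 1| ≤ N ^ 2 * C := by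
    filter_upwards [hT.eventually_ge_atTop 0] with h hh
    have k : ∀ e : ℝ, e ≤ 0 → (N ^ 2 * C) * Real.exp (T h * e) ≤ N ^ 2 * C := fun e he => by
      refine mul_le_of_le_one_right hC0 (Real.exp_le_one_iff.2 ?_)
      exact mul_nonpos_of_nonneg_of_nonpos hh he
    refine ⟨(hFb h 0).trans (k _ ?_), (hFb h 1).trans (k _ ?_)⟩
    · rw [hE]; simp; linarith [hG0 h]
    · rw [hE]; simp; exact hH0 h
  rw [hF] at hFb
  -- t = 4
  have g4 : ∃ᶠ h in atTop, ∃ y, (1:ℤ) • x h = (1 : Matrix (Fin 4) (Fin 4) ℤ).mulVec y :=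
    (Eventually.of_forall fun h => ⟨x h, by rw [Matrix.one_mulVec, one_smul]⟩ : ∀ᶠ h in atTop, _).frequently
  obtain ⟨a, ha, hfa⟩ := stepR Md FO x hxne T hT E _ hEb _ hFb 1 1 one_ne_zero g4 id (by
      rw [← hF]
      have : (F * (1 : Matrix (Fin 4) (Fin 4) ℤ).map (Int.castRingHom ℝ)).submatrix id id = F := by
        rw [Matrix.map_one _ (map_zero _) (map_one _), mul_one]; rfl
      rw [this, hF']
      simp [Matrix.det_succ_row_zero, Fin.sum_univ_succ, Fin.succAbove]
      exact hN) κ hκ (fun h => by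
      rw [hE]; simp [Fin.sum_univ_four]; linarith)
  obtain ⟨D3, K3, hD3, hK3, hK3f⟩ := param a ha
  -- t = 3
  have g3 : ∃ᶠ h in atTop, ∃ y, D3 • x h = K3.mulVec y := hfa.mono fun h => by
    rintro ⟨y, hy, hay⟩
    rw [Matrix.one_mulVec, one_smul] at hy
    subst hy
    exact hK3 _ hay
  obtain ⟨b, hb, hfb⟩ := stepR Md FO x hxne T hT E _ hEb _ hFb K3 D3 hD3 g3 ![0, 1, 2] (by
      rw [← hF]
      intro h0
      obtain ⟨v, hv, hv0, hvx⟩ := dep F K3 _ h0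
      have e2 : v 2 = 0 := by
        refine unb hF2inf (v 2) (|v 0| * (N ^ 2 * C) + |v 1| * (N ^ 2 * C)) (b := fun h => v 0 * F.mulVec (cv (x h)) 0 + v 1 * F.mulVec (cv (x h)) 1) ?_ ?_
        · filter_upwards [hbd] with h hh
          refine (abs_add_le _ _).trans ?_
          rw [abs_mul, abs_mul]
          exact add_le_add (mul_le_mul_of_nonneg_left hh.1 (abs_nonneg _)) (mul_le_mul_of_nonneg_left hh.2 (abs_nonneg _))
        · refine g3.mono fun h => ?_
          rintro ⟨y, hy⟩
          have := hvx _ _ _ hD3 hy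
          rw [Fin.sum_univ_three] at this
          exact this
      rw [← Matrix.vecMul_vecMul] at hv0
      obtain ⟨ρ, hρ⟩ := hK3f _ hv0
      have c0 := hρ 0
      have c1 := hρ 1
      have c2 := hρ 2
      have c3 := hρ 3
      rw [hF'] at c0 c1 c2 c3
      simp [Matrix.vecMul, dotProduct, Fin.sum_univ_three, e2] at c0 c1 c2 c3
      have hρ0 : ρ ≠ 0 := by
        rintro rfl
        apply hv
        have d0 : v 0 = 0 := by
          have : v 0 * (N:ℝ) ^ 2 = 0 := by linarith
          exact (mul_eq_zero.1 this).resolve_right (by positivity)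
        have d1 : v 1 = 0 := by
          rw [d0] at c1
          have : v 1 * (N:ℝ) = 0 := by linarith
          exact (mul_eq_zero.1 this).resolve_right hNr
        ext i; fin_cases i
        · exact d0
        · exact d1
        · exact e2
      have z1 : α * ((-a 3 : ℤ) : ℝ) = (a 2 : ℤ) := by
        have : ρ * (α * ((-a 3 : ℤ) : ℝ)) = ρ * (a 2 : ℤ) := by
          push_cast; rw [← c2]; linear_combination α * c3
        exact mul_left_cancel₀ hρ0 this
      obtain ⟨z3, z2⟩ := irr_rat hirr _ _ z1
      have z3 : a 3 = 0 := by simpa using z3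
      rw [z3] at c3
      have d0 : v 0 = 0 := by
        have : v 0 * (N:ℝ) ^ 2 = 0 := by rw [c3]; simp
        exact (mul_eq_zero.1 this).resolve_right (by positivity)
      rw [d0] at c0 c1
      have z4 : α * ((-a 1 : ℤ) : ℝ) = (a 0 : ℤ) := by
        have : ρ * (α * ((-a 1 : ℤ) : ℝ)) = ρ * (a 0 : ℤ) := by
          push_cast; linear_combination c0 + α * c1
        exact mul_left_cancel₀ hρ0 this
      obtain ⟨z5, z6⟩ := irr_rat hirr _ _ z4
      apply ha
      ext i; fin_cases i
      · exact z6
      · simpa using z5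
      · exact z2
      · exact z3) κ hκ (fun h => by
      rw [hE]; simp [Fin.sum_univ_three]; linarith [hG0 h])
  obtain ⟨D2, K2, hD2, hK2, -⟩ := param b hb
  -- t = 2
  have g2 : ∃ᶠ h in atTop, ∃ y, (D2 * D3) • x h = (K3 * K2).mulVec y := hfb.mono fun h => by
    rintro ⟨y, hy, hay⟩
    obtain ⟨z, hz⟩ := hK2 _ hay
    exact ⟨z, by rw [← Matrix.mulVec_mulVec, ← hz, Matrix.mulVec_smul, ← hy, smul_smul]⟩
  obtain ⟨c, hc, hfc⟩ := stepR Md FO x hxne T hT E _ hEb _ hFb (K3 * K2) (D2 * D3) (mul_ne_zero hD2 hD3) g2 ![0, 2] (by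
      rw [← hF]
      intro h0
      obtain ⟨v, hv, hv0, hvx⟩ := dep F _ _ h0
      have e2 : v 1 = 0 := by
        refine unb hF2inf (v 1) (|v 0| * (N ^ 2 * C)) (b := fun h => v 0 * F.mulVec (cv (x h)) 0) ?_ ?_
        · filter_upwards [hbd] with h hh
          rw [abs_mul]
          exact mul_le_mul_of_nonneg_left hh.1 (abs_nonneg _)
        · refine g2.mono fun h => ?_
          rintro ⟨y, hy⟩
          have := hvx _ _ _ (mul_ne_zero hD2 hD3) hy
          rw [Fin.sum_univ_two] at this
          exact this
      obtain ⟨h, y, hy⟩ := g2.exists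
      have := hvx _ _ _ (mul_ne_zero hD2 hD3) hy
      rw [Fin.sum_univ_two, e2, zero_mul, add_zero] at this
      have d0 := (mul_eq_zero.1 this).resolve_right (hF0ne h)
      apply hv
      ext i; fin_cases i
      · exact d0
      · exact e2) κ hκ (fun h => by
      rw [hE]; simp [Fin.sum_univ_two]; linarith [hHG h])
  obtain ⟨D1, K1, hD1, hK1, -⟩ := param c hc
  -- t = 1
  have g1 : ∃ᶠ h in atTop, ∃ y, (D1 * (D2 * D3)) • x h = ((K3 * K2) * K1).mulVec y := hfc.mono fun h => by
    rintro ⟨y, hy, hay⟩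
    obtain ⟨z, hz⟩ := hK1 _ hay
    exact ⟨z, by rw [← Matrix.mulVec_mulVec, ← hz, Matrix.mulVec_smul, ← hy, smul_smul]⟩
  have hDD := mul_ne_zero hD1 (mul_ne_zero hD2 hD3)
  obtain ⟨d, hd, hfd⟩ := stepR Md FO x hxne T hT E _ hEb _ hFb ((K3 * K2) * K1) (D1 * (D2 * D3)) hDD g1 ![0] (by
      rw [← hF]
      intro h0
      obtain ⟨v, hv, hv0, hvx⟩ := dep F _ _ h0
      obtain ⟨h, y, hy⟩ := g1.exists
      have := hvx _ _ _ hDD hy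
      rw [Fin.sum_univ_one] at this
      have d0 := (mul_eq_zero.1 this).resolve_right (hF0ne h)
      apply hv
      ext i; fin_cases i
      exact d0) κ hκ (fun h => by
      rw [hE]; simp; linarith [hG0 h])
  obtain ⟨h, y, hy, hdy⟩ := hfd.exists
  rw [Fin.sum_univ_one] at hdy
  have hd0 : d 0 ≠ 0 := by
    intro h; apply hd; ext i; fin_cases i; exact h
  have hy0 : y = 0 := by
    ext i; fin_cases i; exact (mul_eq_zero.1 hdy).resolve_left hd0
  rw [hy0, Matrix.mulVec_zero] at hy
  exact hxne h ((smul_eq_zero.1 hy).resolve_left hDD)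

end Sst


namespace Sst
open Filter Topology
set_option linter.unusedSectionVars false
set_option linter.unusedSimpArgs false
set_option linter.unusedVariables false

section cf
variable (a : ℕ → ℕ)

lemma cfQ_succ (k : ℕ) : (cfQ a (k + 2) : ℝ) = a (k + 1) * cfQ a (k + 1) + cfQ a k := by
  rw [cfQ]; push_cast; ring

lemma cfP_succ (k : ℕ) : (cfP a (k + 2) : ℝ) = a (k + 1) * cfP a (k + 1) + cfP a k := by
  rw [cfP]; push_cast; ring

lemma cf_det (k : ℕ) : (cfP a (k + 1) : ℝ) * cfQ a k - cfP a k * cfQ a (k + 1) = (-1) ^ k := by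
  induction k with
  | zero => simp [cfP, cfQ]
  | succ k ih => rw [cfQ_succ, cfP_succ, pow_succ, ← ih]; ring

lemma cfQ_pos (hpos : ∀ i, 0 < a i) : ∀ k, 0 < cfQ a k
  | 0 => by simp [cfQ]
  | 1 => by simpa [cfQ] using hpos 0
  | k + 2 => by rw [cfQ]; have := cfQ_pos hpos k; omega

lemma cfQ_mono (hpos : ∀ i, 0 < a i) : Monotone (cfQ a) := by
  refine monotone_nat_of_le_succ fun k => ?_
  cases k with
  | zero => simpa [cfQ] using Nat.succ_le_of_lt (hpos 0)
  | succ k => rw [show k + 1 + 1 = k + 2 from rfl, cfQ]; nlinarith [hpos (k + 1), cfQ_pos a hpos k, cfQ_pos a hpos (k + 1)]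

lemma cfQ_two (hpos : ∀ i, 0 < a i) (k : ℕ) : 2 * cfQ a k ≤ cfQ a (k + 2) := by
  rw [cfQ]
  have h1 := cfQ_mono a hpos (Nat.le_succ k)
  have h2 : cfQ a (k + 1) ≤ a (k + 1) * cfQ a (k + 1) := Nat.le_mul_of_pos_left _ (hpos _)
  simp at h1
  omega

lemma cfQ_grow2 (hpos : ∀ i, 0 < a i) (k j : ℕ) : 2 ^ j * cfQ a k ≤ cfQ a (k + 2 * j) := by
  induction j with
  | zero => simp
  | succ j ih =>
    have := cfQ_two a hpos (k + 2 * j)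
    rw [show k + 2 * (j + 1) = k + 2 * j + 2 by ring, pow_succ]
    linarith

lemma cfQ_grow (hpos : ∀ i, 0 < a i) (k l : ℕ) : 2 ^ (l / 2) * cfQ a k ≤ cfQ a (k + l) :=
  (cfQ_grow2 a hpos k (l / 2)).trans (cfQ_mono a hpos (by omega))

lemma cf_e (hpos : ∀ i, 0 < a i) (α : ℝ) (hα : Tendsto (fun ℓ => (cfP a ℓ : ℝ) / (cfQ a ℓ : ℝ)) atTop (𝓝 α)) :
    ∃ e : ℕ → ℝ, (∀ k, cfQ a k * α - cfP a k = (-1) ^ k * e k) ∧ (∀ k, 0 < e k) ∧ (∀ k, e k = a (k + 1) * e (k + 1) + e (k + 2)) ∧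
      ∀ k, cfQ a (k + 1) * e k + cfQ a k * e (k + 1) = 1 := by
  have hq : ∀ k, (0:ℝ) < cfQ a k := fun k => by exact_mod_cast cfQ_pos a hpos k
  have sq : ∀ k, ((-1 : ℝ) ^ k) * (-1) ^ k = 1 := fun k => by rw [← mul_pow]; simp
  refine ⟨fun k => (-1) ^ k * (cfQ a k * α - cfP a k), fun k => ?_, fun k => ?_, fun k => ?_, fun k => ?_⟩
  · rw [← mul_assoc, sq, one_mul]
  · obtain ⟨v, hv⟩ : ∃ v : ℕ → ℝ, ∀ j, v j = (-1) ^ k * ((cfP a (k + 2 * j) : ℝ) / cfQ a (k + 2 * j)) := ⟨_, fun _ => rfl⟩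
    have hmono : StrictMono v := by
      refine strictMono_nat_of_lt_succ fun j => ?_
      rw [hv, hv, show k + 2 * (j + 1) = k + 2 * j + 2 by ring, ← sub_pos, ← mul_sub,
        div_sub_div _ _ (hq _).ne' (hq _).ne', cfP_succ]
      have h1 : ((a (k + 2 * j + 1) : ℝ) * cfP a (k + 2 * j + 1) + cfP a (k + 2 * j)) * cfQ a (k + 2 * j) - cfQ a (k + 2 * j + 2) * cfP a (k + 2 * j)
          = a (k + 2 * j + 1) * (-1) ^ k := by
        rw [cfQ_succ]
        have := cf_det a (k + 2 * j)
        rw [pow_add, pow_mul] at this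
        simp only [neg_one_sq, one_pow, mul_one] at this
        rw [← this]; ring
      rw [h1, mul_div_assoc', mul_left_comm, sq, mul_one]
      have := hq (k + 2 * j); have := hq (k + 2 * j + 2)
      have : (0:ℝ) < a (k + 2 * j + 1) := by exact_mod_cast hpos _
      positivity
    have hlim : Tendsto v atTop (𝓝 ((-1) ^ k * α)) := by
      have : Tendsto (fun j : ℕ => k + 2 * j) atTop atTop := tendsto_atTop_mono (fun j => (by omega : j ≤ k + 2 * j)) tendsto_id
      refine ((hα.comp this).const_mul ((-1 : ℝ) ^ k)).congr fun j => ?_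
      rw [hv]; rfl
    have h1 := (hmono (Nat.lt_succ_self 0)).trans_le (hmono.monotone.ge_of_tendsto hlim 1)
    rw [hv] at h1
    simp only [mul_zero, add_zero] at h1
    have h2 : (0:ℝ) < cfQ a k * ((-1) ^ k * α - (-1) ^ k * ((cfP a k : ℝ) / cfQ a k)) := mul_pos (hq k) (by linarith)
    have h3 : (cfQ a k : ℝ) * ((-1) ^ k * α - (-1) ^ k * ((cfP a k : ℝ) / cfQ a k)) = (-1) ^ k * (cfQ a k * α - cfP a k) := by
      have := (hq k).ne'
      field_simp
    linarith
  · simp only []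
    rw [cfQ_succ, cfP_succ, pow_add, pow_add]; ring
  · simp only []
    have h := cf_det a k
    have h2 := sq k
    rw [pow_succ]
    linear_combination ((-1 : ℝ) ^ k) * h + h2

lemma cf_irr (hpos : ∀ i, 0 < a i) (α : ℝ) (hα : Tendsto (fun ℓ => (cfP a ℓ : ℝ) / (cfQ a ℓ : ℝ)) atTop (𝓝 α)) : Irrational α := by
  obtain ⟨e, he, he0, -, he1⟩ := cf_e a hpos α hα
  have hq : ∀ k, (0:ℝ) < cfQ a k := fun k => by exact_mod_cast cfQ_pos a hpos k
  rintro ⟨r, rfl⟩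
  obtain ⟨k, hk⟩ := pow_unbounded_of_one_lt (r.den : ℝ) one_lt_two
  have h1 : (2:ℝ) ^ k ≤ cfQ a (2 * k + 1) := by
    have := cfQ_grow a hpos 0 (2 * k + 1)
    rw [show (2 * k + 1) / 2 = k by omega, show cfQ a 0 = 1 from rfl, mul_one, zero_add] at this
    exact_mod_cast this
  have h2 := he (2 * k)
  rw [pow_mul, neg_one_sq, one_pow, one_mul] at h2
  have hd : (0:ℝ) < r.den := by exact_mod_cast r.pos
  have h3 : (r.den : ℝ) * e (2 * k) = ((cfQ a (2 * k) * r.num - cfP a (2 * k) * r.den : ℤ) : ℝ) := by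
    rw [← h2]
    have : (r : ℝ) * r.den = r.num := by exact_mod_cast Rat.mul_den_eq_num r
    push_cast
    rw [← this]; ring
  have h4 : (0:ℝ) < r.den * e (2 * k) := mul_pos hd (he0 _)
  have h5 : (r.den : ℝ) * e (2 * k) < 1 := by
    have := he1 (2 * k)
    have h6 := mul_pos (hq (2 * k)) (he0 (2 * k + 1))
    have h7 : (r.den : ℝ) * e (2 * k) < cfQ a (2 * k + 1) * e (2 * k) := mul_lt_mul_of_pos_right (hk.trans_le h1) (he0 _)
    linarith
  rw [h3] at h4 h5
  have h4' : 0 < (cfQ a (2 * k) * r.num - cfP a (2 * k) * r.den : ℤ) := by exact_mod_cast h4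
  have h5' : (cfQ a (2 * k) * r.num - cfP a (2 * k) * r.den : ℤ) < 1 := by exact_mod_cast h5
  omega

end cf

section per
variable (a : ℕ → ℕ)

lemma W_step (e : ℕ → ℝ) (her : ∀ k, e k = a (k + 1) * e (k + 1) + e (k + 2)) (k k' : ℕ) (h : a (k + 1) = a (k' + 1)) :
    e k * e (k' + 1) - e (k + 1) * e k' = - (e (k + 1) * e (k' + 2) - e (k + 2) * e (k' + 1)) := by
  rw [her k, her k', h]; ring

lemma W_iter (e : ℕ → ℝ) (her : ∀ k, e k = a (k + 1) * e (k + 1) + e (k + 2)) (u S l : ℕ) (h : ∀ i < l, a (u + i + 1) = a (u + S + i + 1)) :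
    |e u * e (u + S + 1) - e (u + 1) * e (u + S)| = |e (u + l) * e (u + S + l + 1) - e (u + l + 1) * e (u + S + l)| := by
  induction l with
  | zero => simp
  | succ l ih =>
    rw [ih fun i hi => h i (by omega), W_step a e her (u + l) (u + S + l) (h l (by omega)), abs_neg]
    rfl

lemma e_anti (hpos : ∀ i, 0 < a i) (e : ℕ → ℝ) (he0 : ∀ k, 0 < e k) (her : ∀ k, e k = a (k + 1) * e (k + 1) + e (k + 2)) (k : ℕ) : e (k + 1) < e k := by
  rw [her k]
  have h1 : (1:ℝ) ≤ a (k + 1) := by exact_mod_cast hpos (k + 1)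
  nlinarith [he0 (k + 1), he0 (k + 2)]

lemma W_ne (hpos : ∀ i, 0 < a i) (e : ℕ → ℝ) (he0 : ∀ k, 0 < e k) (her : ∀ k, e k = a (k + 1) * e (k + 1) + e (k + 2)) (hper : ¬ EventuallyPeriodic a) (u S : ℕ) (hS : 0 < S) : e u * e (u + S + 1) - e (u + 1) * e (u + S) ≠ 0 := by
  intro h0
  have key : ∀ k k', e k * e (k' + 1) - e (k + 1) * e k' = 0 → a (k + 1) = a (k' + 1) := by
    intro k k' h
    rw [her k, her k'] at h
    have h1 : ((a (k + 1) : ℝ) - a (k' + 1)) * (e (k + 1) * e (k' + 1)) = e (k + 1) * e (k' + 2) - e (k + 2) * e (k' + 1) := by linarith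
    have hP : 0 < e (k + 1) * e (k' + 1) := mul_pos (he0 _) (he0 _)
    have b1 : e (k + 1) * e (k' + 2) < e (k + 1) * e (k' + 1) := mul_lt_mul_of_pos_left (e_anti a hpos e he0 her (k' + 1)) (he0 _)
    have b2 : e (k + 2) * e (k' + 1) < e (k + 1) * e (k' + 1) := mul_lt_mul_of_pos_right (e_anti a hpos e he0 her (k + 1)) (he0 _)
    have b3 := mul_pos (he0 (k + 1)) (he0 (k' + 2))
    have b4 := mul_pos (he0 (k + 2)) (he0 (k' + 1))
    have c1 : ((a (k + 1) : ℝ) - a (k' + 1)) < 1 := by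
      by_contra hc; push Not at hc; nlinarith
    have c2 : (-1 : ℝ) < ((a (k + 1) : ℝ) - a (k' + 1)) := by
      by_contra hc; push Not at hc; nlinarith
    have d1 : (a (k + 1) : ℝ) < a (k' + 1) + 1 := by linarith
    have d2 : (a (k' + 1) : ℝ) < a (k + 1) + 1 := by linarith
    have d1' : a (k + 1) < a (k' + 1) + 1 := by exact_mod_cast d1
    have d2' : a (k' + 1) < a (k + 1) + 1 := by exact_mod_cast d2
    omega
  have all : ∀ i, e (u + i) * e (u + S + i + 1) - e (u + i + 1) * e (u + S + i) = 0 := by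
    intro i
    induction i with
    | zero => exact h0
    | succ i ih =>
      rw [W_step a e her _ _ (key _ _ ih)] at ih
      exact neg_eq_zero.1 ih
  apply hper
  refine ⟨u + 1, S, hS, fun n hn => ?_⟩
  have := key _ _ (all (n - (u + 1)))
  rw [show u + (n - (u + 1)) + 1 = n by omega, show u + S + (n - (u + 1)) + 1 = n + S by omega] at this
  exact this.symm

end per
end Sst


namespace Sst
open Filter Topology
set_option linter.unusedSectionVars false
set_option linter.unusedSimpArgs false
set_option linter.unusedVariables false

lemma w_gt (a : ℕ → ℕ) (hpos : ∀ i, 0 < a i) (B : ℝ) (hB : ∀ ℓ : ℕ, 1 ≤ ℓ → (cfQ a ℓ : ℝ) ^ (1 / (ℓ : ℝ)) ≤ B)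
    (w w' : ℝ) (hw' : 0 ≤ w')
    (hineq : w > (2 * w' + 1) * (Real.log (limsup (fun ℓ : ℕ => (cfQ a ℓ : ℝ) ^ (1 / (ℓ : ℝ))) atTop) /
      Real.log (liminf (fun ℓ : ℕ => (cfQ a ℓ : ℝ) ^ (1 / (ℓ : ℝ))) atTop)) - w') : 1 < w := by
  obtain ⟨f, hf⟩ : ∃ f : ℕ → ℝ, f = fun ℓ : ℕ => (cfQ a ℓ : ℝ) ^ (1 / (ℓ : ℝ)) := ⟨_, rfl⟩
  rw [← hf] at hineq
  have hub : ∀ᶠ l in atTop, f l ≤ B := by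
    filter_upwards [eventually_ge_atTop 1] with l hl
    rw [hf]; exact hB l hl
  have hlb : ∀ᶠ l in atTop, (2:ℝ) ^ (1 / 4 : ℝ) ≤ f l := by
    filter_upwards [eventually_ge_atTop 2] with l hl
    rw [hf]
    have hl0 : (0:ℝ) < l := by exact_mod_cast (by omega : 0 < l)
    have h1 : (2:ℝ) ^ (l / 2) ≤ cfQ a l := by
      have := cfQ_grow a hpos 0 l
      rw [show cfQ a 0 = 1 from rfl, mul_one, zero_add] at this
      exact_mod_cast this
    have h2 : (l : ℝ) * (1 / 4) ≤ ((l / 2 : ℕ) : ℝ) := by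
      have : (l : ℝ) ≤ 4 * ((l / 2 : ℕ) : ℝ) := by exact_mod_cast (by omega : l ≤ 4 * (l / 2))
      linarith
    have h3 : (2:ℝ) ^ ((1 / 4 : ℝ) * l) ≤ cfQ a l := by
      calc (2:ℝ) ^ ((1 / 4 : ℝ) * l) ≤ (2:ℝ) ^ (((l / 2 : ℕ) : ℝ)) := Real.rpow_le_rpow_of_exponent_le one_le_two (by linarith)
        _ = (2:ℝ) ^ (l / 2) := Real.rpow_natCast _ _
        _ ≤ _ := h1
    calc (2:ℝ) ^ (1 / 4 : ℝ) = ((2:ℝ) ^ ((1 / 4 : ℝ) * l)) ^ (1 / (l : ℝ)) := by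
          rw [← Real.rpow_mul (by norm_num)]; congr 1; field_simp
      _ ≤ _ := Real.rpow_le_rpow (by positivity) h3 (by positivity)
  have hba : IsBoundedUnder (· ≤ ·) atTop f := ⟨B, hub⟩
  have hbb : IsBoundedUnder (· ≥ ·) atTop f := ⟨_, hlb⟩
  have hm : (2:ℝ) ^ (1 / 4 : ℝ) ≤ liminf f atTop := le_liminf_of_le hba.isCoboundedUnder_ge hlb
  have hmM : liminf f atTop ≤ limsup f atTop := liminf_le_limsup hba hbb
  have h1 : (1:ℝ) < (2:ℝ) ^ (1 / 4 : ℝ) := Real.one_lt_rpow one_lt_two (by norm_num)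
  have h2 : 0 < Real.log (liminf f atTop) := Real.log_pos (by linarith)
  have h3 : 1 ≤ Real.log (limsup f atTop) / Real.log (liminf f atTop) := by
    rw [le_div_iff₀ h2, one_mul]
    exact Real.log_le_log (by linarith) hmM
  nlinarith

set_option maxHeartbeats 1000000 in
theorem main (a : ℕ → ℕ) (hpos : ∀ i, 0 < a i) (α : ℝ)
    (hα : Tendsto (fun ℓ => (cfP a ℓ : ℝ) / (cfQ a ℓ : ℝ)) atTop (𝓝 α))
    (B : ℝ) (hB : ∀ ℓ : ℕ, 1 ≤ ℓ → (cfQ a ℓ : ℝ) ^ (1 / (ℓ : ℝ)) ≤ B)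
    (w w' : ℝ) (hw : 1 < w) (hw' : 0 ≤ w') (hcond : ConditionStarStar a w w') (halg : IsAlgebraic ℚ α) : False := by
  obtain ⟨hper, U, V, hV, hmono, hUV, hpre⟩ := hcond
  obtain ⟨e, he, he0, her, he1⟩ := cf_e a hpos α hα
  obtain ⟨q, hq⟩ : ∃ q : ℕ → ℝ, ∀ k, q k = cfQ a k := ⟨_, fun _ => rfl⟩
  have hq1 : ∀ k, (1:ℝ) ≤ q k := fun k => by rw [hq]; exact_mod_cast cfQ_pos a hpos k
  have hq0 : ∀ k, (0:ℝ) < q k := fun k => by linarith [hq1 k]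
  have hqm : ∀ k l, k ≤ l → q k ≤ q l := fun k l h => by rw [hq, hq]; exact_mod_cast cfQ_mono a hpos h
  have hqg : ∀ k l, (2:ℝ) ^ (l / 2) * q k ≤ q (k + l) := fun k l => by
    rw [hq, hq]; exact_mod_cast cfQ_grow a hpos k l
  simp only [← hq] at he he1
  have hlogq : ∀ k, Real.log (q k) ≤ k * |Real.log B| := by
    intro k
    rcases Nat.eq_zero_or_pos k with rfl | hk
    · rw [hq, show cfQ a 0 = 1 from rfl]; simp
    · have h1 := hB k hk
      rw [← hq] at h1
      have hk0 : (0:ℝ) < k := by exact_mod_cast hk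
      have h2 := Real.log_le_log (Real.rpow_pos_of_pos (hq0 k) _) h1
      rw [Real.log_rpow (hq0 k)] at h2
      have h3 : Real.log (q k) ≤ k * Real.log B := by
        rw [one_div, inv_mul_le_iff₀ hk0] at h2; exact h2
      exact h3.trans (mul_le_mul_of_nonneg_left (le_abs_self _) hk0.le)
  obtain ⟨u, hu⟩ : ∃ u : ℕ → ℕ, ∀ n, u n = (U n).length := ⟨_, fun _ => rfl⟩
  obtain ⟨S, hS⟩ : ∃ S : ℕ → ℕ, ∀ n, S n = (V n).length := ⟨_, fun _ => rfl⟩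
  have hSpos : ∀ n, 0 < S n := fun n => by rw [hS]; exact List.length_pos_iff.2 (hV n)
  have hSn : ∀ n, n ≤ S n := fun n => by rw [hS]; exact hmono.id_le n
  have huS : ∀ n, (u n : ℝ) ≤ w' * S n := fun n => by rw [hu, hS]; exact hUV n
  have hSr : ∀ n, (1:ℝ) ≤ S n := fun n => by exact_mod_cast hSpos n
  obtain ⟨l, hl⟩ : ∃ l : ℕ → ℕ, ∀ n, l n = ⌈w * S n⌉₊ - S n - 1 := ⟨_, fun _ => rfl⟩
  have hrep : ∀ n, ∀ i < l n, a (u n + i + 1) = a (u n + S n + i + 1) := by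
    intro n i hi
    rw [hl] at hi
    have hb := (hpre n).2
    rw [BeginsWithPow] at hb
    simp only [← hu, ← hS] at hb
    have h1 := hb (i + 1) (by omega)
    have h2 := hb (i + 1 + S n) (by omega)
    rw [Nat.add_mod_right, h1] at h2
    have h3 := Option.some.inj h2
    rw [show u n + i + 1 = u n + (i + 1) by ring, show u n + S n + i + 1 = u n + (i + 1 + S n) by ring]
    exact h3
  have hlow : ∀ n, (w - 1) * S n - 1 ≤ l n := by
    intro n
    have h1 : w * S n ≤ (⌈w * S n⌉₊ : ℝ) := Nat.le_ceil _
    have h2 : (⌈w * S n⌉₊ : ℝ) ≤ l n + S n + 1 := by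
      have : ⌈w * S n⌉₊ ≤ l n + S n + 1 := by rw [hl]; omega
      exact_mod_cast this
    linarith
  have heq : ∀ k, e k ≤ 1 / q (k + 1) := by
    intro k
    rw [le_div_iff₀ (hq0 _)]
    have := he1 k
    have := mul_pos (hq0 k) (he0 (k + 1))
    linarith
  have heq2 : ∀ k, 1 / (2 * q (k + 1)) ≤ e k := by
    intro k
    have h2 := hq0 (k + 1)
    rw [div_le_iff₀ (by positivity)]
    have h1 := he1 k
    have : q k * e (k + 1) ≤ q (k + 1) * e k := mul_le_mul (hqm _ _ (Nat.le_succ k)) (e_anti a hpos e he0 her k).le (he0 _).le (hq0 _).le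
    linarith
  have he1' : ∀ k, e (k + 1) ≤ 1 / q (k + 1) := fun k => (e_anti a hpos e he0 her k).le.trans (heq k)
  have sg : ∀ k, |((-1 : ℝ) ^ k)| = 1 := fun k => by simp
  obtain ⟨x, hx⟩ : ∃ x : ℕ → Fin 4 → ℤ, ∀ n, x n =
      ![(cfQ a (u n) * cfQ a (u n + S n + 1) - cfQ a (u n + 1) * cfQ a (u n + S n) : ℤ),
        (cfQ a (u n) * cfP a (u n + S n + 1) - cfQ a (u n + 1) * cfP a (u n + S n) : ℤ),
        (cfP a (u n) * cfQ a (u n + S n + 1) - cfP a (u n + 1) * cfQ a (u n + S n) : ℤ),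
        (cfP a (u n) * cfP a (u n + S n + 1) - cfP a (u n + 1) * cfP a (u n + S n) : ℤ)] := ⟨_, fun _ => rfl⟩
  have x0 : ∀ n, (x n 0 : ℝ) = q (u n) * q (u n + S n + 1) - q (u n + 1) * q (u n + S n) := fun n => by
    rw [hx]; simp [hq]
  have x1 : ∀ n, (x n 1 : ℝ) = q (u n) * cfP a (u n + S n + 1) - q (u n + 1) * cfP a (u n + S n) := fun n => by
    rw [hx]; simp [hq]
  have x2 : ∀ n, (x n 2 : ℝ) = cfP a (u n) * q (u n + S n + 1) - cfP a (u n + 1) * q (u n + S n) := fun n => by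
    rw [hx]; simp [hq]
  have x3 : ∀ n, (x n 3 : ℝ) = (cfP a (u n) : ℝ) * cfP a (u n + S n + 1) - cfP a (u n + 1) * cfP a (u n + S n) := fun n => by
    rw [hx]; simp [hq]
  have L1 : ∀ n, α ^ 2 * x n 0 - α * (x n 1 + x n 2) + x n 3 = (-1) ^ (S n + 1) * (e (u n) * e (u n + S n + 1) - e (u n + 1) * e (u n + S n)) := by
    intro n
    rw [x0, x1, x2, x3]
    have h1 := he (u n); have h2 := he (u n + 1); have h3 := he (u n + S n); have h4 := he (u n + S n + 1)
    have e1 : α ^ 2 * (q (u n) * q (u n + S n + 1) - q (u n + 1) * q (u n + S n)) -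
        α * (q (u n) * cfP a (u n + S n + 1) - q (u n + 1) * cfP a (u n + S n) + (cfP a (u n) * q (u n + S n + 1) - cfP a (u n + 1) * q (u n + S n))) +
        ((cfP a (u n) : ℝ) * cfP a (u n + S n + 1) - cfP a (u n + 1) * cfP a (u n + S n)) =
        (q (u n) * α - cfP a (u n)) * (q (u n + S n + 1) * α - cfP a (u n + S n + 1)) -
        (q (u n + 1) * α - cfP a (u n + 1)) * (q (u n + S n) * α - cfP a (u n + S n)) := by ring
    rw [e1, h1, h2, h3, h4]
    have sq : ((-1 : ℝ) ^ (u n)) * (-1) ^ (u n) = 1 := by rw [← mul_pow]; simp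
    rw [pow_succ, pow_succ, pow_succ, pow_add]
    linear_combination (-(-1 : ℝ) ^ (S n) * (e (u n) * e (u n + S n + 1) - e (u n + 1) * e (u n + S n))) * sq
  have L2 : ∀ n, α * x n 0 - x n 1 = (-1) ^ (u n + S n + 1) * (q (u n) * e (u n + S n + 1) + q (u n + 1) * e (u n + S n)) := by
    intro n
    rw [x0, x1]
    have h3 := he (u n + S n); have h4 := he (u n + S n + 1)
    rw [pow_succ] at h4 ⊢
    linear_combination q (u n) * h4 - q (u n + 1) * h3
  have L3 : ∀ n, α * x n 0 - x n 2 = (-1) ^ (u n) * (e (u n) * q (u n + S n + 1) + e (u n + 1) * q (u n + S n)) := by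
    intro n
    rw [x0, x2]
    have h3 := he (u n); have h4 := he (u n + 1)
    rw [pow_succ] at h4
    linear_combination q (u n + S n + 1) * h3 - q (u n + S n) * h4
  obtain ⟨G, hG⟩ : ∃ G : ℕ → ℝ, ∀ n, G n = Real.log (q (u n + 1) * q (u n + S n + 1)) / S n := ⟨_, fun _ => rfl⟩
  obtain ⟨H, hH⟩ : ∃ H : ℕ → ℝ, ∀ n, H n = Real.log (q (u n + S n + 1) / q (u n + 1)) / S n := ⟨_, fun _ => rfl⟩
  have hS0 : ∀ n, (0:ℝ) < S n := fun n => by linarith [hSr n]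
  have hQ0 : ∀ n, 0 < q (u n + 1) * q (u n + S n + 1) := fun n => mul_pos (hq0 _) (hq0 _)
  have hP0 : ∀ n, 0 < q (u n + S n + 1) / q (u n + 1) := fun n => div_pos (hq0 _) (hq0 _)
  have expG : ∀ n, Real.exp (S n * G n) = q (u n + 1) * q (u n + S n + 1) := fun n => by
    rw [hG, mul_div_cancel₀ _ (hS0 n).ne', Real.exp_log (hQ0 n)]
  have expH : ∀ n, Real.exp (S n * H n) = q (u n + S n + 1) / q (u n + 1) := fun n => by
    rw [hH, mul_div_cancel₀ _ (hS0 n).ne', Real.exp_log (hP0 n)]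
  refine M2 α (cf_irr a hpos α hα) halg x (fun n => S n) G H ?_ ((2 * w' + 3) * |Real.log B|) ((w - 1) * Real.log 2) 8
    (mul_pos (by linarith) (Real.log_pos one_lt_two)) ?_ ?_ ?_ ?_ ?_ ?_ ?_ ?_ ?_
  · exact tendsto_natCast_atTop_atTop.comp (tendsto_atTop_mono hSn tendsto_id)
  · intro n
    rw [hH]
    refine div_nonneg (Real.log_nonneg ?_) (hS0 n).le
    rw [le_div_iff₀ (hq0 _), one_mul]
    exact hqm _ _ (by omega)
  · intro n
    rw [hH, hG]
    refine div_le_div_of_nonneg_right (Real.log_le_log (hP0 n) ?_) (hS0 n).le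
    have h1 := hq1 (u n + 1)
    rw [div_le_iff₀ (hq0 _)]
    have h2 := hq0 (u n + S n + 1)
    nlinarith [mul_le_mul h1 h1 (by norm_num) (by linarith)]
  · intro n
    rw [hG, div_le_iff₀ (hS0 n), Real.log_mul (hq0 _).ne' (hq0 _).ne']
    have h1 := hlogq (u n + 1)
    have h2 := hlogq (u n + S n + 1)
    push_cast at h1 h2
    have h3 := abs_nonneg (Real.log B)
    have h4 : (u n : ℝ) + 1 + (u n + S n + 1) ≤ (2 * w' + 3) * S n := by nlinarith [huS n, hSr n]
    have h5 := mul_le_mul_of_nonneg_right h4 h3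
    linarith
  · intro n
    rw [L1]
    exact mul_ne_zero (pow_ne_zero _ (by norm_num)) (W_ne a hpos e he0 her hper _ _ (hSpos n))
  · intro n
    rw [L1, abs_mul, sg, one_mul, W_iter a e her (u n) (S n) (l n) (hrep n)]
    have b1 : e (u n + l n) ≤ 1 / q (u n + 1 + l n) := by
      have := heq (u n + l n); rwa [show u n + l n + 1 = u n + 1 + l n by ring] at this
    have b2 : e (u n + l n + 1) ≤ 1 / q (u n + 1 + l n) := by
      have := he1' (u n + l n); rwa [show u n + l n + 1 = u n + 1 + l n by ring] at this ⊢
    have b3 : e (u n + S n + l n) ≤ 1 / q (u n + S n + 1 + l n) := by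
      have := heq (u n + S n + l n); rwa [show u n + S n + l n + 1 = u n + S n + 1 + l n by ring] at this
    have b4 : e (u n + S n + l n + 1) ≤ 1 / q (u n + S n + 1 + l n) := by
      have := he1' (u n + S n + l n); rwa [show u n + S n + l n + 1 = u n + S n + 1 + l n by ring] at this ⊢
    obtain ⟨z, hz⟩ : ∃ z : ℝ, z = (2:ℝ) ^ (l n / 2) := ⟨_, rfl⟩
    have hz0 : 0 < z := by rw [hz]; positivity
    have c1 : 1 / q (u n + 1 + l n) ≤ 1 / (z * q (u n + 1)) :=
      one_div_le_one_div_of_le (mul_pos hz0 (hq0 _)) (by rw [hz]; exact hqg _ _)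
    have c2 : 1 / q (u n + S n + 1 + l n) ≤ 1 / (z * q (u n + S n + 1)) :=
      one_div_le_one_div_of_le (mul_pos hz0 (hq0 _)) (by rw [hz]; exact hqg _ _)
    have d : ∀ s t, 0 < s → 0 < t → s ≤ 1 / q (u n + 1 + l n) → t ≤ 1 / q (u n + S n + 1 + l n) →
        s * t ≤ (z * z)⁻¹ * (q (u n + 1) * q (u n + S n + 1))⁻¹ := by
      intro s t hs ht h1 h2
      have := mul_le_mul (h1.trans c1) (h2.trans c2) ht.le (by have := hq0 (u n + 1); positivity)
      refine this.trans_eq ?_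
      rw [one_div, one_div, mul_inv, mul_inv, mul_inv, mul_inv]; ring
    have d1 := d _ _ (he0 _) (he0 _) b1 b4
    have d2 := d _ _ (he0 _) (he0 _) b2 b3
    have hzz : (z * z)⁻¹ ≤ 4 * Real.exp (- (S n * ((w - 1) * Real.log 2))) := by
      have h1 : Real.exp (S n * ((w - 1) * Real.log 2)) ≤ 4 * (z * z) := by
        have e1 : 4 * (z * z) = (2:ℝ) ^ ((2 + (l n / 2 + l n / 2) : ℕ) : ℝ) := by
          rw [Real.rpow_natCast, pow_add, pow_add, hz]; norm_num
        rw [e1, Real.rpow_def_of_pos two_pos]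
        apply Real.exp_le_exp.2
        have h3 : (l n : ℝ) + 1 ≤ ((2 + (l n / 2 + l n / 2) : ℕ) : ℝ) := by exact_mod_cast (by omega : l n + 1 ≤ 2 + (l n / 2 + l n / 2))
        have h4 := hlow n
        have h5 : (w - 1) * S n ≤ ((2 + (l n / 2 + l n / 2) : ℕ) : ℝ) := by linarith
        have := mul_le_mul_of_nonneg_left h5 (Real.log_nonneg one_le_two)
        linarith
      rw [Real.exp_neg, ← div_eq_mul_inv, le_div_iff₀ (Real.exp_pos _), inv_mul_le_iff₀ (by positivity)]
      linarith
    have hE : Real.exp (S n * (- G n - (w - 1) * Real.log 2)) = Real.exp (- (S n * ((w - 1) * Real.log 2))) * (q (u n + 1) * q (u n + S n + 1))⁻¹ := by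
      rw [← expG n, ← Real.exp_neg, ← Real.exp_add]; ring_nf
    rw [hE]
    have hQi : 0 < (q (u n + 1) * q (u n + S n + 1))⁻¹ := inv_pos.2 (hQ0 n)
    have hfin := mul_le_mul_of_nonneg_right hzz hQi.le
    have p1 := mul_pos (he0 (u n + l n)) (he0 (u n + S n + l n + 1))
    have p2 := mul_pos (he0 (u n + l n + 1)) (he0 (u n + S n + l n))
    rw [abs_le]
    constructor <;> linarith
  · intro n
    rw [L2, abs_mul, sg, one_mul, mul_neg, Real.exp_neg, expH, inv_div]
    have h1 := heq (u n + S n)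
    have h2 := he1' (u n + S n)
    have h3 := hq0 (u n + 1)
    have h4 := hqm _ _ (Nat.le_succ (u n))
    have p1 : q (u n) * e (u n + S n + 1) ≤ q (u n + 1) * (1 / q (u n + S n + 1)) := mul_le_mul h4 h2 (he0 _).le h3.le
    have p2 : q (u n + 1) * e (u n + S n) ≤ q (u n + 1) * (1 / q (u n + S n + 1)) := mul_le_mul_of_nonneg_left h1 h3.le
    have p3 := mul_pos (hq0 (u n)) (he0 (u n + S n + 1))
    have p4 := mul_pos h3 (he0 (u n + S n))
    rw [mul_one_div] at p1 p2
    rw [abs_of_pos (by linarith)]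
    linarith
  · intro n
    rw [L3, abs_mul, sg, one_mul, expH]
    have h1 := heq (u n)
    have h2 := he1' (u n)
    have h3 := hq0 (u n + S n + 1)
    have h4 := hqm _ _ (Nat.le_succ (u n + S n))
    have p1 : e (u n) * q (u n + S n + 1) ≤ (1 / q (u n + 1)) * q (u n + S n + 1) := mul_le_mul_of_nonneg_right h1 h3.le
    have p2 : e (u n + 1) * q (u n + S n) ≤ (1 / q (u n + 1)) * q (u n + S n + 1) := mul_le_mul h2 h4 (hq0 _).le (by have := hq0 (u n + 1); positivity)
    have p3 := mul_pos (he0 (u n)) h3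
    have p4 := mul_pos (he0 (u n + 1)) (hq0 (u n + S n))
    rw [one_div_mul_eq_div] at p1 p2
    rw [abs_of_pos (by linarith)]
    linarith
  · intro n
    rw [x0, expG]
    have h1 := hqm _ _ (Nat.le_succ (u n))
    have h2 := hqm _ _ (Nat.le_succ (u n + S n))
    have p1 : q (u n) * q (u n + S n + 1) ≤ q (u n + 1) * q (u n + S n + 1) := mul_le_mul_of_nonneg_right h1 (hq0 _).le
    have p2 : q (u n + 1) * q (u n + S n) ≤ q (u n + 1) * q (u n + S n + 1) := mul_le_mul_of_nonneg_left h2 (hq0 _).le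
    have p3 := mul_pos (hq0 (u n)) (hq0 (u n + S n + 1))
    have p4 := mul_pos (hq0 (u n + 1)) (hq0 (u n + S n))
    rw [abs_le]
    constructor <;> linarith
  · have hb : ∀ n, (2:ℝ) ^ (n / 2) / 2 ≤ |α * x n 0 - x n 2| := by
      intro n
      rw [L3, abs_mul, sg, one_mul]
      have p4 := mul_pos (he0 (u n + 1)) (hq0 (u n + S n))
      have h3 := hq0 (u n + 1)
      have g1 := hqg (u n + 1) (S n)
      rw [show u n + 1 + S n = u n + S n + 1 by ring] at g1
      have g2 : (2:ℝ) ^ (n / 2) ≤ 2 ^ (S n / 2) := pow_le_pow_right₀ one_le_two (Nat.div_le_div_right (hSn n))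
      have p1 : (1 / (2 * q (u n + 1))) * (2 ^ (S n / 2) * q (u n + 1)) ≤ e (u n) * q (u n + S n + 1) :=
        mul_le_mul (heq2 _) g1 (by positivity) (he0 _).le
      have p2 : (1 / (2 * q (u n + 1))) * (2 ^ (S n / 2) * q (u n + 1)) = (2:ℝ) ^ (S n / 2) / 2 := by
        field_simp
      refine le_trans ?_ (le_abs_self _)
      linarith
    refine tendsto_atTop_mono hb ?_
    have h1 : Tendsto (fun n : ℕ => (2:ℝ) ^ (n / 2)) atTop atTop :=
      (tendsto_pow_atTop_atTop_of_one_lt one_lt_two).comp (Nat.tendsto_div_const_atTop two_ne_zero)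
    exact h1.atTop_div_const two_pos

end Sst


/-- Theorem 2: let `α = [0; a_1, a_2, …]` with convergents `p_ℓ/q_ℓ`, assume the
sequence `(q_ℓ^{1/ℓ})` is bounded, set `M = limsup q_ℓ^{1/ℓ}`, `m = liminf q_ℓ^{1/ℓ}`,
and let `w, w' ≥ 0` with `w > (2w'+1)·(log M / log m) − w'`.  If the partial
quotients satisfy Condition `(**)_{w,w'}`, then `α` is transcendental. -/
theorem statement2 (a : ℕ → ℕ) (hpos : ∀ i, 0 < a i) (α : ℝ)
    (hα : Tendsto (fun ℓ => (cfP a ℓ : ℝ) / (cfQ a ℓ : ℝ)) atTop (𝓝 α))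
    (hbdd : ∃ B : ℝ, ∀ ℓ : ℕ, 1 ≤ ℓ → (cfQ a ℓ : ℝ) ^ (1 / (ℓ : ℝ)) ≤ B)
    (M m : ℝ)
    (hM : M = limsup (fun ℓ : ℕ => (cfQ a ℓ : ℝ) ^ (1 / (ℓ : ℝ))) atTop)
    (hm : m = liminf (fun ℓ : ℕ => (cfQ a ℓ : ℝ) ^ (1 / (ℓ : ℝ))) atTop)
    (w w' : ℝ) (hw : 0 ≤ w) (hw' : 0 ≤ w')
    (hineq : w > (2 * w' + 1) * (Real.log M / Real.log m) - w')
    (hcond : ConditionStarStar a w w') :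
    Transcendental ℚ α := by
  obtain ⟨B, hB⟩ := hbdd
  subst hM hm
  intro halg
  exact Sst.main a hpos α hα B hB w w' (Sst.w_gt a hpos B hB w w' hw' hineq) hw' hcond halg
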